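/- Let q > 1, p > 0, and let Ω_t, t ∈ [0,T), be a smooth solution of the normalized Gauss curvature flow ∂h/∂t = −θ(t) h^p 𝒦 f / Ṽ_{γ,q}(Ω_t, ∇h + hx) + h (with f a positive smooth even function on S^{n−1}). Then the functional Φ(Ω_t) = (1/p) ∫_{S^{n−1}} f(x) h(x,t)^p dx is non-increasing in t, i.e. dΦ(Ω_t)/dt ≤ 0; equality at some time t holds if and only if the support function h(·,t) satisfies τ₁ Ṽ_{γ,q}(Ω_t, ∇h + hx) h^{1−p} det(∇²h + hI) = f on S^{n−1} with τ₁ = 1/θ(t). -/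

import Mathlib

open MeasureTheory Filter
open scoped RealInnerProductSpace Topology

noncomputable section

/-- `n`-dimensional Euclidean space. -/
abbrev Eucl (n : ℕ) := EuclideanSpace ℝ (Fin n)

/-- The support function of `K`, as a `1`-homogeneous function on all of `ℝⁿ`;
its restriction to the unit sphere is the usual support function `h_K`. -/
def suppFun {n : ℕ} (K : Set (Eucl n)) (x : Eucl n) : ℝ :=
  sSup ((fun y => ⟪x, y⟫) '' K)

/-- The radial function `ρ_K(ξ) = max {c > 0 : c • ξ ∈ K}`. -/
def radFun {n : ℕ} (K : Set (Eucl n)) (ξ : Eucl n) : ℝ :=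
  sSup {c : ℝ | 0 < c ∧ c • ξ ∈ K}

/-- `Ṽ_{γ,q}(K, y) = 2 e^{-|y|²/2} ∫_K e^{-|z|²/2} |z - y|^{-(n-q+1)} dz`. -/
def Vtilde {n : ℕ} (q : ℝ) (K : Set (Eucl n)) (y : Eucl n) : ℝ :=
  2 * Real.exp (-‖y‖ ^ 2 / 2) *
    ∫ z in K, Real.exp (-‖z‖ ^ 2 / 2) / ‖z - y‖ ^ ((n : ℝ) - q + 1)

/-- The Gaussian chord integral
`I_{γ,q}(K) = ∫_K ∫_K e^{-(|z|²+|y|²)/2} |z - y|^{-(n-q+1)} dz dy`. -/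
def gaussChord {n : ℕ} (q : ℝ) (K : Set (Eucl n)) : ℝ :=
  ∫ y in K, ∫ z in K,
    Real.exp (-(‖z‖ ^ 2 + ‖y‖ ^ 2) / 2) / ‖z - y‖ ^ ((n : ℝ) - q + 1)

/-- The rank-one map `v ↦ ⟪x, v⟫ • x` (orthogonal projection onto `ℝ x` when `‖x‖ = 1`). -/
def rankOne {n : ℕ} (x : Eucl n) : Eucl n →ₗ[ℝ] Eucl n where
  toFun v := ⟪x, v⟫ • x
  map_add' v w := by simp [inner_add_right, add_smul]
  map_smul' c v := by simp [inner_smul_right, mul_smul]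

/-- For the `1`-homogeneous extension `H` of the support function `h` of a smooth strictly
convex body, `fderiv ℝ (gradient H) x` vanishes on `ℝ x` and restricts on the tangent space
`x^⊥` to the matrix of principal radii of curvature `∇²h + h I`.  Adding the rank-one
projection onto `ℝ x` therefore makes the determinant of the ambient map equal to
`det(∇²h + h I)`, the reciprocal Gauss curvature. -/
def curvDet {n : ℕ} (H : Eucl n → ℝ) (x : Eucl n) : ℝ :=
  LinearMap.det
    ((fderiv ℝ (fun y => gradient H y) x : Eucl n →ₗ[ℝ] Eucl n) + rankOne x)

/-- A convex body in `ℝⁿ` which is origin-symmetric and has smooth, strictly convex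
boundary (encoded via smoothness of its support function away from the origin and
positivity of the curvature determinant on the sphere). -/
def IsSmoothBody {n : ℕ} (Ω : Set (Eucl n)) : Prop :=
  IsCompact Ω ∧ Convex ℝ Ω ∧ (0 : Eucl n) ∈ interior Ω ∧ (∀ x ∈ Ω, -x ∈ Ω) ∧
    ContDiffOn ℝ (⊤ : ℕ∞) (suppFun Ω) {(0 : Eucl n)}ᶜ ∧
    ∀ x ∈ Metric.sphere (0 : Eucl n) 1, 0 < curvDet (suppFun Ω) x

/-- The normalizing factor
`θ(t) = (∫_{S^{n-1}} Ṽ_{γ,q}(Ω, ρ(ξ)ξ) ρ(ξ)ⁿ dξ) / (∫_{S^{n-1}} h(x)^p f(x) dx)`. -/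
def theta {n : ℕ} (q p : ℝ) (f : Eucl n → ℝ) (K : Set (Eucl n)) : ℝ :=
  (∫ ξ in Metric.sphere (0 : Eucl n) 1,
      Vtilde q K (radFun K ξ • ξ) * radFun K ξ ^ n ∂μH[(n : ℝ) - 1]) /
  ∫ x in Metric.sphere (0 : Eucl n) 1, suppFun K x ^ p * f x ∂μH[(n : ℝ) - 1]

/-- The right-hand side `-θ h^p 𝒦 f / Ṽ_{γ,q}(K, ∇h + h x) + h` of the normalized Gauss
curvature flow, expressed through the `1`-homogeneous extension of the support function
(`gradient (suppFun K) x = ∇h(x) + h(x) x` and `𝒦 = (curvDet (suppFun K) x)⁻¹`). -/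
def flowRHS {n : ℕ} (q p : ℝ) (f : Eucl n → ℝ) (K : Set (Eucl n)) (x : Eucl n) : ℝ :=
  -(theta q p f K) * suppFun K x ^ p * (curvDet (suppFun K) x)⁻¹ * f x /
      Vtilde q K (gradient (suppFun K) x) + suppFun K x

/-- `K : ℝ → Set (Eucl n)` solves the normalized Gauss curvature flow
`∂h/∂t = -θ(t) h^p 𝒦 f / Ṽ_{γ,q} + h` on the time set `S`. -/
def IsGaussChordFlow {n : ℕ} (q p : ℝ) (f : Eucl n → ℝ) (S : Set ℝ)
    (K : ℝ → Set (Eucl n)) : Prop :=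
  ∀ t ∈ S, ∀ x ∈ Metric.sphere (0 : Eucl n) 1,
    HasDerivWithinAt (fun s => suppFun (K s) x) (flowRHS q p f (K t) x) S t

/-- The Wulff shape (Aleksandrov body) of a function `φ` on the unit sphere. -/
def wulff {n : ℕ} (φ : Eucl n → ℝ) : Set (Eucl n) :=
  {x | ∀ u ∈ Metric.sphere (0 : Eucl n) 1, ⟪x, u⟫ ≤ φ u}

/-- `ν` is a Gauss map of `∂K`: at every boundary point `y` of `K`, `ν y` is an outer
unit normal, i.e. `y · ν y = h_K(ν y)`. -/
def IsGaussMap {n : ℕ} (K : Set (Eucl n)) (ν : Eucl n → Eucl n) : Prop :=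
  ∀ y ∈ frontier K, ν y ∈ Metric.sphere (0 : Eucl n) 1 ∧ ⟪y, ν y⟫ = suppFun K (ν y)

section UniformMeasure

open Metric
open scoped NNReal ENNReal BoundedContinuousFunction

variable {X : Type*} [MetricSpace X] [CompactSpace X] [MeasurableSpace X] [BorelSpace X]

lemma lintegral_mul_measure_ball (μ ν : Measure X) [IsFiniteMeasure μ] [IsFiniteMeasure ν]
    {ψ : X → ℝ≥0∞} (hψ : Measurable ψ) (r : ℝ) :
    ∫⁻ x, ψ x * ν (ball x r) ∂μ = ∫⁻ y, (∫⁻ x in ball y r, ψ x ∂μ) ∂ν := by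
  have hset : MeasurableSet {z : X × X | dist z.1 z.2 < r} :=
    (isOpen_lt (continuous_fst.dist continuous_snd) continuous_const).measurableSet
  have hmeas : Measurable (fun z : X × X =>
      {z : X × X | dist z.1 z.2 < r}.indicator (fun z => ψ z.1) z) :=
    (hψ.comp measurable_fst).indicator hset
  calc ∫⁻ x, ψ x * ν (ball x r) ∂μ
      = ∫⁻ x, ∫⁻ y, {z : X × X | dist z.1 z.2 < r}.indicator (fun z => ψ z.1) (x, y) ∂ν ∂μ := by
        refine lintegral_congr fun x => ?_
        rw [← lintegral_indicator_const measurableSet_ball]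
        refine lintegral_congr fun y => ?_
        simp [Set.indicator, dist_comm]
    _ = ∫⁻ y, ∫⁻ x, {z : X × X | dist z.1 z.2 < r}.indicator (fun z => ψ z.1) (x, y) ∂μ ∂ν :=
        lintegral_lintegral_swap hmeas.aemeasurable
    _ = _ := by
        refine lintegral_congr fun y => ?_
        rw [← lintegral_indicator measurableSet_ball]
        refine lintegral_congr fun x => ?_
        simp [Set.indicator]

lemma lintegral_mul_measure_univ_le (μ ν : Measure X) [IsFiniteMeasure μ] [IsFiniteMeasure ν]
    (hμ : ∀ x y r, μ (ball x r) = μ (ball y r)) (hν : ∀ x y r, ν (ball x r) = ν (ball y r))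
    (φ : X →ᵇ ℝ≥0) :
    (∫⁻ x, φ x ∂μ) * ν Set.univ ≤ μ Set.univ * ∫⁻ x, φ x ∂ν := by
  rcases isEmpty_or_nonempty X with hX | ⟨⟨x₀⟩⟩
  · simp [Set.eq_empty_of_isEmpty]
  by_cases hν0 : ν Set.univ = 0
  · simp [hν0]
  have hpos : ∀ r : ℝ, 0 < r → ν (ball x₀ r) ≠ 0 := by
    intro r hr h0
    apply hν0
    obtain ⟨t, -, htf, ht⟩ := isCompact_univ.finite_cover_balls (X := X) hr
    refine measure_mono_null ht ((measure_biUnion_null_iff htf.countable).2 fun x _ => ?_)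
    rw [hν x x₀, h0]
  have hφm : Measurable (fun x => (φ x : ℝ≥0∞)) := by fun_prop
  have key : ∀ δ : ℝ≥0, 0 < δ → (∫⁻ x, φ x ∂μ) * ν Set.univ ≤
      μ Set.univ * ((∫⁻ x, φ x ∂ν) + δ * ν Set.univ) := by
    intro δ hδ
    obtain ⟨r, hr, hφr⟩ := Metric.uniformContinuous_iff.1
      (CompactSpace.uniformContinuous_of_continuous φ.continuous) δ hδ
    have h1 : μ Set.univ * ν (ball x₀ r) = μ (ball x₀ r) * ν Set.univ := by
      have := lintegral_mul_measure_ball μ ν (ψ := fun _ => 1) measurable_const r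
      simp only [one_mul, setLIntegral_const] at this
      rw [lintegral_congr (fun x => hν x x₀ r), lintegral_congr (fun x => hμ x x₀ r)] at this
      simpa [mul_comm] using this
    have h2 : (∫⁻ x, φ x ∂μ) * ν (ball x₀ r) ≤
        μ (ball x₀ r) * ((∫⁻ x, φ x ∂ν) + δ * ν Set.univ) := by
      have h := lintegral_mul_measure_ball μ ν hφm r
      rw [lintegral_congr (fun x => by rw [hν x x₀ r]), lintegral_mul_const _ hφm] at h
      rw [h]
      calc ∫⁻ y, (∫⁻ x in ball y r, φ x ∂μ) ∂ν
          ≤ ∫⁻ y, ((φ y : ℝ≥0∞) + δ) * μ (ball x₀ r) ∂ν := by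
            refine lintegral_mono fun y => ?_
            rw [← hμ y x₀ r, ← setLIntegral_const]
            refine setLIntegral_mono measurable_const fun x hx => ?_
            have h3 := hφr (a := x) (b := y) hx
            rw [NNReal.dist_eq] at h3
            have h4 := (abs_lt.1 h3).2
            have : φ x ≤ φ y + δ := by
              rw [← NNReal.coe_le_coe]; push_cast; linarith
            exact_mod_cast this
        _ = _ := by
            rw [lintegral_mul_const _ (by fun_prop), lintegral_add_right _ measurable_const]
            simp [mul_comm]
    have h3 : ((∫⁻ x, φ x ∂μ) * ν Set.univ) * ν (ball x₀ r) ≤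
        (μ Set.univ * ((∫⁻ x, φ x ∂ν) + δ * ν Set.univ)) * ν (ball x₀ r) := by
      calc ((∫⁻ x, φ x ∂μ) * ν Set.univ) * ν (ball x₀ r)
          = ((∫⁻ x, φ x ∂μ) * ν (ball x₀ r)) * ν Set.univ := by ring
        _ ≤ (μ (ball x₀ r) * ((∫⁻ x, φ x ∂ν) + δ * ν Set.univ)) * ν Set.univ := by gcongr
        _ = (μ (ball x₀ r) * ν Set.univ) * ((∫⁻ x, φ x ∂ν) + δ * ν Set.univ) := by ring
        _ = _ := by rw [← h1]; ring
    exact (ENNReal.mul_le_mul_iff_left (hpos r hr) (measure_ne_top _ _)).1 h3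
  have hlim : Tendsto (fun δ : ℝ≥0 => μ Set.univ * ((∫⁻ x, φ x ∂ν) + δ * ν Set.univ)) (𝓝[>] 0)
      (𝓝 (μ Set.univ * ((∫⁻ x, φ x ∂ν) + (0 : ℝ≥0) * ν Set.univ))) := by
    refine Tendsto.mono_left ?_ nhdsWithin_le_nhds
    refine ENNReal.Tendsto.const_mul (tendsto_const_nhds.add ?_) (Or.inr (measure_ne_top _ _))
    exact ENNReal.Tendsto.mul_const (ENNReal.tendsto_coe.2 tendsto_id)
      (Or.inr (measure_ne_top _ _))
  simp only [ENNReal.coe_zero, zero_mul, add_zero] at hlim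
  exact ge_of_tendsto hlim (eventually_mem_nhdsWithin.mono fun δ hδ => key δ hδ)

/-- Two nonzero finite uniformly distributed measures on a compact metric space are
proportional. -/
lemma exists_eq_smul_of_uniformlyDistributed (μ ν : Measure X)
    [IsFiniteMeasure μ] [IsFiniteMeasure ν] (hμ0 : μ ≠ 0) (hν0 : ν ≠ 0)
    (hμ : ∀ x y r, μ (ball x r) = μ (ball y r)) (hν : ∀ x y r, ν (ball x r) = ν (ball y r)) :
    ∃ c : ℝ≥0, 0 < c ∧ μ = c • ν := by
  have hμu : μ Set.univ ≠ 0 := by simpa using hμ0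
  have hνu : ν Set.univ ≠ 0 := by simpa using hν0
  refine ⟨(μ Set.univ / ν Set.univ).toNNReal, ?_, ?_⟩
  · exact ENNReal.toNNReal_pos (ENNReal.div_pos hμu (measure_ne_top _ _)).ne'
      (ENNReal.div_ne_top (measure_ne_top _ _) hνu)
  refine ext_of_forall_lintegral_eq_of_IsFiniteMeasure fun φ => ?_
  have h := le_antisymm (lintegral_mul_measure_univ_le μ ν hμ hν φ)
    ((mul_comm _ _).trans_le ((lintegral_mul_measure_univ_le ν μ hν hμ φ).trans_eq (mul_comm _ _)))
  rw [lintegral_smul_measure, ENNReal.smul_def, smul_eq_mul,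
    ENNReal.coe_toNNReal (ENNReal.div_ne_top (measure_ne_top _ _) hνu),
    ENNReal.div_eq_inv_mul, mul_assoc, ← h, mul_comm _ (ν Set.univ), ← mul_assoc,
    ENNReal.inv_mul_cancel hνu (measure_ne_top _ _), one_mul]

end UniformMeasure

section SphereMeasure

open Metric
open scoped NNReal ENNReal Pointwise

lemma hausdorffMeasure_sphere_lt_top (m : ℕ) :
    (μH[(m : ℝ)] : Measure (Eucl (m + 1))) (sphere 0 1) < ⊤ := by
  let g : Fin (m + 1) × Bool → (Fin m → ℝ) → Eucl (m + 1) := fun a z =>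
    WithLp.toLp 2 (Fin.insertNth a.1 (if a.2 then (1 : ℝ) else -1) z)
  let φ : Fin (m + 1) × Bool → (Fin m → ℝ) → Eucl (m + 1) := fun a z => ‖g a z‖⁻¹ • g a z
  have hg : ∀ a, ContDiff ℝ 1 (g a) := by
    intro a
    rw [contDiff_euclidean]
    intro j
    rcases eq_or_ne j a.1 with rfl | hj
    · simpa [g] using contDiff_const
    · obtain ⟨k, rfl⟩ := Fin.exists_succAbove_eq hj
      simpa [g] using contDiff_apply ℝ ℝ k
  have hg0 : ∀ a z, g a z ≠ 0 := by
    intro a z h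
    have := congrArg (fun v : Eucl (m + 1) => v a.1) h
    simp only [g, Fin.insertNth_apply_same, PiLp.zero_apply] at this
    split_ifs at this <;> norm_num at this
  have hφ : ∀ a, ContDiff ℝ 1 (φ a) := fun a =>
    contDiff_iff_contDiffAt.2 fun z =>
      (((hg a).contDiffAt.norm ℝ (hg0 a z)).inv (norm_ne_zero_iff.2 (hg0 a z))).smul
        (hg a).contDiffAt
  have hlip : ∀ a, ∃ C, LipschitzOnWith C (φ a) (Set.Icc (-1) 1) := fun a =>
    LocallyLipschitzOn.exists_lipschitzOnWith_of_compact isCompact_Icc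
      (hφ a).locallyLipschitz.locallyLipschitzOn
  have hcover : sphere (0 : Eucl (m + 1)) 1 ⊆ ⋃ a, φ a '' Set.Icc (-1) 1 := by
    intro x hx
    have hx1 : ‖x‖ = 1 := by simpa using hx
    obtain ⟨i, -, hi⟩ := Finset.exists_max_image Finset.univ (fun i => |x i|) ⟨0, Finset.mem_univ _⟩
    have hxi : 0 < |x i| := by
      by_contra h
      have : x = 0 := by
        ext j
        exact abs_eq_zero.1 (le_antisymm ((hi j (Finset.mem_univ _)).trans (not_lt.1 h))
          (abs_nonneg _))
      simp [this] at hx1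
    have hgx : g (i, decide (0 < x i)) (fun j => |x i|⁻¹ * x (i.succAbove j)) = |x i|⁻¹ • x := by
      ext j
      rcases eq_or_ne j i with rfl | hj
      · rcases lt_or_gt_of_ne (abs_pos.1 hxi) with h | h
        · have : ¬ 0 < x j := not_lt.2 h.le
          simp [g, this, abs_of_neg h, inv_neg, inv_mul_cancel₀ h.ne]
        · simp [g, h, abs_of_pos h, inv_mul_cancel₀ h.ne']
      · obtain ⟨k, rfl⟩ := Fin.exists_succAbove_eq hj
        simp [g]
    refine Set.mem_iUnion.2 ⟨(i, decide (0 < x i)), fun j => |x i|⁻¹ * x (i.succAbove j), ?_, ?_⟩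
    · have : ∀ j, |(|x i|⁻¹ * x (i.succAbove j))| ≤ 1 := by
        intro j
        rw [abs_mul, abs_inv, abs_abs, inv_mul_le_iff₀ hxi, mul_one]
        exact hi _ (Finset.mem_univ _)
      exact ⟨fun j => (abs_le.1 (this j)).1, fun j => (abs_le.1 (this j)).2⟩
    · simp only [φ, hgx, norm_smul, hx1, norm_inv, Real.norm_eq_abs, abs_abs, mul_one, inv_inv,
        smul_smul, mul_inv_cancel₀ hxi.ne', one_smul]
  refine (measure_mono hcover).trans_lt ((measure_iUnion_le _).trans_lt ?_)
  rw [tsum_fintype]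
  refine ENNReal.sum_lt_top.2 fun a _ => ?_
  obtain ⟨C, hC⟩ := hlip a
  refine (hC.hausdorffMeasure_image_le (Nat.cast_nonneg m)).trans_lt ?_
  refine ENNReal.mul_lt_top (by simp) ?_
  have := hausdorffMeasure_pi_real (ι := Fin m)
  rw [Fintype.card_fin] at this
  rw [this]
  exact isCompact_Icc.measure_lt_top

lemma hausdorffMeasure_sphere_pos (m : ℕ) :
    0 < (μH[(m : ℝ)] : Measure (Eucl (m + 1))) (sphere 0 1) := by
  let P : Eucl (m + 1) → (Fin m → ℝ) := fun x j => x j.succ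
  have hP : LipschitzWith 1 P := by
    refine LipschitzWith.of_dist_le_mul fun x y => ?_
    rw [NNReal.coe_one, one_mul, dist_pi_le_iff dist_nonneg]
    intro j
    rw [dist_eq_norm, dist_eq_norm]
    exact PiLp.norm_apply_le (x - y) j.succ
  have hsub : ball (0 : Fin m → ℝ) (1 / (m + 1)) ⊆ P '' sphere 0 1 := by
    intro z hz
    have hzj : ∀ j, z j ^ 2 ≤ 1 / (m + 1) := by
      intro j
      have h1 : |z j| < 1 / (m + 1) := by
        have := (norm_le_pi_norm z j).trans_lt (mem_ball_zero_iff.1 hz)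
        simpa using this
      have h2 : (1 : ℝ) / (m + 1) ≤ 1 := by
        rw [div_le_one (by positivity)]; linarith [(Nat.cast_nonneg m : (0 : ℝ) ≤ m)]
      rw [← sq_abs]
      nlinarith [abs_nonneg (z j)]
    have hsum : ∑ j, z j ^ 2 ≤ 1 := by
      refine (Finset.sum_le_sum fun j _ => hzj j).trans ?_
      rw [Finset.sum_const, Finset.card_univ, Fintype.card_fin, nsmul_eq_mul, mul_one_div,
        div_le_one (by positivity)]
      linarith
    refine ⟨WithLp.toLp 2 (Fin.cons (√(1 - ∑ j, z j ^ 2)) z), ?_, ?_⟩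
    · rw [mem_sphere_zero_iff_norm, EuclideanSpace.norm_eq, Fin.sum_univ_succ]
      simp [Real.sq_sqrt (sub_nonneg.2 hsum)]
    · ext j
      simp [P]
  have hpos : 0 < (μH[(m : ℝ)] : Measure (Fin m → ℝ)) (ball 0 (1 / (m + 1))) := by
    have := hausdorffMeasure_pi_real (ι := Fin m)
    rw [Fintype.card_fin] at this
    rw [this]
    exact measure_ball_pos _ _ (by positivity)
  have := (measure_mono hsub).trans (hP.hausdorffMeasure_image_le (Nat.cast_nonneg m) (sphere 0 1))
  simp only [ENNReal.coe_one, ENNReal.one_rpow, one_mul] at this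
  exact hpos.trans_le this

/-- The `(n-1)`-dimensional Hausdorff measure, as a measure on the unit sphere of `ℝⁿ`. -/
def sphereMeasure (n : ℕ) : Measure (sphere (0 : Eucl n) 1) :=
  (μH[(n : ℝ) - 1] : Measure (Eucl n)).comap (↑)

lemma sphereMeasure_apply {n : ℕ} (s : Set (sphere (0 : Eucl n) 1)) :
    sphereMeasure n s = μH[(n : ℝ) - 1] ((↑) '' s : Set (Eucl n)) :=
  comap_subtype_coe_apply isClosed_sphere.measurableSet _ _

lemma setIntegral_sphere {n : ℕ} (g : Eucl n → ℝ) :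
    ∫ x in sphere (0 : Eucl n) 1, g x ∂μH[(n : ℝ) - 1] = ∫ x, g x ∂sphereMeasure n :=
  (integral_subtype_comap isClosed_sphere.measurableSet g).symm

lemma exists_isometry_sphere {n : ℕ} (x y : sphere (0 : Eucl n) 1) :
    ∃ L : Eucl n ≃ₗᵢ[ℝ] Eucl n, L x = y :=
  ⟨_, Submodule.reflection_sub (by rw [norm_eq_of_mem_sphere, norm_eq_of_mem_sphere])⟩

lemma image_ball_sphere {n : ℕ} (x y : sphere (0 : Eucl n) 1) {L : Eucl n ≃ₗᵢ[ℝ] Eucl n}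
    (hL : L x = y) (r : ℝ) :
    L '' ((↑) '' ball x r) = ((↑) '' ball y r : Set (Eucl n)) := by
  ext z
  simp only [Set.mem_image, mem_ball, Subtype.exists, mem_sphere_iff_norm, sub_zero,
    exists_and_right, exists_eq_right, Subtype.dist_eq]
  constructor
  · rintro ⟨w, ⟨hw, hwr⟩, rfl⟩
    exact ⟨by simpa using hw, by rwa [← hL, L.dist_map]⟩
  · rintro ⟨hz, hzr⟩
    refine ⟨L.symm z, ⟨by simpa using hz, ?_⟩, by simp⟩
    rwa [← L.dist_map, hL, L.apply_symm_apply]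

lemma isFiniteMeasure_sphereMeasure {n : ℕ} (hn : n ≠ 0) : IsFiniteMeasure (sphereMeasure n) := by
  obtain ⟨m, rfl⟩ := Nat.exists_eq_succ_of_ne_zero hn
  refine ⟨?_⟩
  have h : ((m.succ : ℕ) : ℝ) - 1 = m := by push_cast; ring
  rw [sphereMeasure_apply, Set.image_univ, Subtype.range_coe, h]
  exact hausdorffMeasure_sphere_lt_top m

/-- The Hausdorff measure on the sphere is a multiple of the measure of polar coordinates. -/
lemma exists_sphereMeasure_eq_smul_toSphere {n : ℕ} (hn : n ≠ 0) :
    ∃ c : ℝ≥0, 0 < c ∧ sphereMeasure n = c • (volume : Measure (Eucl n)).toSphere := by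
  have := isFiniteMeasure_sphereMeasure hn
  obtain ⟨m, rfl⟩ := Nat.exists_eq_succ_of_ne_zero hn
  refine exists_eq_smul_of_uniformlyDistributed _ _ ?_ (Measure.toSphere_ne_zero _) ?_ ?_
  · intro h
    have h1 := sphereMeasure_apply (n := m + 1) Set.univ
    simp only [Nat.succ_eq_add_one] at h
    simp only [h, Measure.coe_zero, Pi.zero_apply, Set.image_univ, Subtype.range_coe] at h1
    have h2 := hausdorffMeasure_sphere_pos m
    push_cast at h1
    rw [add_sub_cancel_right] at h1
    exact h2.ne h1
  · intro x y r
    obtain ⟨L, hL⟩ := exists_isometry_sphere x y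
    rw [sphereMeasure_apply, sphereMeasure_apply, ← image_ball_sphere x y hL]
    exact (L.toIsometryEquiv.hausdorffMeasure_image _ _).symm
  · intro x y r
    obtain ⟨L, hL⟩ := exists_isometry_sphere x y
    rw [Measure.toSphere_apply' _ measurableSet_ball, Measure.toSphere_apply' _ measurableSet_ball,
      ← image_ball_sphere x y hL]
    congr 1
    have h1 : Set.Ioo (0 : ℝ) 1 • (L '' ((↑) '' ball x r)) =
        L '' (Set.Ioo (0 : ℝ) 1 • ((↑) '' ball x r)) := by
      ext z
      simp only [Set.mem_smul, Set.mem_image]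
      constructor
      · rintro ⟨a, ha, _, ⟨w, hw, rfl⟩, rfl⟩
        exact ⟨a • w, ⟨a, ha, w, hw, rfl⟩, by simp⟩
      · rintro ⟨_, ⟨a, ha, w, hw, rfl⟩, rfl⟩
        exact ⟨a, ha, L w, ⟨w, hw, rfl⟩, by simp⟩
    rw [h1, LinearIsometryEquiv.image_eq_preimage_symm]
    exact (L.symm.measurePreserving.measure_preimage_equiv (f := L.symm.toMeasurableEquiv) _).symm

lemma isOpenPosMeasure_sphereMeasure {n : ℕ} (hn : n ≠ 0) :
    (sphereMeasure n).IsOpenPosMeasure := by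
  obtain ⟨c, hc, h⟩ := exists_sphereMeasure_eq_smul_toSphere hn
  rw [h]
  refine ⟨fun U hU hU' => ?_⟩
  rw [Measure.smul_apply]
  simpa [hc.ne', ENNReal.smul_def] using hU.measure_ne_zero (volume.toSphere) hU'

end SphereMeasure

section DetCompare

variable {n : ℕ}

/-- A symmetric operator whose quadratic form dominates a diagonal one has larger determinant. -/
lemma prod_le_det_of_quadForm_le {T : Eucl n →ₗ[ℝ] Eucl n} (hT : T.IsSymmetric)
    (b : OrthonormalBasis (Fin n) ℝ (Eucl n)) {ν : Fin n → ℝ} (hν : ∀ i, 0 < ν i)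
    (h : ∀ v, ∑ i, ν i * ⟪b i, v⟫ ^ 2 ≤ ⟪T v, v⟫) :
    ∏ i, ν i ≤ LinearMap.det T := by
  let d : Fin n → ℝ := fun i => (√(ν i))⁻¹
  have hd : ∀ i, 0 < d i := fun i => inv_pos.2 (Real.sqrt_pos.2 (hν i))
  have hdν : ∀ i, d i ^ 2 * ν i = 1 := fun i => by
    simp only [d, inv_pow, Real.sq_sqrt (hν i).le]
    exact inv_mul_cancel₀ (hν i).ne'
  let R : Eucl n →ₗ[ℝ] Eucl n := Matrix.toLin b.toBasis b.toBasis (Matrix.diagonal d)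
  have hRdet : LinearMap.det R = ∏ i, d i := by
    simp only [R, LinearMap.det_toLin, Matrix.det_diagonal]
  have hRb : ∀ i v, ⟪b i, R v⟫ = d i * ⟪b i, v⟫ := by
    intro i v
    rw [← b.repr_apply_apply, ← b.repr_apply_apply, ← b.coe_toBasis_repr_apply,
      ← b.coe_toBasis_repr_apply]
    simp only [R]
    rw [← LinearMap.toMatrix_mulVec_repr b.toBasis b.toBasis, LinearMap.toMatrix_toLin,
      Matrix.mulVec_diagonal]
  have hRsym : R.IsSymmetric := by
    intro v w
    rw [← b.sum_inner_mul_inner, ← b.sum_inner_mul_inner v]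
    refine Finset.sum_congr rfl fun i _ => ?_
    rw [real_inner_comm, hRb, hRb, real_inner_comm v]
    ring
  let U : Eucl n →ₗ[ℝ] Eucl n := R ∘ₗ T ∘ₗ R
  have hUsym : U.IsSymmetric := by
    intro v w
    simp only [U, LinearMap.comp_apply]
    rw [hRsym, hT, hRsym]
  have hUge : ∀ v, ‖v‖ ^ 2 ≤ ⟪U v, v⟫ := by
    intro v
    simp only [U, LinearMap.comp_apply]
    rw [hRsym]
    refine le_trans (le_of_eq ?_) (h (R v))
    rw [← b.sum_sq_norm_inner_right]
    refine Finset.sum_congr rfl fun i _ => ?_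
    rw [hRb, mul_pow, Real.norm_eq_abs, sq_abs, ← mul_assoc, mul_comm (ν i), hdν, one_mul]
  have hn : Module.finrank ℝ (Eucl n) = n := by simp
  have hdetU : 1 ≤ LinearMap.det U := by
    rw [hUsym.det_eq_prod_eigenvalues hn]
    rw [← Finset.prod_const_one (s := Finset.univ (α := Fin n))]
    refine Finset.prod_le_prod (fun _ _ => zero_le_one) fun i _ => ?_
    have h1 := hUge (hUsym.eigenvectorBasis hn i)
    rw [hUsym.apply_eigenvectorBasis hn i] at h1
    simpa [inner_smul_left] using h1
  simp only [U, LinearMap.det_comp, hRdet] at hdetU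
  have h1 : (∏ i, d i) * (LinearMap.det T * ∏ i, d i) * ∏ i, ν i = LinearMap.det T := by
    have : (∏ i, d i) * (∏ i, d i) * ∏ i, ν i = 1 := by
      rw [← Finset.prod_mul_distrib, ← Finset.prod_mul_distrib]
      exact Finset.prod_eq_one fun i _ => by rw [← sq]; exact hdν i
    linear_combination (LinearMap.det T) * this
  rw [← h1]
  exact le_mul_of_one_le_left (Finset.prod_pos fun i _ => hν i).le hdetU

lemma eigenvalues_pos_of_det_pos {T : Eucl n →ₗ[ℝ] Eucl n} (hT : T.IsSymmetric)
    (hn : Module.finrank ℝ (Eucl n) = n)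
    (hpsd : ∀ v, 0 ≤ ⟪T v, v⟫) (hdet : 0 < LinearMap.det T) (i : Fin n) :
    0 < hT.eigenvalues hn i := by
  have h0 : 0 ≤ hT.eigenvalues hn i := by
    have := hpsd (hT.eigenvectorBasis hn i)
    rw [hT.apply_eigenvectorBasis hn i] at this
    simpa [inner_smul_left] using this
  refine h0.lt_of_ne fun h => hdet.ne' ?_
  rw [hT.det_eq_prod_eigenvalues hn]
  exact Finset.prod_eq_zero (Finset.mem_univ i) h.symm

lemma inner_self_eq_sum_eigenvalues {T : Eucl n →ₗ[ℝ] Eucl n} (hT : T.IsSymmetric)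
    (hn : Module.finrank ℝ (Eucl n) = n) (v : Eucl n) :
    ⟪T v, v⟫ = ∑ i, hT.eigenvalues hn i * ⟪hT.eigenvectorBasis hn i, v⟫ ^ 2 := by
  rw [← (hT.eigenvectorBasis hn).sum_inner_mul_inner]
  refine Finset.sum_congr rfl fun i _ => ?_
  rw [hT, hT.apply_eigenvectorBasis hn i, inner_smul_right, real_inner_comm v]
  simp
  ring

/-- If `T' ≥ α T` then `det T' ≥ αⁿ det T`. -/
lemma pow_mul_det_le_det {T T' : Eucl n →ₗ[ℝ] Eucl n} (hT : T.IsSymmetric)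
    (hT' : T'.IsSymmetric) (hpsd : ∀ v, 0 ≤ ⟪T v, v⟫) (hdet : 0 < LinearMap.det T)
    {α : ℝ} (hα : 0 < α) (h : ∀ v, α * ⟪T v, v⟫ ≤ ⟪T' v, v⟫) :
    α ^ n * LinearMap.det T ≤ LinearMap.det T' := by
  have hn : Module.finrank ℝ (Eucl n) = n := by simp
  have := prod_le_det_of_quadForm_le hT' (hT.eigenvectorBasis hn)
    (ν := fun i => α * hT.eigenvalues hn i)
    (fun i => mul_pos hα (eigenvalues_pos_of_det_pos hT hn hpsd hdet i)) (fun v => by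
      refine le_trans (le_of_eq ?_) (h v)
      rw [inner_self_eq_sum_eigenvalues hT hn, Finset.mul_sum]
      exact Finset.sum_congr rfl fun i _ => by ring)
  rw [Finset.prod_mul_distrib] at this
  rw [hT.det_eq_prod_eigenvalues hn]
  simpa using this

/-- Let `x` be a unit vector fixed by `T`.  If `T' ≥ α T + s (1 - x ⊗ x)`, then either `det T` is
bounded below or `det T'` exceeds `αⁿ det T` by a definite factor. -/
lemma pow_le_det_or_mul_det_le_det {T T' : Eucl n →ₗ[ℝ] Eucl n} (hT : T.IsSymmetric)
    (hT' : T'.IsSymmetric) (hpsd : ∀ v, 0 ≤ ⟪T v, v⟫) (hdet : 0 < LinearMap.det T)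
    {x : Eucl n} (hx : T x = x)
    {α s : ℝ} (hα : 0 < α) (hs : 0 ≤ s)
    (h : ∀ v, α * ⟪T v, v⟫ + s * (‖v‖ ^ 2 - ⟪x, v⟫ ^ 2) ≤ ⟪T' v, v⟫)
    (hx1 : ‖x‖ = 1) {m : ℝ} (hm : 0 < m) (hm1 : m < 1) :
    m ^ n ≤ LinearMap.det T ∨
      α ^ n * LinearMap.det T * (1 + s / (α * m)) ≤ LinearMap.det T' := by
  have hn : Module.finrank ℝ (Eucl n) = n := by simp
  have hpos := eigenvalues_pos_of_det_pos hT hn hpsd hdet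
  by_cases hall : ∀ i, m ≤ hT.eigenvalues hn i
  · left
    rw [hT.det_eq_prod_eigenvalues hn]
    calc m ^ n = ∏ _i : Fin n, m := by simp
      _ ≤ _ := Finset.prod_le_prod (fun _ _ => hm.le) (fun i _ => hall i)
  · right
    push Not at hall
    obtain ⟨k, hk⟩ := hall
    set b := hT.eigenvectorBasis hn with hb
    set μ := hT.eigenvalues hn with hμ
    have hbx : ⟪x, b k⟫ = 0 := by
      have h1 : ⟪T x, b k⟫ = ⟪x, T (b k)⟫ := hT x (b k)
      rw [hx, hb, hT.apply_eigenvectorBasis hn k, inner_smul_right, ← hb] at h1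
      have h2 : (1 - μ k) * ⟪x, b k⟫ = 0 := by
        simp only [RCLike.ofReal_real_eq_id, id_eq] at h1
        rw [sub_mul, one_mul, sub_eq_zero]
        exact h1
      exact (mul_eq_zero.1 h2).resolve_left (by linarith)
    have hbess : ∀ v, ⟪b k, v⟫ ^ 2 ≤ ‖v‖ ^ 2 - ⟪x, v⟫ ^ 2 := by
      intro v
      set w := v - ⟪x, v⟫ • x
      have h1 : ⟪b k, w⟫ = ⟪b k, v⟫ := by
        simp [w, inner_sub_right, inner_smul_right, real_inner_comm x, hbx]
      have h2 : ‖w‖ ^ 2 = ‖v‖ ^ 2 - ⟪x, v⟫ ^ 2 := by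
        rw [norm_sub_sq_real, inner_smul_right, norm_smul, mul_pow, hx1, real_inner_comm v x]
        simp
        ring
      rw [← h2, ← h1]
      have h3 := abs_real_inner_le_norm (b k) w
      rw [b.norm_eq_one, one_mul] at h3
      exact sq_le_sq.2 (by rwa [abs_norm])
    have hν : ∀ i, 0 < α * μ i + (if i = k then s else 0) := by
      intro i
      have := mul_pos hα (hpos i)
      split_ifs <;> linarith
    have key := prod_le_det_of_quadForm_le hT' b hν (fun v => by
      refine le_trans ?_ (h v)
      rw [inner_self_eq_sum_eigenvalues hT hn, Finset.mul_sum]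
      simp only [add_mul, ite_mul, zero_mul, Finset.sum_add_distrib, Finset.sum_ite_eq',
        Finset.mem_univ, if_true]
      refine add_le_add (le_of_eq (Finset.sum_congr rfl fun i _ => by ring)) ?_
      exact mul_le_mul_of_nonneg_left (hbess v) hs)
    refine le_trans ?_ key
    have hprod : ∏ i, (α * μ i + (if i = k then s else 0)) =
        α ^ n * LinearMap.det T * (1 + s / (α * μ k)) := by
      have h1 : ∀ i, α * μ i + (if i = k then s else 0) =
          (α * μ i) * (if i = k then 1 + s / (α * μ k) else 1) := by
        intro i
        split_ifs with hi
        · subst hi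
          have := (mul_pos hα (hpos i)).ne'
          rw [mul_add, mul_one, mul_div_cancel₀ _ this]
        · ring
      simp_rw [h1]
      rw [Finset.prod_mul_distrib, Finset.prod_mul_distrib, hT.det_eq_prod_eigenvalues hn]
      simp [hμ]
    rw [hprod]
    have hμk := hpos k
    have : 0 < α ^ n * LinearMap.det T := by positivity
    gcongr

end DetCompare

section SuppFun

variable {n : ℕ} {K L : Set (Eucl n)}

lemma bddAbove_inner_image (hK : IsCompact K) (x : Eucl n) :
    BddAbove ((fun y => ⟪x, y⟫) '' K) :=
  (hK.image (by fun_prop)).bddAbove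

lemma inner_le_suppFun (hK : IsCompact K) (x : Eucl n) {y : Eucl n} (hy : y ∈ K) :
    ⟪x, y⟫ ≤ suppFun K x :=
  le_csSup (bddAbove_inner_image hK x) (Set.mem_image_of_mem _ hy)

lemma exists_inner_eq_suppFun (hK : IsCompact K) (hne : K.Nonempty) (x : Eucl n) :
    ∃ y ∈ K, ⟪x, y⟫ = suppFun K x := by
  obtain ⟨y, hy, hmax⟩ := (hK.image (f := fun y => ⟪x, y⟫) (by fun_prop)).sSup_mem (hne.image _)
  exact ⟨y, hy, hmax⟩

lemma suppFun_le (hK : IsCompact K) (hne : K.Nonempty) {x : Eucl n} {a : ℝ}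
    (h : ∀ y ∈ K, ⟪x, y⟫ ≤ a) : suppFun K x ≤ a := by
  obtain ⟨y, hy, h1⟩ := exists_inner_eq_suppFun hK hne x
  exact h1 ▸ h y hy

lemma suppFun_smul (hK : IsCompact K) (hne : K.Nonempty) {c : ℝ} (hc : 0 ≤ c) (x : Eucl n) :
    suppFun K (c • x) = c * suppFun K x := by
  refine le_antisymm (suppFun_le hK hne fun y hy => ?_) ?_
  · rw [real_inner_smul_left]
    exact mul_le_mul_of_nonneg_left (inner_le_suppFun hK x hy) hc
  · obtain ⟨y, hy, h1⟩ := exists_inner_eq_suppFun hK hne x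
    rw [← h1, ← real_inner_smul_left]
    exact inner_le_suppFun hK _ hy

lemma suppFun_zero (hK : IsCompact K) (hne : K.Nonempty) : suppFun K 0 = 0 := by
  simpa using suppFun_smul hK hne (c := 0) le_rfl 0

lemma suppFun_sub_le (hK : IsCompact K) (hne : K.Nonempty) {R : ℝ} (hR : ∀ z ∈ K, ‖z‖ ≤ R)
    (x y : Eucl n) : suppFun K x - suppFun K y ≤ R * ‖x - y‖ := by
  obtain ⟨z, hz, h1⟩ := exists_inner_eq_suppFun hK hne x
  have h2 := inner_le_suppFun hK y hz
  have h3 : ⟪x - y, z⟫ ≤ ‖x - y‖ * R :=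
    (real_inner_le_norm _ _).trans (mul_le_mul_of_nonneg_left (hR z hz) (norm_nonneg _))
  rw [inner_sub_left] at h3
  linarith

lemma abs_suppFun_sub_le (hK : IsCompact K) (hne : K.Nonempty) {R : ℝ} (hR : ∀ z ∈ K, ‖z‖ ≤ R)
    (x y : Eucl n) : |suppFun K x - suppFun K y| ≤ R * ‖x - y‖ := by
  rw [abs_le]
  have h1 := suppFun_sub_le hK hne hR x y
  have h2 := suppFun_sub_le hK hne hR y x
  rw [norm_sub_rev] at h2
  constructor <;> linarith

lemma norm_le_of_suppFun_le (hK : IsCompact K) {R : ℝ} (hR : 0 ≤ R)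
    (h : ∀ x ∈ Metric.sphere (0 : Eucl n) 1, suppFun K x ≤ R) {z : Eucl n} (hz : z ∈ K) :
    ‖z‖ ≤ R := by
  rcases eq_or_ne z 0 with rfl | hz0
  · simpa using hR
  have h1 := (inner_le_suppFun hK (‖z‖⁻¹ • z) hz).trans (h _ (by simp [norm_smul, hz0]))
  rwa [real_inner_smul_left, real_inner_self_eq_norm_sq, sq, ← mul_assoc,
    inv_mul_cancel₀ (norm_ne_zero_iff.2 hz0), one_mul] at h1

lemma exists_forall_norm_le (hK : IsCompact K) : ∃ R : ℝ, 0 < R ∧ ∀ z ∈ K, ‖z‖ ≤ R := by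
  obtain ⟨R, hR⟩ := hK.isBounded.exists_norm_le
  exact ⟨max R 1, by positivity, fun z hz => (hR z hz).trans (le_max_left _ _)⟩

lemma continuous_suppFun (hK : IsCompact K) (hne : K.Nonempty) : Continuous (suppFun K) := by
  obtain ⟨R, hR0, hR⟩ := exists_forall_norm_le hK
  refine (LipschitzWith.of_dist_le_mul (K := ⟨R, hR0.le⟩) fun x y => ?_).continuous
  rw [Real.dist_eq, dist_eq_norm]
  exact abs_suppFun_sub_le hK hne hR x y

lemma inner_lt_suppFun_of_mem_interior (hK : IsCompact K) {x z : Eucl n} (hx : x ≠ 0)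
    (hz : z ∈ interior K) : ⟪x, z⟫ < suppFun K x := by
  have h1 : ∀ᶠ ε : ℝ in 𝓝[>] 0, z + ε • x ∈ K := by
    have : Tendsto (fun ε : ℝ => z + ε • x) (𝓝 0) (𝓝 z) := by
      have : Continuous fun ε : ℝ => z + ε • x := by fun_prop
      simpa using this.tendsto 0
    exact (this.eventually (mem_interior_iff_mem_nhds.1 hz)).filter_mono nhdsWithin_le_nhds
  obtain ⟨ε, hε, hε0⟩ := (h1.and self_mem_nhdsWithin).exists
  have h2 := inner_le_suppFun hK x hε
  rw [inner_add_right, real_inner_smul_right, real_inner_self_eq_norm_sq] at h2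
  have : 0 < ε * ‖x‖ ^ 2 := mul_pos hε0 (by positivity)
  linarith

lemma suppFun_pos (hK : IsCompact K) (h0 : (0 : Eucl n) ∈ interior K) {x : Eucl n} (hx : x ≠ 0) :
    0 < suppFun K x := by
  simpa using inner_lt_suppFun_of_mem_interior hK hx h0

lemma exists_suppFun_lt_inner (hK : IsCompact K) (hc : Convex ℝ K) (hne : K.Nonempty)
    {z : Eucl n} (hz : z ∉ K) : ∃ x ∈ Metric.sphere (0 : Eucl n) 1, suppFun K x < ⟪x, z⟫ := by
  obtain ⟨f, u, h1, h2⟩ := geometric_hahn_banach_closed_point hc hK.isClosed hz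
  set w := (InnerProductSpace.toDual ℝ (Eucl n)).symm f with hw
  have hfw : ∀ y, f y = ⟪w, y⟫ := fun y => by rw [hw, InnerProductSpace.toDual_symm_apply]
  have h3 : suppFun K w < ⟪w, z⟫ := by
    obtain ⟨y, hy, h3⟩ := exists_inner_eq_suppFun hK hne w
    rw [← h3, ← hfw, ← hfw]
    exact (h1 y hy).trans h2
  have hw0 : w ≠ 0 := by
    intro h
    rw [h, suppFun_zero hK hne, inner_zero_left] at h3
    exact h3.false
  have hpos : 0 < ‖w‖⁻¹ := by positivity
  refine ⟨‖w‖⁻¹ • w, by simp [norm_smul, hw0], ?_⟩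
  rw [suppFun_smul hK hne hpos.le, real_inner_smul_left]
  exact mul_lt_mul_of_pos_left h3 hpos

lemma mem_of_forall_inner_le_suppFun (hK : IsCompact K) (hc : Convex ℝ K) (hne : K.Nonempty)
    {z : Eucl n} (h : ∀ x ∈ Metric.sphere (0 : Eucl n) 1, ⟪x, z⟫ ≤ suppFun K x) : z ∈ K := by
  by_contra hz
  obtain ⟨x, hx, h1⟩ := exists_suppFun_lt_inner hK hc hne hz
  exact (h x hx).not_gt h1

lemma ne_zero_of_mem_sphere_one {x : Eucl n} (hx : x ∈ Metric.sphere (0 : Eucl n) 1) : x ≠ 0 := by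
  rintro rfl
  simp at hx

lemma exists_inner_eq_suppFun_of_mem_frontier (hK : IsCompact K) (hc : Convex ℝ K)
    (hne : K.Nonempty) {z : Eucl n} (hz : z ∈ frontier K) :
    ∃ x ∈ Metric.sphere (0 : Eucl n) 1, ⟪x, z⟫ = suppFun K x := by
  rcases Nat.eq_zero_or_pos n with rfl | hn
  · have : K = Set.univ := Set.eq_univ_of_forall fun y => by
      obtain ⟨w, hw⟩ := hne
      rwa [Subsingleton.elim y w]
    simp [this] at hz
  have : NeZero n := ⟨hn.ne'⟩
  obtain ⟨u, hu⟩ := (NormedSpace.sphere_nonempty (E := Eucl n) (x := 0) (r := 1)).2 zero_le_one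
  have hzK : z ∈ K := hK.isClosed.frontier_subset hz
  obtain ⟨x, hx, hmin⟩ := (isCompact_sphere (0 : Eucl n) 1).exists_isMinOn ⟨u, hu⟩
    (f := fun x => suppFun K x - ⟪x, z⟫)
    ((continuous_suppFun hK hne).sub (by fun_prop)).continuousOn
  refine ⟨x, hx, le_antisymm (inner_le_suppFun hK x hzK) (not_lt.1 fun hlt => hz.2 ?_)⟩
  refine mem_interior.2 ⟨Metric.ball z (suppFun K x - ⟪x, z⟫), fun y hy => ?_, Metric.isOpen_ball,
    Metric.mem_ball_self (sub_pos.2 hlt)⟩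
  refine mem_of_forall_inner_le_suppFun hK hc hne fun v hv => ?_
  have h1 := isMinOn_iff.1 hmin v hv
  have h2 : ⟪v, y - z⟫ ≤ ‖v‖ * ‖y - z‖ := real_inner_le_norm _ _
  rw [mem_sphere_zero_iff_norm.1 hv, one_mul, inner_sub_right] at h2
  rw [Metric.mem_ball, dist_eq_norm] at hy
  linarith

end SuppFun

section SmoothBody

variable {n : ℕ} {Ω : Set (Eucl n)}

lemma IsSmoothBody.isCompact (h : IsSmoothBody Ω) : IsCompact Ω := h.1

lemma IsSmoothBody.convex (h : IsSmoothBody Ω) : Convex ℝ Ω := h.2.1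

lemma IsSmoothBody.zero_mem_interior (h : IsSmoothBody Ω) : (0 : Eucl n) ∈ interior Ω := h.2.2.1

lemma IsSmoothBody.zero_mem (h : IsSmoothBody Ω) : (0 : Eucl n) ∈ Ω :=
  interior_subset h.zero_mem_interior

lemma IsSmoothBody.nonempty (h : IsSmoothBody Ω) : Ω.Nonempty := ⟨0, h.zero_mem⟩

lemma IsSmoothBody.curvDet_pos (h : IsSmoothBody Ω) {x : Eucl n}
    (hx : x ∈ Metric.sphere (0 : Eucl n) 1) : 0 < curvDet (suppFun Ω) x := h.2.2.2.2.2 x hx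

lemma IsSmoothBody.suppFun_pos (h : IsSmoothBody Ω) {x : Eucl n} (hx : x ≠ 0) :
    0 < suppFun Ω x :=
  _root_.suppFun_pos h.isCompact h.zero_mem_interior hx

lemma IsSmoothBody.contDiffAt (h : IsSmoothBody Ω) {x : Eucl n} (hx : x ≠ 0) :
    ContDiffAt ℝ (⊤ : ℕ∞) (suppFun Ω) x :=
  (h.2.2.2.2.1 x hx).contDiffAt (isOpen_compl_singleton.mem_nhds hx)

lemma IsSmoothBody.hasGradientAt (h : IsSmoothBody Ω) {x : Eucl n} (hx : x ≠ 0) :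
    HasGradientAt (suppFun Ω) (gradient (suppFun Ω) x) x :=
  ((h.contDiffAt hx).differentiableAt (by simp)).hasGradientAt

lemma IsSmoothBody.contDiffAt_gradient (h : IsSmoothBody Ω) {x : Eucl n} (hx : x ≠ 0) :
    ContDiffAt ℝ (⊤ : ℕ∞) (gradient (suppFun Ω)) x := by
  have h1 : ContDiffAt ℝ (⊤ : ℕ∞) (fderiv ℝ (suppFun Ω)) x :=
    (h.contDiffAt hx).fderiv_right (m := (⊤ : ℕ∞)) (by simp)
  exact (InnerProductSpace.toDual ℝ (Eucl n)).symm.contDiff.contDiffAt.comp x h1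

lemma IsSmoothBody.differentiableAt_gradient (h : IsSmoothBody Ω) {x : Eucl n} (hx : x ≠ 0) :
    DifferentiableAt ℝ (gradient (suppFun Ω)) x :=
  (h.contDiffAt_gradient hx).differentiableAt (by simp)

lemma HasGradientAt.eq_zero_of_isLocalMin {Z : Eucl n → ℝ} {g x : Eucl n}
    (hZ : HasGradientAt Z g x) (hmin : IsLocalMin Z x) : g = 0 := by
  have := hmin.hasFDerivAt_eq_zero hZ.hasFDerivAt
  simpa using this

/-- The gradient of the support function at `x` is the boundary point with outer normal `x`. -/
lemma IsSmoothBody.gradient_eq (h : IsSmoothBody Ω) {x y : Eucl n} (hx : x ≠ 0) (hy : y ∈ Ω)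
    (hxy : ⟪x, y⟫ = suppFun Ω x) : gradient (suppFun Ω) x = y := by
  have h1 : HasGradientAt (fun z => suppFun Ω z - ⟪z, y⟫) (gradient (suppFun Ω) x - y) x := by
    have h2 : HasGradientAt (fun z : Eucl n => ⟪z, y⟫) y x := by
      rw [hasGradientAt_iff_hasFDerivAt]
      refine ((InnerProductSpace.toDual ℝ (Eucl n) y).hasFDerivAt).congr_of_eventuallyEq ?_
      exact Eventually.of_forall fun z => by simp [real_inner_comm]
    rw [hasGradientAt_iff_hasFDerivAt, map_sub]
    exact (h.hasGradientAt hx).hasFDerivAt.sub h2.hasFDerivAt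
  refine sub_eq_zero.1 (h1.eq_zero_of_isLocalMin (Eventually.of_forall fun z => ?_))
  have := inner_le_suppFun h.isCompact z hy
  simp only
  linarith

lemma IsSmoothBody.gradient_mem_and_inner (h : IsSmoothBody Ω) {x : Eucl n} (hx : x ≠ 0) :
    gradient (suppFun Ω) x ∈ Ω ∧ ⟪x, gradient (suppFun Ω) x⟫ = suppFun Ω x := by
  obtain ⟨y, hy, h1⟩ := exists_inner_eq_suppFun h.isCompact h.nonempty x
  rw [h.gradient_eq hx hy h1]
  exact ⟨hy, h1⟩

lemma IsSmoothBody.gradient_mem (h : IsSmoothBody Ω) {x : Eucl n} (hx : x ≠ 0) :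
    gradient (suppFun Ω) x ∈ Ω := (h.gradient_mem_and_inner hx).1

lemma IsSmoothBody.inner_gradient (h : IsSmoothBody Ω) {x : Eucl n} (hx : x ≠ 0) :
    ⟪x, gradient (suppFun Ω) x⟫ = suppFun Ω x := (h.gradient_mem_and_inner hx).2

lemma IsSmoothBody.gradient_smul (h : IsSmoothBody Ω) {x : Eucl n} (hx : x ≠ 0) {c : ℝ}
    (hc : 0 < c) : gradient (suppFun Ω) (c • x) = gradient (suppFun Ω) x := by
  refine h.gradient_eq (smul_ne_zero hc.ne' hx) (h.gradient_mem hx) ?_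
  rw [real_inner_smul_left, h.inner_gradient hx, suppFun_smul h.isCompact h.nonempty hc.le]

lemma IsSmoothBody.fderiv_gradient_self (h : IsSmoothBody Ω) {x : Eucl n} (hx : x ≠ 0) :
    fderiv ℝ (gradient (suppFun Ω)) x x = 0 := by
  have h1 : HasDerivAt (fun c : ℝ => gradient (suppFun Ω) (c • x))
      (fderiv ℝ (gradient (suppFun Ω)) x x) 1 := by
    have h2 : HasDerivAt (fun c : ℝ => c • x) x 1 := by
      simpa using (hasDerivAt_id (1 : ℝ)).smul_const x
    have h3 : HasFDerivAt (gradient (suppFun Ω)) (fderiv ℝ (gradient (suppFun Ω)) x)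
        ((1 : ℝ) • x) := by
      simpa using (h.differentiableAt_gradient hx).hasFDerivAt
    exact h3.comp_hasDerivAt 1 h2
  refine h1.unique ((hasDerivAt_const 1 (gradient (suppFun Ω) x)).congr_of_eventuallyEq ?_)
  filter_upwards [lt_mem_nhds (zero_lt_one' ℝ)] with c hc
  exact h.gradient_smul hx hc

lemma IsSmoothBody.fderiv_gradient_symm (h : IsSmoothBody Ω) {x : Eucl n} (hx : x ≠ 0)
    (v w : Eucl n) : ⟪fderiv ℝ (gradient (suppFun Ω)) x v, w⟫ =
      ⟪v, fderiv ℝ (gradient (suppFun Ω)) x w⟫ := by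
  have h1 : DifferentiableAt ℝ (fderiv ℝ (suppFun Ω)) x :=
    ((h.contDiffAt hx).fderiv_right (m := (⊤ : ℕ∞)) (by simp)).differentiableAt (by simp)
  have h2 : ∀ v w, ⟪fderiv ℝ (gradient (suppFun Ω)) x v, w⟫ =
      fderiv ℝ (fderiv ℝ (suppFun Ω)) x v w := by
    intro v w
    have h3 : HasFDerivAt (fun y => ⟪gradient (suppFun Ω) y, w⟫) _ x :=
      (h.differentiableAt_gradient hx).hasFDerivAt.inner ℝ (hasFDerivAt_const w x)
    have h4 : HasFDerivAt (fun y => fderiv ℝ (suppFun Ω) y w) _ x :=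
      h1.hasFDerivAt.clm_apply (hasFDerivAt_const w x)
    have h5 : (fun y => ⟪gradient (suppFun Ω) y, w⟫) = fun y => fderiv ℝ (suppFun Ω) y w :=
      funext fun y => by rw [gradient, InnerProductSpace.toDual_symm_apply]
    rw [h5] at h3
    simpa using DFunLike.congr_fun (h3.unique h4) v
  rw [real_inner_comm _ v, h2, h2]
  exact (h.contDiffAt hx).isSymmSndFDerivAt
    (by simpa using WithTop.coe_le_coe.2 (le_top : (2 : ℕ∞) ≤ ⊤)) v w

lemma IsSmoothBody.fderiv_gradient_nonneg (h : IsSmoothBody Ω) {x : Eucl n} (hx : x ≠ 0)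
    (v : Eucl n) : 0 ≤ ⟪fderiv ℝ (gradient (suppFun Ω)) x v, v⟫ := by
  have h1 : HasDerivAt (fun ε : ℝ => ⟪gradient (suppFun Ω) (x + ε • v), v⟫)
      ⟪fderiv ℝ (gradient (suppFun Ω)) x v, v⟫ 0 := by
    have h2 : HasDerivAt (fun ε : ℝ => x + ε • v) v 0 := by
      simpa using ((hasDerivAt_id (0 : ℝ)).smul_const v).const_add x
    have h3 : HasFDerivAt (gradient (suppFun Ω)) (fderiv ℝ (gradient (suppFun Ω)) x)
        (x + (0 : ℝ) • v) := by
      simpa using (h.differentiableAt_gradient hx).hasFDerivAt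
    simpa using (h3.comp_hasDerivAt 0 h2).inner ℝ (hasDerivAt_const 0 v)
  have h4 := h1.tendsto_slope_zero_right
  refine ge_of_tendsto h4 ?_
  have h5 : ∀ᶠ ε : ℝ in 𝓝[>] 0, x + ε • v ≠ 0 := by
    have : Tendsto (fun ε : ℝ => x + ε • v) (𝓝 0) (𝓝 x) := by
      have : Continuous fun ε : ℝ => x + ε • v := by fun_prop
      simpa using this.tendsto 0
    exact (this.eventually_ne hx).filter_mono nhdsWithin_le_nhds
  filter_upwards [h5, self_mem_nhdsWithin] with ε hε hε0
  have hε0 : 0 < ε := hε0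
  have h6 := inner_le_suppFun h.isCompact (x + ε • v) (h.gradient_mem hx)
  have h7 := inner_le_suppFun h.isCompact x (h.gradient_mem hε)
  rw [← h.inner_gradient hε, inner_add_left, inner_add_left, real_inner_smul_left,
    real_inner_smul_left, h.inner_gradient hx] at h6
  have h8 : 0 ≤ ε * (⟪v, gradient (suppFun Ω) (x + ε • v)⟫ - ⟪v, gradient (suppFun Ω) x⟫) := by
    linarith
  have h9 := nonneg_of_mul_nonneg_right h8 hε0
  simp only [zero_add, zero_smul, add_zero, smul_eq_mul]
  rw [real_inner_comm v, real_inner_comm v]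
  positivity

/-- The operator whose determinant is `curvDet`. -/
def curvOp (H : Eucl n → ℝ) (x : Eucl n) : Eucl n →ₗ[ℝ] Eucl n :=
  (fderiv ℝ (fun y => gradient H y) x : Eucl n →ₗ[ℝ] Eucl n) + rankOne x

lemma curvOp_apply (H : Eucl n → ℝ) (x v : Eucl n) :
    curvOp H x v = fderiv ℝ (gradient H) x v + ⟪x, v⟫ • x := rfl

lemma IsSmoothBody.isSymmetric_curvOp (h : IsSmoothBody Ω) {x : Eucl n} (hx : x ≠ 0) :
    (curvOp (suppFun Ω) x).IsSymmetric := by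
  intro v w
  simp only [curvOp_apply, inner_add_left, inner_add_right, h.fderiv_gradient_symm hx,
    real_inner_smul_left, real_inner_smul_right]
  rw [real_inner_comm x v]
  ring

lemma inner_curvOp (H : Eucl n → ℝ) (x v : Eucl n) :
    ⟪curvOp H x v, v⟫ = ⟪fderiv ℝ (gradient H) x v, v⟫ + ⟪x, v⟫ ^ 2 := by
  rw [curvOp_apply, inner_add_left, real_inner_smul_left]
  ring

lemma IsSmoothBody.inner_curvOp_nonneg (h : IsSmoothBody Ω) {x : Eucl n} (hx : x ≠ 0)
    (v : Eucl n) : 0 ≤ ⟪curvOp (suppFun Ω) x v, v⟫ := by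
  rw [inner_curvOp]
  have := h.fderiv_gradient_nonneg hx v
  positivity

lemma IsSmoothBody.curvOp_self (h : IsSmoothBody Ω) {x : Eucl n} (hx : ‖x‖ = 1) :
    curvOp (suppFun Ω) x x = x := by
  rw [curvOp_apply, h.fderiv_gradient_self (by rintro rfl; simp at hx)]
  simp [hx]

lemma IsSmoothBody.continuousOn_gradient (h : IsSmoothBody Ω) :
    ContinuousOn (gradient (suppFun Ω)) {0}ᶜ := fun _ hx =>
  (h.contDiffAt_gradient hx).continuousAt.continuousWithinAt

lemma IsSmoothBody.continuousOn_curvDet (h : IsSmoothBody Ω) :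
    ContinuousOn (curvDet (suppFun Ω)) {0}ᶜ := by
  intro x hx
  have h1 : ContinuousAt (fderiv ℝ (gradient (suppFun Ω))) x :=
    ((h.contDiffAt_gradient hx).fderiv_right (m := (⊤ : ℕ∞)) (by simp)).continuousAt
  have h2 : ContinuousAt (fun y : Eucl n => fderiv ℝ (gradient (suppFun Ω)) y +
      (innerSL ℝ y).smulRight y) x := by
    refine h1.add ?_
    have : Continuous fun y : Eucl n => (innerSL ℝ y).smulRight y := by fun_prop
    exact this.continuousAt
  have h3 : curvDet (suppFun Ω) = fun y => ContinuousLinearMap.det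
      (fderiv ℝ (gradient (suppFun Ω)) y + (innerSL ℝ y).smulRight y) := by
    funext y
    rw [curvDet, ContinuousLinearMap.det]
    congr 1
  rw [h3]
  exact (ContinuousLinearMap.continuous_det.continuousAt.comp h2).continuousWithinAt

end SmoothBody

section Touching

variable {n : ℕ}

lemma inner_fderiv_nonneg_of_isLocalMin {Z : Eucl n → ℝ} {G : Eucl n → Eucl n}
    {M : Eucl n →L[ℝ] Eucl n} {x : Eucl n} (hZ : ∀ᶠ y in 𝓝 x, HasGradientAt Z (G y) y)
    (hG : HasFDerivAt G M x) (hmin : IsLocalMin Z x) (v : Eucl n) : 0 ≤ ⟪M v, v⟫ := by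
  by_contra! hc
  have hG0 : G x = 0 := hZ.self_of_nhds.eq_zero_of_isLocalMin hmin
  have hline : ∀ t : ℝ, HasDerivAt (fun ε : ℝ => x + ε • v) v t := fun t => by
    simpa using ((hasDerivAt_id t).smul_const v).const_add x
  have h1 : HasDerivAt (fun ε : ℝ => ⟪G (x + ε • v), v⟫) ⟪M v, v⟫ 0 := by
    have h3 : HasFDerivAt G M (x + (0 : ℝ) • v) := by simpa using hG
    simpa using (h3.comp_hasDerivAt 0 (hline 0)).inner ℝ (hasDerivAt_const 0 v)
  have h2 := (h1.tendsto_slope_zero_right).eventually (gt_mem_nhds hc)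
  have hcont : Tendsto (fun ε : ℝ => x + ε • v) (𝓝[≥] 0) (𝓝 x) := by
    have := (hline 0).continuousAt.tendsto
    rw [zero_smul, add_zero] at this
    exact this.mono_left nhdsWithin_le_nhds
  have h3 : ∀ᶠ ε : ℝ in 𝓝[≥] 0, HasGradientAt Z (G (x + ε • v)) (x + ε • v) ∧
      Z x ≤ Z (x + ε • v) := hcont.eventually (hZ.and hmin)
  obtain ⟨a, ha, h2⟩ := mem_nhdsGT_iff_exists_Ioo_subset.1 h2
  obtain ⟨b, hb, h3⟩ := mem_nhdsGE_iff_exists_Ico_subset.1 h3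
  have ha : 0 < a := ha
  have hb : 0 < b := hb
  set ε := min a b / 2 with hεdef
  have hε : 0 < ε := by positivity
  have hεa : ε < a := (half_lt_self (by positivity)).trans_le (min_le_left _ _)
  have hεb : ε < b := (half_lt_self (by positivity)).trans_le (min_le_right _ _)
  have hder : ∀ t ∈ Set.Icc 0 ε, HasDerivAt (fun t : ℝ => Z (x + t • v))
      ⟪G (x + t • v), v⟫ t := by
    intro t ht
    have h4 := (h3 ⟨ht.1, ht.2.trans_lt hεb⟩).1.hasFDerivAt.comp_hasDerivAt t (hline t)
    simp only [InnerProductSpace.toDual_apply_apply] at h4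
    exact h4
  obtain ⟨ξ, hξ, h5⟩ := exists_hasDerivAt_eq_slope (fun t : ℝ => Z (x + t • v))
    (fun t => ⟪G (x + t • v), v⟫) hε
    (fun t ht => (hder t ht).continuousAt.continuousWithinAt)
    (fun t ht => hder t ⟨ht.1.le, ht.2.le⟩)
  have h6 : ξ⁻¹ * ⟪G (x + ξ • v), v⟫ < 0 := by
    have := h2 ⟨hξ.1, hξ.2.trans hεa⟩
    simpa [hG0] using this
  have h7 : 0 ≤ ⟪G (x + ξ • v), v⟫ := by
    rw [h5]
    have := (h3 ⟨hε.le, hεb⟩).2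
    simp only [zero_smul, add_zero, sub_zero]
    exact div_nonneg (sub_nonneg.2 this) hε.le
  have := mul_nonneg (inv_nonneg.2 hξ.1.le) h7
  linarith

lemma hasGradientAt_norm {y : Eucl n} (hy : y ≠ 0) :
    HasGradientAt (fun z : Eucl n => ‖z‖) (‖y‖⁻¹ • y) y := by
  rw [hasGradientAt_iff_hasFDerivAt]
  have h1 := (hasStrictFDerivAt_norm_sq y).hasFDerivAt.sqrt (by positivity)
  have h2 : (fun z : Eucl n => √(‖z‖ ^ 2)) = fun z => ‖z‖ :=
    funext fun z => Real.sqrt_sq (norm_nonneg z)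
  rw [h2, Real.sqrt_sq (norm_nonneg y)] at h1
  refine h1.congr_fderiv ?_
  ext v
  simp
  field_simp

lemma hasFDerivAt_inv_norm_smul {x : Eucl n} (hx : ‖x‖ = 1) :
    HasFDerivAt (fun z : Eucl n => ‖z‖⁻¹ • z)
      (ContinuousLinearMap.id ℝ (Eucl n) - (innerSL ℝ x).smulRight x) x := by
  have hx0 : x ≠ 0 := by rintro rfl; simp at hx
  have h1 := ((hasDerivAt_inv (norm_ne_zero_iff.2 hx0)).comp_hasFDerivAt x
    (hasGradientAt_norm hx0).hasFDerivAt).smul (hasFDerivAt_id x)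
  refine h1.congr_fderiv ?_
  ext1 v
  simp [hx, sub_eq_add_neg]

variable {Ω Ω' : Set (Eucl n)} {α σ : ℝ}

lemma smul_add_smul_mem (h : IsCompact Ω) (h' : IsSmoothBody Ω')
    (hle : ∀ y ∈ Metric.sphere (0 : Eucl n) 1, α * suppFun Ω y + σ ≤ suppFun Ω' y)
    (hα : 0 ≤ α) (hσ : 0 ≤ σ) {x z : Eucl n} (hx : ‖x‖ = 1) (hz : z ∈ Ω) :
    α • z + σ • x ∈ Ω' := by
  refine mem_of_forall_inner_le_suppFun h'.isCompact h'.convex h'.nonempty fun u hu => ?_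
  refine le_trans ?_ (hle u hu)
  rw [inner_add_right, real_inner_smul_right, real_inner_smul_right]
  have h1 := inner_le_suppFun h u hz
  have h2 : ⟪u, x⟫ ≤ 1 := by
    refine (real_inner_le_norm _ _).trans ?_
    rw [hx, mem_sphere_zero_iff_norm.1 hu, one_mul]
  nlinarith [mul_le_mul_of_nonneg_left h1 hα, mul_le_mul_of_nonneg_left h2 hσ]

/-- If `α h_Ω + σ ≤ h_Ω'` on the sphere with equality at `x`, the boundary points with normal `x`
correspond and the curvature operators are ordered. -/
lemma IsSmoothBody.gradient_eq_and_le_of_touching (h : IsSmoothBody Ω) (h' : IsSmoothBody Ω')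
    (hle : ∀ y ∈ Metric.sphere (0 : Eucl n) 1, α * suppFun Ω y + σ ≤ suppFun Ω' y)
    {x : Eucl n} (hx : x ∈ Metric.sphere (0 : Eucl n) 1)
    (heq : suppFun Ω' x = α * suppFun Ω x + σ) :
    gradient (suppFun Ω') x = α • gradient (suppFun Ω) x + σ • x ∧
    ∀ v, α * ⟪fderiv ℝ (gradient (suppFun Ω)) x v, v⟫ + σ * (‖v‖ ^ 2 - ⟪x, v⟫ ^ 2) ≤
      ⟪fderiv ℝ (gradient (suppFun Ω')) x v, v⟫ := by
  have hx1 : ‖x‖ = 1 := by simpa using hx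
  have hx0 := ne_zero_of_mem_sphere_one hx
  set Z : Eucl n → ℝ := fun y => suppFun Ω' y - (α * suppFun Ω y + σ * ‖y‖) with hZdef
  set G : Eucl n → Eucl n := fun y => gradient (suppFun Ω') y -
    (α • gradient (suppFun Ω) y + σ • ‖y‖⁻¹ • y) with hGdef
  have hZ : ∀ y, y ≠ 0 → HasGradientAt Z (G y) y := by
    intro y hy
    rw [hasGradientAt_iff_hasFDerivAt, hGdef, map_sub, map_add, map_smul, map_smul]
    exact (h'.hasGradientAt hy).hasFDerivAt.sub
      (((h.hasGradientAt hy).hasFDerivAt.const_mul α).add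
        ((hasGradientAt_norm hy).hasFDerivAt.const_mul σ))
  have hG : HasFDerivAt G (fderiv ℝ (gradient (suppFun Ω')) x -
      (α • fderiv ℝ (gradient (suppFun Ω)) x +
        σ • (ContinuousLinearMap.id ℝ (Eucl n) - (innerSL ℝ x).smulRight x))) x :=
    (h'.differentiableAt_gradient hx0).hasFDerivAt.sub
      (((h.differentiableAt_gradient hx0).hasFDerivAt.const_smul α).add
        ((hasFDerivAt_inv_norm_smul hx1).const_smul σ))
  have hmin : IsLocalMin Z x := by
    have hZx : Z x = 0 := by simp [hZdef, hx1, heq]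
    filter_upwards [isOpen_compl_singleton.mem_nhds hx0] with y hy
    have hy : y ≠ 0 := hy
    rw [hZx]
    have hy' : 0 < ‖y‖ := norm_pos_iff.2 hy
    have h1 := hle (‖y‖⁻¹ • y) (by simp [norm_smul, hy])
    rw [suppFun_smul h.isCompact h.nonempty (by positivity),
      suppFun_smul h'.isCompact h'.nonempty (by positivity)] at h1
    have h2 := mul_le_mul_of_nonneg_left h1 hy'.le
    have h3 : ‖y‖ * (‖y‖⁻¹ * suppFun Ω' y) = suppFun Ω' y := by field_simp
    have h4 : ‖y‖ * (α * (‖y‖⁻¹ * suppFun Ω y) + σ) = α * suppFun Ω y + σ * ‖y‖ := by field_simp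
    rw [h3, h4] at h2
    simpa [hZdef] using h2
  constructor
  · have := (hZ x hx0).eq_zero_of_isLocalMin hmin
    simp only [hGdef, hx1, inv_one, one_smul] at this
    exact sub_eq_zero.1 this
  · intro v
    have h1 := inner_fderiv_nonneg_of_isLocalMin
      (by filter_upwards [isOpen_compl_singleton.mem_nhds hx0] with y hy using hZ y hy) hG hmin v
    simp only [sub_apply, add_apply,
      smul_apply, ContinuousLinearMap.id_apply,
      ContinuousLinearMap.smulRight_apply, inner_sub_left, inner_add_left, real_inner_smul_left,
      innerSL_apply_apply, real_inner_self_eq_norm_sq] at h1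
    linarith

/-- Consequence of touching for the curvature determinants. -/
lemma IsSmoothBody.curvDet_of_touching (h : IsSmoothBody Ω) (h' : IsSmoothBody Ω')
    (hle : ∀ y ∈ Metric.sphere (0 : Eucl n) 1, α * suppFun Ω y + σ ≤ suppFun Ω' y)
    {x : Eucl n} (hx : x ∈ Metric.sphere (0 : Eucl n) 1)
    (heq : suppFun Ω' x = α * suppFun Ω x + σ) (hσ : 0 ≤ σ)
    {β m : ℝ} (hβ : 0 < β) (hβ1 : β ≤ 1) (hβα : β ≤ α) (hm : 0 < m) (hm1 : m < 1) :
    β ^ n * curvDet (suppFun Ω) x ≤ curvDet (suppFun Ω') x ∧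
    (m ^ n ≤ curvDet (suppFun Ω) x ∨
      β ^ n * curvDet (suppFun Ω) x * (1 + σ / (β * m)) ≤ curvDet (suppFun Ω') x) := by
  have hx1 : ‖x‖ = 1 := by simpa using hx
  have hx0 := ne_zero_of_mem_sphere_one hx
  have key : ∀ v, β * ⟪curvOp (suppFun Ω) x v, v⟫ + σ * (‖v‖ ^ 2 - ⟪x, v⟫ ^ 2) ≤
      ⟪curvOp (suppFun Ω') x v, v⟫ := by
    intro v
    have h1 := (h.gradient_eq_and_le_of_touching h' hle hx heq).2 v
    rw [inner_curvOp, inner_curvOp]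
    have h2 := mul_le_mul_of_nonneg_right hβα (h.fderiv_gradient_nonneg hx0 v)
    have h3 := mul_le_mul_of_nonneg_right hβ1 (sq_nonneg ⟪x, v⟫)
    linarith
  have key' : ∀ v, β * ⟪curvOp (suppFun Ω) x v, v⟫ ≤ ⟪curvOp (suppFun Ω') x v, v⟫ := by
    intro v
    refine le_trans (le_add_of_nonneg_right (mul_nonneg hσ ?_)) (key v)
    have := abs_real_inner_le_norm x v
    rw [hx1, one_mul] at this
    have := sq_le_sq' (abs_le.1 this).1 (abs_le.1 this).2
    linarith
  exact ⟨pow_mul_det_le_det (h.isSymmetric_curvOp hx0) (h'.isSymmetric_curvOp hx0)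
      (h.inner_curvOp_nonneg hx0) (h.curvDet_pos hx) hβ key',
    pow_le_det_or_mul_det_le_det (h.isSymmetric_curvOp hx0) (h'.isSymmetric_curvOp hx0)
      (h.inner_curvOp_nonneg hx0) (h.curvDet_pos hx) (h.curvOp_self hx1) hβ hσ key hx1 hm hm1⟩

end Touching

section Family

variable {n : ℕ} {X : Type*} [TopologicalSpace X] {K : X → Set (Eucl n)}

lemma eventually_mem_of_mem_interior (hK : ∀ t, IsCompact (K t)) (hc : ∀ t, Convex ℝ (K t))
    (hne : ∀ t, (K t).Nonempty) (hcont : Continuous fun a : X × Eucl n => suppFun (K a.1) a.2)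
    {t₀ : X} {z₀ : Eucl n} (hz : z₀ ∈ interior (K t₀)) :
    ∀ᶠ a : X × Eucl n in 𝓝 (t₀, z₀), a.2 ∈ K a.1 := by
  have h1 : ∀ᶠ a : X × Eucl n in 𝓝 (t₀, z₀), ∀ x ∈ Metric.sphere (0 : Eucl n) 1,
      0 < suppFun (K a.1) x - ⟪x, a.2⟫ := by
    refine (isCompact_sphere _ _).eventually_forall_of_forall_eventually fun x hx => ?_
    have h2 : Continuous fun b : (X × Eucl n) × Eucl n => suppFun (K b.1.1) b.2 - ⟪b.2, b.1.2⟫ :=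
      (hcont.comp ((continuous_fst.comp continuous_fst).prodMk continuous_snd)).sub (by fun_prop)
    exact h2.continuousAt.eventually (lt_mem_nhds (sub_pos.2
      (inner_lt_suppFun_of_mem_interior (hK t₀) (ne_zero_of_mem_sphere_one hx) hz)))
  filter_upwards [h1] with a ha
  exact mem_of_forall_inner_le_suppFun (hK _) (hc _) (hne _) fun x hx =>
    (sub_pos.1 (ha x hx)).le

lemma eventually_notMem_of_notMem (hK : ∀ t, IsCompact (K t)) (hc : ∀ t, Convex ℝ (K t))
    (hne : ∀ t, (K t).Nonempty) (hcont : Continuous fun a : X × Eucl n => suppFun (K a.1) a.2)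
    {t₀ : X} {z₀ : Eucl n} (hz : z₀ ∉ K t₀) :
    ∀ᶠ a : X × Eucl n in 𝓝 (t₀, z₀), a.2 ∉ K a.1 := by
  obtain ⟨x, -, hx⟩ := exists_suppFun_lt_inner (hK t₀) (hc t₀) (hne t₀) hz
  have h2 : Continuous fun b : X × Eucl n => suppFun (K b.1) x - ⟪x, b.2⟫ :=
    (hcont.comp (continuous_fst.prodMk continuous_const)).sub (by fun_prop)
  filter_upwards [h2.continuousAt.eventually (gt_mem_nhds (sub_neg.2 hx))] with a ha hmem
  exact (sub_neg.1 ha).not_ge (inner_le_suppFun (hK _) x hmem)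

end Family

section RadFun

variable {n : ℕ} {K : Set (Eucl n)}

lemma radFun_spec (hK : IsCompact K) (h0 : (0 : Eucl n) ∈ interior K)
    {ξ : Eucl n} (hξ : ξ ≠ 0) : 0 < radFun K ξ ∧ radFun K ξ • ξ ∈ K ∧
      ∀ c, 0 < c → c • ξ ∈ K → c ≤ radFun K ξ := by
  have hline : Continuous fun c : ℝ => c • ξ := by fun_prop
  obtain ⟨ε, hε, hε0⟩ : ∃ ε : ℝ, ε • ξ ∈ K ∧ 0 < ε := by
    have h1 : ∀ᶠ c : ℝ in 𝓝[>] 0, c • ξ ∈ K := by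
      refine Eventually.filter_mono nhdsWithin_le_nhds (hline.continuousAt.eventually ?_)
      simp only [zero_smul]
      exact mem_interior_iff_mem_nhds.1 h0
    exact (h1.and self_mem_nhdsWithin).exists
  obtain ⟨R, hR0, hR⟩ := exists_forall_norm_le hK
  have hξ' : 0 < ‖ξ‖ := norm_pos_iff.2 hξ
  have hbdd : BddAbove {c : ℝ | 0 < c ∧ c • ξ ∈ K} := by
    refine ⟨R / ‖ξ‖, fun c hc => ?_⟩
    have := hR _ hc.2
    rw [norm_smul, Real.norm_of_nonneg hc.1.le] at this
    rwa [le_div_iff₀ hξ']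
  have hle : ∀ c, 0 < c → c • ξ ∈ K → c ≤ radFun K ξ := fun c hc hcK => le_csSup hbdd ⟨hc, hcK⟩
  have hpos : 0 < radFun K ξ := hε0.trans_le (hle ε hε0 hε)
  refine ⟨hpos, ?_, hle⟩
  have hmem : radFun K ξ ∈ closure {c : ℝ | 0 < c ∧ c • ξ ∈ K} :=
    csSup_mem_closure ⟨ε, hε0, hε⟩ hbdd
  have hcl : IsClosed {c : ℝ | c • ξ ∈ K} := hK.isClosed.preimage hline
  exact closure_minimal (fun c hc => hc.2) hcl hmem

lemma radFun_pos (hK : IsCompact K) (h0 : (0 : Eucl n) ∈ interior K) {ξ : Eucl n} (hξ : ξ ≠ 0) :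
    0 < radFun K ξ := (radFun_spec hK h0 hξ).1

lemma radFun_nonneg (ξ : Eucl n) : 0 ≤ radFun K ξ := Real.sSup_nonneg fun _ hc => hc.1.le

lemma smul_mem_interior_of_lt_radFun (hK : IsCompact K) (hc : Convex ℝ K)
    (h0 : (0 : Eucl n) ∈ interior K) {ξ : Eucl n} (hξ : ξ ≠ 0) {c : ℝ} (hc0 : 0 ≤ c)
    (hcr : c < radFun K ξ) : c • ξ ∈ interior K := by
  obtain ⟨hpos, hmem, -⟩ := radFun_spec hK h0 hξ
  have h1 := hc.combo_interior_self_mem_interior h0 hmem (a := 1 - c / radFun K ξ)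
    (b := c / radFun K ξ) (by rw [sub_pos, div_lt_one hpos]; exact hcr) (by positivity) (by ring)
  rwa [smul_zero, zero_add, smul_smul, div_mul_cancel₀ _ hpos.ne'] at h1

lemma radFun_eq_of_mem_frontier (hK : IsCompact K) (hc : Convex ℝ K)
    (h0 : (0 : Eucl n) ∈ interior K) {ξ : Eucl n} (hξ : ξ ≠ 0) {c : ℝ} (hc0 : 0 < c)
    (h : c • ξ ∈ frontier K) : radFun K ξ = c := by
  refine le_antisymm (not_lt.1 fun hlt => h.2 ?_)
    ((radFun_spec hK h0 hξ).2.2 c hc0 (hK.isClosed.frontier_subset h))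
  exact smul_mem_interior_of_lt_radFun hK hc h0 hξ hc0.le hlt

lemma smul_notMem_of_radFun_lt (hK : IsCompact K)
    (h0 : (0 : Eucl n) ∈ interior K) {ξ : Eucl n} (hξ : ξ ≠ 0) {c : ℝ}
    (hcr : radFun K ξ < c) : c • ξ ∉ K := fun h =>
  hcr.not_ge ((radFun_spec hK h0 hξ).2.2 c ((radFun_pos hK h0 hξ).trans hcr) h)

lemma radFun_smul (hK : IsCompact K) (h0 : (0 : Eucl n) ∈ interior K) {ξ : Eucl n} (hξ : ξ ≠ 0)
    {c : ℝ} (hc0 : 0 < c) : radFun K (c • ξ) = c⁻¹ * radFun K ξ := by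
  have h1 : ∀ (ξ : Eucl n) (hξ : ξ ≠ 0) (c : ℝ) (hc0 : 0 < c),
      c⁻¹ * radFun K ξ ≤ radFun K (c • ξ) := by
    intro ξ hξ c hc0
    refine (radFun_spec hK h0 (smul_ne_zero hc0.ne' hξ)).2.2 _
      (mul_pos (inv_pos.2 hc0) (radFun_pos hK h0 hξ)) ?_
    rw [smul_smul, mul_right_comm, inv_mul_cancel₀ hc0.ne', one_mul]
    exact (radFun_spec hK h0 hξ).2.1
  refine le_antisymm ?_ (h1 ξ hξ c hc0)
  have h2 := h1 (c • ξ) (smul_ne_zero hc0.ne' hξ) c⁻¹ (inv_pos.2 hc0)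
  rw [smul_smul, inv_mul_cancel₀ hc0.ne', one_smul, inv_inv] at h2
  rwa [le_inv_mul_iff₀ hc0]

lemma one_lt_radFun_iff (hK : IsCompact K) (hc : Convex ℝ K) (h0 : (0 : Eucl n) ∈ interior K)
    {ξ : Eucl n} (hξ : ξ ≠ 0) : 1 < radFun K ξ ↔ ξ ∈ interior K := by
  constructor
  · intro h
    simpa using smul_mem_interior_of_lt_radFun hK hc h0 hξ zero_le_one h
  · intro h
    refine ((radFun_spec hK h0 hξ).2.2 1 one_pos (by simpa using interior_subset h)).lt_of_ne
      fun h1 => ?_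
    have hline : Tendsto (fun c : ℝ => c • ξ) (𝓝[>] 1) (𝓝 ξ) := by
      have : Continuous fun c : ℝ => c • ξ := by fun_prop
      simpa using (this.tendsto 1).mono_left nhdsWithin_le_nhds
    obtain ⟨c, h2, h3⟩ := ((hline.eventually (mem_interior_iff_mem_nhds.1 h)).and
      self_mem_nhdsWithin).exists
    exact smul_notMem_of_radFun_lt hK h0 hξ (h1 ▸ h3) h2

lemma continuousOn_radFun_family {X : Type*} [TopologicalSpace X] {K : X → Set (Eucl n)}
    (hK : ∀ t, IsCompact (K t)) (hc : ∀ t, Convex ℝ (K t))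
    (h0 : ∀ t, (0 : Eucl n) ∈ interior (K t))
    (hcont : Continuous fun a : X × Eucl n => suppFun (K a.1) a.2) :
    ContinuousOn (fun a : X × Eucl n => radFun (K a.1) a.2) {a | a.2 ≠ 0} := by
  intro a ha
  have hne : ∀ t, (K t).Nonempty := fun t => ⟨0, interior_subset (h0 t)⟩
  have hopen : ∀ᶠ b : X × Eucl n in 𝓝 a, b.2 ≠ 0 :=
    (isOpen_ne_fun continuous_snd continuous_const).mem_nhds ha
  have hsm : ∀ c : ℝ, Tendsto (fun b : X × Eucl n => (b.1, c • b.2)) (𝓝 a) (𝓝 (a.1, c • a.2)) :=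
    fun c => (continuous_fst.prodMk (continuous_snd.const_smul c)).tendsto a
  refine ContinuousAt.continuousWithinAt (tendsto_order.2 ⟨fun c hlt => ?_, fun c hlt => ?_⟩)
  · obtain ⟨c', h1, h2⟩ := exists_between (max_lt hlt (radFun_pos (hK a.1) (h0 a.1) ha))
    have hc' : 0 < c' := (le_max_right _ _).trans_lt h1
    filter_upwards [(hsm c').eventually (eventually_mem_of_mem_interior hK hc hne hcont
      (smul_mem_interior_of_lt_radFun (hK _) (hc _) (h0 _) ha hc'.le h2)), hopen] with b hb hb0
    exact ((le_max_left _ _).trans_lt h1).trans_le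
      ((radFun_spec (hK _) (h0 _) hb0).2.2 c' hc' hb)
  · obtain ⟨c', h1, h2⟩ := exists_between hlt
    filter_upwards [(hsm c').eventually (eventually_notMem_of_notMem hK hc hne hcont
      (smul_notMem_of_radFun_lt (hK _) (h0 _) ha h1)), hopen] with b hb hb0
    refine lt_of_le_of_lt (not_lt.1 fun h3 => hb ?_) h2
    exact interior_subset (smul_mem_interior_of_lt_radFun (hK _) (hc _) (h0 _) hb0
      ((radFun_nonneg _).trans h1.le) h3)

end RadFun

section Polar

variable {n : ℕ}

open scoped ENNReal

lemma setLIntegral_eq_lintegral_toSphere (hn : n ≠ 0) {U : Set (Eucl n)} (hUm : MeasurableSet U)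
    {φ : Eucl n → ℝ≥0∞} {G : Metric.sphere (0 : Eucl n) 1 → ℝ≥0∞} (hG : Measurable G)
    {R : Metric.sphere (0 : Eucl n) 1 → ℝ} (hR : Measurable R) (hR0 : ∀ u, 0 < R u)
    (hU0 : (0 : Eucl n) ∉ U)
    (hU : ∀ (u : Metric.sphere (0 : Eucl n) 1) (r : ℝ), 0 < r → (r • (u : Eucl n) ∈ U ↔ r < R u))
    (hφ : ∀ (u : Metric.sphere (0 : Eucl n) 1) (r : ℝ), 0 < r → φ (r • (u : Eucl n)) = G u) :
    ∫⁻ y in U, φ y = ∫⁻ u, G u * ENNReal.ofReal (R u ^ n / n)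
      ∂(volume : Measure (Eucl n)).toSphere := by
  have : NeZero n := ⟨hn⟩
  have hdim : Module.finrank ℝ (Eucl n) - 1 + 1 = n := by
    rw [finrank_euclideanSpace_fin]; exact Nat.sub_add_cancel (Nat.pos_of_ne_zero hn)
  have hmeas : MeasurableSet {a : Metric.sphere (0 : Eucl n) 1 × Set.Ioi (0 : ℝ) |
      (a.2 : ℝ) < R a.1} :=
    measurableSet_lt (measurable_subtype_coe.comp measurable_snd) (hR.comp measurable_fst)
  calc ∫⁻ y in U, φ y = ∫⁻ y in {0}ᶜ, U.indicator φ y := by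
        rw [setLIntegral_indicator hUm, Set.inter_eq_left.2]
        intro y hy h0
        exact hU0 (Set.mem_singleton_iff.1 h0 ▸ hy)
    _ = ∫⁻ y : ({0}ᶜ : Set (Eucl n)), U.indicator φ y ∂(volume.comap Subtype.val) :=
        (lintegral_subtype_comap (measurableSet_singleton _).compl _).symm
    _ = ∫⁻ a : Metric.sphere (0 : Eucl n) 1 × Set.Ioi (0 : ℝ),
          {a : Metric.sphere (0 : Eucl n) 1 × Set.Ioi (0 : ℝ) | (a.2 : ℝ) < R a.1}.indicator
            (fun a => G a.1) a
          ∂((volume : Measure (Eucl n)).toSphere.prod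
            (Measure.volumeIoiPow (Module.finrank ℝ (Eucl n) - 1))) := by
        rw [← (Measure.measurePreserving_homeomorphUnitSphereProd
          (volume : Measure (Eucl n))).lintegral_comp_emb (Homeomorph.measurableEmbedding _)]
        refine lintegral_congr fun y => ?_
        set a := homeomorphUnitSphereProd (Eucl n) y with ha
        have hy : (y : Eucl n) = (a.2 : ℝ) • (a.1 : Eucl n) := by
          have := homeomorphUnitSphereProd_symm_apply_coe (Eucl n) a
          rwa [ha, Homeomorph.symm_apply_apply] at this
        have ha0 : 0 < (a.2 : ℝ) := a.2.2
        rw [hy]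
        by_cases h : (a.2 : ℝ) < R a.1
        · rw [Set.indicator_of_mem ((hU _ _ ha0).2 h), hφ _ _ ha0]
          exact (Set.indicator_of_mem (s := {a : Metric.sphere (0 : Eucl n) 1 × Set.Ioi (0 : ℝ) |
            (a.2 : ℝ) < R a.1}) h fun a => G a.1).symm
        · rw [Set.indicator_of_notMem (fun h' => h ((hU _ _ ha0).1 h'))]
          exact (Set.indicator_of_notMem (s := {a : Metric.sphere (0 : Eucl n) 1 ×
            Set.Ioi (0 : ℝ) | (a.2 : ℝ) < R a.1}) h fun a => G a.1).symm
    _ = ∫⁻ u, ∫⁻ r : Set.Ioi (0 : ℝ), (Set.Iio (⟨R u, Set.mem_Ioi.2 (hR0 u)⟩ : Set.Ioi (0 : ℝ))).indicator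
          (fun _ => G u) r ∂(Measure.volumeIoiPow (Module.finrank ℝ (Eucl n) - 1))
          ∂(volume : Measure (Eucl n)).toSphere := by
        have h1 : Measurable fun a : Metric.sphere (0 : Eucl n) 1 × Set.Ioi (0 : ℝ) => G a.1 :=
          hG.comp measurable_fst
        rw [lintegral_prod _ (h1.indicator hmeas).aemeasurable]
        rfl
    _ = _ := by
        refine lintegral_congr fun u => ?_
        rw [lintegral_indicator_const measurableSet_Iio, Measure.volumeIoiPow_apply_Iio, hdim,
          ← Nat.cast_add_one, hdim]

end Polar

section ReverseGauss

variable {n : ℕ} {Ω : Set (Eucl n)}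

open scoped ENNReal

lemma IsSmoothBody.smul_fderiv_gradient_smul (h : IsSmoothBody Ω) {x : Eucl n} (hx : x ≠ 0)
    {c : ℝ} (hc : 0 < c) : c • fderiv ℝ (gradient (suppFun Ω)) (c • x) =
      fderiv ℝ (gradient (suppFun Ω)) x := by
  have h1 : HasFDerivAt (fun y : Eucl n => gradient (suppFun Ω) (c • y))
      ((fderiv ℝ (gradient (suppFun Ω)) (c • x)).comp
        (c • ContinuousLinearMap.id ℝ (Eucl n))) x :=
    (h.differentiableAt_gradient (smul_ne_zero hc.ne' hx)).hasFDerivAt.comp x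
      ((hasFDerivAt_id x).const_smul c)
  have h2 : HasFDerivAt (fun y : Eucl n => gradient (suppFun Ω) (c • y))
      (fderiv ℝ (gradient (suppFun Ω)) x) x := by
    refine (h.differentiableAt_gradient hx).hasFDerivAt.congr_of_eventuallyEq ?_
    filter_upwards [isOpen_compl_singleton.mem_nhds hx] with y hy
    exact h.gradient_smul hy hc
  rw [← h1.unique h2, ContinuousLinearMap.comp_smul, ContinuousLinearMap.comp_id]

lemma IsSmoothBody.gradient_mem_frontier (h : IsSmoothBody Ω) {x : Eucl n} (hx : x ≠ 0) :
    gradient (suppFun Ω) x ∈ frontier Ω := by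
  refine ⟨subset_closure (h.gradient_mem hx), fun hi => ?_⟩
  exact (inner_lt_suppFun_of_mem_interior h.isCompact hx hi).ne (h.inner_gradient hx)

lemma IsSmoothBody.gradient_ne_zero (h : IsSmoothBody Ω) {x : Eucl n} (hx : x ≠ 0) :
    gradient (suppFun Ω) x ≠ 0 := by
  intro h0
  have := h.inner_gradient hx
  rw [h0, inner_zero_right] at this
  exact (h.suppFun_pos hx).ne this

lemma IsSmoothBody.radFun_gradient (h : IsSmoothBody Ω) {x : Eucl n} (hx : x ≠ 0) :
    radFun Ω (gradient (suppFun Ω) x) = 1 :=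
  radFun_eq_of_mem_frontier h.isCompact h.convex h.zero_mem_interior (h.gradient_ne_zero hx)
    one_pos (by rw [one_smul]; exact h.gradient_mem_frontier hx)

lemma IsSmoothBody.injOn_gradient (h : IsSmoothBody Ω) :
    Set.InjOn (gradient (suppFun Ω)) (Metric.sphere 0 1) := by
  intro u hu w hw huw
  have hu0 := ne_zero_of_mem_sphere_one hu
  have hw0 := ne_zero_of_mem_sphere_one hw
  have hu1 : ‖u‖ = 1 := by simpa using hu
  have hw1 : ‖w‖ = 1 := by simpa using hw
  set p := gradient (suppFun Ω) u with hp
  have hpu : ⟪u, p⟫ = suppFun Ω u := h.inner_gradient hu0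
  have hpw : ⟪w, p⟫ = suppFun Ω w := by rw [huw]; exact h.inner_gradient hw0
  have hup := h.suppFun_pos hu0
  have hwp := h.suppFun_pos hw0
  have hpΩ : p ∈ Ω := h.gradient_mem hu0
  have hseg : ∀ s ∈ Set.Icc (0 : ℝ) 1, gradient (suppFun Ω) (u + s • (w - u)) = p := by
    intro s hs
    have hz : u + s • (w - u) = (1 - s) • u + s • w := by module
    have h1 : ⟪u + s • (w - u), p⟫ = (1 - s) * suppFun Ω u + s * suppFun Ω w := by
      rw [hz, inner_add_left, real_inner_smul_left, real_inner_smul_left, hpu, hpw]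
    have h1pos : 0 < ⟪u + s • (w - u), p⟫ := by
      rw [h1]
      rcases hs.1.eq_or_lt with h0 | h0
      · simp [← h0, hup]
      · have := mul_pos h0 hwp
        have := mul_nonneg (sub_nonneg.2 hs.2) hup.le
        linarith
    refine h.gradient_eq ?_ hpΩ ?_
    · intro h0; rw [h0, inner_zero_left] at h1pos; exact lt_irrefl _ h1pos
    · refine le_antisymm (inner_le_suppFun h.isCompact _ hpΩ) ?_
      rw [h1]
      refine suppFun_le h.isCompact h.nonempty fun z hzΩ => ?_
      rw [hz, inner_add_left, real_inner_smul_left, real_inner_smul_left]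
      have h2 := inner_le_suppFun h.isCompact u hzΩ
      have h3 := inner_le_suppFun h.isCompact w hzΩ
      have h4 := mul_le_mul_of_nonneg_left h2 (sub_nonneg.2 hs.2)
      have h5 := mul_le_mul_of_nonneg_left h3 hs.1
      linarith
  have hA : fderiv ℝ (gradient (suppFun Ω)) u (w - u) = 0 := by
    have h1 : HasDerivAt (fun s : ℝ => gradient (suppFun Ω) (u + s • (w - u)))
        (fderiv ℝ (gradient (suppFun Ω)) u (w - u)) 0 := by
      have h2 : HasDerivAt (fun s : ℝ => u + s • (w - u)) (w - u) 0 := by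
        simpa using ((hasDerivAt_id (0 : ℝ)).smul_const (w - u)).const_add u
      have h3 : HasFDerivAt (gradient (suppFun Ω)) (fderiv ℝ (gradient (suppFun Ω)) u)
          (u + (0 : ℝ) • (w - u)) := by
        simpa using (h.differentiableAt_gradient hu0).hasFDerivAt
      exact h3.comp_hasDerivAt 0 h2
    refine (uniqueDiffOn_Icc (zero_lt_one' ℝ) 0 (by simp)).eq_deriv _ h1.hasDerivWithinAt
      ((hasDerivWithinAt_const 0 _ p).congr (fun s hs => hseg s hs) (hseg 0 (by simp)))
  have hv : curvOp (suppFun Ω) u (w - ⟪u, w⟫ • u) = 0 := by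
    have : w - ⟪u, w⟫ • u = (w - u) + (1 - ⟪u, w⟫) • u := by module
    rw [curvOp_apply, inner_sub_right, real_inner_smul_right, real_inner_self_eq_norm_sq, hu1,
      this, map_add, map_smul, hA, h.fderiv_gradient_self hu0]
    simp
  have hinj : Function.Injective (curvOp (suppFun Ω) u) := by
    rw [← LinearMap.ker_eq_bot]
    by_contra hk
    exact (h.curvDet_pos hu).ne' (LinearMap.det_eq_zero_iff_ker_ne_bot.2 hk)
  have hw2 : w = ⟪u, w⟫ • u := sub_eq_zero.1 (hinj (hv.trans (map_zero _).symm))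
  have hc : |⟪u, w⟫| = 1 := by
    have := congrArg norm hw2
    rwa [norm_smul, hu1, hw1, mul_one, eq_comm, Real.norm_eq_abs] at this
  rcases (abs_eq zero_le_one).1 hc with h1 | h1
  · rw [h1, one_smul] at hw2; exact hw2.symm
  · exfalso
    have h2 : ⟪w, p⟫ = -⟪u, p⟫ := by
      rw [h1, neg_one_smul] at hw2
      rw [hw2, inner_neg_left]
    linarith

/-- The `1`-homogeneous extension of the inverse Gauss map. -/
def coneMap (H : Eucl n → ℝ) (x : Eucl n) : Eucl n := ‖x‖ • gradient H x

/-- The derivative of `coneMap H` at `x`. -/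
def coneMapDeriv (H : Eucl n → ℝ) (x : Eucl n) : Eucl n →L[ℝ] Eucl n :=
  ‖x‖ • fderiv ℝ (gradient H) x + (innerSL ℝ (‖x‖⁻¹ • x)).smulRight (gradient H x)

lemma IsSmoothBody.hasFDerivAt_coneMap (h : IsSmoothBody Ω) {x : Eucl n} (hx : x ≠ 0) :
    HasFDerivAt (coneMap (suppFun Ω)) (coneMapDeriv (suppFun Ω) x) x := by
  have h1 := (hasGradientAt_norm hx).hasFDerivAt.smul
    (h.differentiableAt_gradient hx).hasFDerivAt
  exact h1

lemma IsSmoothBody.coneMapDeriv_smul (h : IsSmoothBody Ω) {x : Eucl n} (hx : ‖x‖ = 1) {r : ℝ}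
    (hr : 0 < r) : coneMapDeriv (suppFun Ω) (r • x) = coneMapDeriv (suppFun Ω) x := by
  have hx0 : x ≠ 0 := by rintro rfl; simp at hx
  have h1 : ‖r • x‖ = r := by rw [norm_smul, hx, Real.norm_of_nonneg hr.le, mul_one]
  rw [coneMapDeriv, coneMapDeriv, h1, hx, h.smul_fderiv_gradient_smul hx0 hr, one_smul,
    h.gradient_smul hx0 hr, smul_smul, inv_mul_cancel₀ hr.ne', inv_one, one_smul]

lemma IsSmoothBody.det_coneMapDeriv (h : IsSmoothBody Ω) {x : Eucl n} (hx : ‖x‖ = 1) :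
    (coneMapDeriv (suppFun Ω) x).det = suppFun Ω x * curvDet (suppFun Ω) x := by
  have hx0 : x ≠ 0 := by rintro rfl; simp at hx
  have h1 : (coneMapDeriv (suppFun Ω) x : Eucl n →ₗ[ℝ] Eucl n) =
      LinearMap.transvection (innerSL ℝ x : Eucl n →ₗ[ℝ] ℝ) (gradient (suppFun Ω) x - x) ∘ₗ
        curvOp (suppFun Ω) x := by
    ext1 v
    have h2 : ⟪x, fderiv ℝ (gradient (suppFun Ω)) x v⟫ = 0 := by
      rw [← h.fderiv_gradient_symm hx0, h.fderiv_gradient_self hx0, inner_zero_left]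
    have h3 : ⟪x, curvOp (suppFun Ω) x v⟫ = ⟪x, v⟫ := by
      rw [curvOp_apply, inner_add_right, h2, real_inner_smul_right, real_inner_self_eq_norm_sq, hx]
      ring
    rw [LinearMap.comp_apply, LinearMap.transvection.apply]
    simp only [ContinuousLinearMap.coe_coe, innerSL_apply_apply, h3]
    rw [curvOp_apply, coneMapDeriv, hx]
    simp only [add_apply,
      ContinuousLinearMap.smulRight_apply, innerSL_apply_apply, inv_one, one_smul]
    module
  rw [ContinuousLinearMap.det, h1, LinearMap.det_comp, LinearMap.transvection.det]
  congr 1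
  simp only [ContinuousLinearMap.coe_coe, innerSL_apply_apply]
  rw [inner_sub_right, h.inner_gradient hx0, real_inner_self_eq_norm_sq, hx]
  ring

lemma IsSmoothBody.coneMap_smul (h : IsSmoothBody Ω) {x : Eucl n} (hx : ‖x‖ = 1) {r : ℝ}
    (hr : 0 < r) : coneMap (suppFun Ω) (r • x) = r • gradient (suppFun Ω) x := by
  have hx0 : x ≠ 0 := by rintro rfl; simp at hx
  rw [coneMap, h.gradient_smul hx0 hr, norm_smul, hx, Real.norm_of_nonneg hr.le, mul_one]

lemma exists_smul_eq_of_ne_zero {x : Eucl n} (hx : x ≠ 0) :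
    ∃ r : ℝ, 0 < r ∧ ∃ u : Eucl n, ‖u‖ = 1 ∧ x = r • u :=
  ⟨‖x‖, norm_pos_iff.2 hx, ‖x‖⁻¹ • x, norm_smul_inv_norm hx, by
    rw [smul_smul, mul_inv_cancel₀ (norm_ne_zero_iff.2 hx), one_smul]⟩

lemma IsSmoothBody.injOn_coneMap (h : IsSmoothBody Ω) :
    Set.InjOn (coneMap (suppFun Ω)) {0}ᶜ := by
  intro x hx y hy hxy
  obtain ⟨r, hr, u, hu, rfl⟩ := exists_smul_eq_of_ne_zero hx
  obtain ⟨s, hs, w, hw, rfl⟩ := exists_smul_eq_of_ne_zero hy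
  have hu0 : u ≠ 0 := by rintro rfl; simp at hu
  have hw0 : w ≠ 0 := by rintro rfl; simp at hw
  rw [h.coneMap_smul hu hr, h.coneMap_smul hw hs] at hxy
  have h1 := congrArg (radFun Ω) hxy
  rw [radFun_smul h.isCompact h.zero_mem_interior (h.gradient_ne_zero hu0) hr,
    radFun_smul h.isCompact h.zero_mem_interior (h.gradient_ne_zero hw0) hs,
    h.radFun_gradient hu0, h.radFun_gradient hw0, mul_one, mul_one, inv_inj] at h1
  subst h1
  rw [h.injOn_gradient (by simpa using hu) (by simpa using hw)
    (smul_right_injective _ hr.ne' hxy)]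

lemma IsSmoothBody.image_coneMap (h : IsSmoothBody Ω) :
    coneMap (suppFun Ω) '' (Metric.ball 0 1 \ {0}) = interior Ω \ {0} := by
  ext y
  constructor
  · rintro ⟨x, ⟨hx1, hx0⟩, rfl⟩
    obtain ⟨r, hr, u, hu, rfl⟩ := exists_smul_eq_of_ne_zero hx0
    have hu0 : u ≠ 0 := by rintro rfl; simp at hu
    have hr1 : r < 1 := by
      simpa [norm_smul, hu, Real.norm_of_nonneg hr.le] using hx1
    rw [h.coneMap_smul hu hr]
    refine ⟨?_, smul_ne_zero hr.ne' (h.gradient_ne_zero hu0)⟩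
    exact smul_mem_interior_of_lt_radFun h.isCompact h.convex h.zero_mem_interior
      (h.gradient_ne_zero hu0) hr.le (by rwa [h.radFun_gradient hu0])
  · rintro ⟨hy, hy0⟩
    have hy0 : y ≠ 0 := hy0
    have h1 := (one_lt_radFun_iff h.isCompact h.convex h.zero_mem_interior hy0).2 hy
    have hρ := zero_lt_one.trans h1
    have hfr : radFun Ω y • y ∈ frontier Ω := by
      refine ⟨subset_closure (radFun_spec h.isCompact h.zero_mem_interior hy0).2.1, fun hi => ?_⟩
      have := (one_lt_radFun_iff h.isCompact h.convex h.zero_mem_interior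
        (smul_ne_zero hρ.ne' hy0)).2 hi
      rw [radFun_smul h.isCompact h.zero_mem_interior hy0 hρ, inv_mul_cancel₀ hρ.ne'] at this
      exact lt_irrefl _ this
    obtain ⟨u, hu, hu1⟩ :=
      exists_inner_eq_suppFun_of_mem_frontier h.isCompact h.convex h.nonempty hfr
    have hu0 := ne_zero_of_mem_sphere_one hu
    have hu2 : ‖u‖ = 1 := by simpa using hu
    refine ⟨(radFun Ω y)⁻¹ • u, ⟨?_, smul_ne_zero (inv_ne_zero hρ.ne') hu0⟩, ?_⟩
    · simpa [norm_smul, hu2, abs_of_pos hρ] using inv_lt_one_of_one_lt₀ h1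
    · rw [h.coneMap_smul hu2 (inv_pos.2 hρ), h.gradient_eq hu0
        (radFun_spec h.isCompact h.zero_mem_interior hy0).2.1 hu1, smul_smul,
        inv_mul_cancel₀ hρ.ne', one_smul]

lemma IsSmoothBody.continuous_radFun_sphere (h : IsSmoothBody Ω) :
    Continuous fun u : Metric.sphere (0 : Eucl n) 1 => radFun Ω u := by
  have h1 := continuousOn_radFun_family (X := Unit) (K := fun _ => Ω) (fun _ => h.isCompact)
    (fun _ => h.convex) (fun _ => h.zero_mem_interior)
    ((continuous_suppFun h.isCompact h.nonempty).comp continuous_snd)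
  exact h1.comp_continuous (f := fun u : Metric.sphere (0 : Eucl n) 1 => ((), (u : Eucl n)))
    (by fun_prop) fun u => ne_zero_of_mem_sphere_one u.2

lemma IsSmoothBody.continuous_gradient_sphere (h : IsSmoothBody Ω) :
    Continuous fun u : Metric.sphere (0 : Eucl n) 1 => gradient (suppFun Ω) u :=
  h.continuousOn_gradient.comp_continuous continuous_subtype_val
    fun u => ne_zero_of_mem_sphere_one u.2

lemma IsSmoothBody.continuous_curvDet_sphere (h : IsSmoothBody Ω) :
    Continuous fun u : Metric.sphere (0 : Eucl n) 1 => curvDet (suppFun Ω) u :=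
  h.continuousOn_curvDet.comp_continuous continuous_subtype_val
    fun u => ne_zero_of_mem_sphere_one u.2

/-- Change of variables from the radial to the inverse Gauss parametrization of `∂Ω`. -/
lemma IsSmoothBody.lintegral_radFun (hn : n ≠ 0) (h : IsSmoothBody Ω) {Ψ : Eucl n → ℝ≥0∞}
    (hΨ : Measurable Ψ) :
    ∫⁻ u : Metric.sphere (0 : Eucl n) 1,
        Ψ (radFun Ω u • (u : Eucl n)) * ENNReal.ofReal (radFun Ω u ^ n)
        ∂(volume : Measure (Eucl n)).toSphere =
      ∫⁻ u : Metric.sphere (0 : Eucl n) 1, Ψ (gradient (suppFun Ω) u) *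
        ENNReal.ofReal (suppFun Ω u * curvDet (suppFun Ω) u)
        ∂(volume : Measure (Eucl n)).toSphere := by
  have hn0 : (0 : ℝ) < n := by positivity
  have hH : Continuous (suppFun Ω) := continuous_suppFun h.isCompact h.nonempty
  have hr := h.continuous_radFun_sphere
  have hu1 : ∀ u : Metric.sphere (0 : Eucl n) 1, ‖(u : Eucl n)‖ = 1 := fun u => by simp
  have hu0 : ∀ u : Metric.sphere (0 : Eucl n) 1, (u : Eucl n) ≠ 0 :=
    fun u => ne_zero_of_mem_sphere_one u.2
  have e1 := setLIntegral_eq_lintegral_toSphere hn (U := interior Ω \ {0})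
    (isOpen_interior.measurableSet.diff (measurableSet_singleton 0))
    (φ := fun y => Ψ (radFun Ω y • y)) (G := fun u => Ψ (radFun Ω u • (u : Eucl n)))
    (hΨ.comp (hr.smul continuous_subtype_val).measurable) (R := fun u => radFun Ω u) hr.measurable
    (fun u => radFun_pos h.isCompact h.zero_mem_interior (hu0 u)) (by simp)
    (fun u r hr0 => by
      have h1 := one_lt_radFun_iff h.isCompact h.convex h.zero_mem_interior
        (smul_ne_zero hr0.ne' (hu0 u))
      rw [Set.mem_sdiff, ← h1, radFun_smul h.isCompact h.zero_mem_interior (hu0 u) hr0,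
        lt_inv_mul_iff₀ hr0, mul_one]
      exact and_iff_left (smul_ne_zero hr0.ne' (hu0 u)))
    (fun u r hr0 => by
      rw [radFun_smul h.isCompact h.zero_mem_interior (hu0 u) hr0, smul_smul, mul_right_comm,
        inv_mul_cancel₀ hr0.ne', one_mul])
  have e2 := setLIntegral_eq_lintegral_toSphere hn (U := Metric.ball (0 : Eucl n) 1 \ {0})
    (Metric.isOpen_ball.measurableSet.diff (measurableSet_singleton 0))
    (φ := fun x => ENNReal.ofReal |(coneMapDeriv (suppFun Ω) x).det| *
      Ψ (radFun Ω (coneMap (suppFun Ω) x) • coneMap (suppFun Ω) x))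
    (G := fun u => ENNReal.ofReal (suppFun Ω u * curvDet (suppFun Ω) u) *
      Ψ (gradient (suppFun Ω) u))
    ((ENNReal.measurable_ofReal.comp ((hH.comp continuous_subtype_val).mul
      h.continuous_curvDet_sphere).measurable).mul
      (hΨ.comp h.continuous_gradient_sphere.measurable))
    (R := fun _ => 1) measurable_const (fun u => one_pos) (by simp)
    (fun u r hr0 => by
      have : r • (u : Eucl n) ≠ 0 := smul_ne_zero hr0.ne' (hu0 u)
      simp [norm_smul, abs_of_pos hr0, this])
    (fun u r hr0 => by
      rw [h.coneMapDeriv_smul (hu1 u) hr0, h.det_coneMapDeriv (hu1 u), h.coneMap_smul (hu1 u) hr0,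
        radFun_smul h.isCompact h.zero_mem_interior (h.gradient_ne_zero (hu0 u)) hr0,
        h.radFun_gradient (hu0 u), mul_one, smul_smul, inv_mul_cancel₀ hr0.ne', one_smul,
        abs_of_pos (mul_pos (h.suppFun_pos (hu0 u)) (h.curvDet_pos u.2))])
  rw [← h.image_coneMap, lintegral_image_eq_lintegral_abs_det_fderiv_mul volume
    (Metric.isOpen_ball.measurableSet.diff (measurableSet_singleton 0))
    (fun x hx => (h.hasFDerivAt_coneMap hx.2).hasFDerivWithinAt)
    (h.injOn_coneMap.mono fun x hx => hx.2), e2] at e1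
  have hc : ENNReal.ofReal n ≠ ∞ := ENNReal.ofReal_ne_top
  have e3 := congrArg (fun a => a * ENNReal.ofReal n) e1.symm
  rw [← lintegral_mul_const' _ _ hc, ← lintegral_mul_const' _ _ hc] at e3
  refine (lintegral_congr fun u => ?_).trans (e3.trans (lintegral_congr fun u => ?_))
  · rw [mul_assoc, ← ENNReal.ofReal_mul (by have := radFun_nonneg (K := Ω) (u : Eucl n); positivity),
      div_mul_cancel₀ _ hn0.ne']
  · rw [mul_assoc, ← ENNReal.ofReal_mul (by positivity), one_pow, div_mul_cancel₀ _ hn0.ne',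
      ENNReal.ofReal_one, mul_one, mul_comm]

end ReverseGauss

section Chord

variable {n : ℕ} {q : ℝ}

lemma integrableOn_ball_inv_norm_rpow (hn : n ≠ 0) (hq : 1 < q) (r : ℝ) :
    IntegrableOn (fun z : Eucl n => (‖z‖ ^ ((n : ℝ) - q + 1))⁻¹) (Metric.ball 0 r) := by
  have : NeZero n := ⟨hn⟩
  rw [integrableOn_fun_norm_addHaar volume (f := fun s : ℝ => (s ^ ((n : ℝ) - q + 1))⁻¹)]
  rcases le_or_gt r 0 with hr | hr
  · simp [Set.Ioo_eq_empty_of_le hr]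
  · have h1 : IntegrableOn (fun s : ℝ => s ^ (q - 2)) (Set.Ioo 0 r) :=
      (intervalIntegral.integrableOn_Ioo_rpow_iff hr).2 (by linarith)
    refine h1.congr_fun (fun s hs => ?_) measurableSet_Ioo
    have h2 : ((n - 1 : ℕ) : ℝ) = n - 1 := Nat.cast_pred (Nat.pos_of_ne_zero hn)
    simp only [finrank_euclideanSpace_fin, smul_eq_mul]
    rw [← Real.rpow_natCast, h2, ← Real.rpow_neg hs.1.le, ← Real.rpow_add hs.1]
    congr 1
    ring

/-- The integrand of `Vtilde` after translating the singularity to the origin. -/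
def chordKernel (q : ℝ) (K : Set (Eucl n)) (y z : Eucl n) : ℝ :=
  K.indicator (fun w => Real.exp (-‖w‖ ^ 2 / 2)) (z + y) * (‖z‖ ^ ((n : ℝ) - q + 1))⁻¹

lemma Vtilde_eq_integral_chordKernel {K : Set (Eucl n)} (hK : MeasurableSet K) (y : Eucl n) :
    Vtilde q K y = 2 * Real.exp (-‖y‖ ^ 2 / 2) * ∫ z, chordKernel q K y z := by
  rw [Vtilde, ← integral_indicator hK, ← integral_add_right_eq_self _ y]
  congr 2
  funext z
  by_cases h : z + y ∈ K
  · simp [chordKernel, h, div_eq_mul_inv]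
  · simp [chordKernel, h]

lemma chordKernel_nonneg (K : Set (Eucl n)) (y z : Eucl n) : 0 ≤ chordKernel q K y z := by
  refine mul_nonneg (Set.indicator_nonneg (fun w _ => (Real.exp_pos _).le) _) (by positivity)

lemma measurable_chordKernel {K : Set (Eucl n)} (hK : MeasurableSet K) (y : Eucl n) :
    Measurable (chordKernel q K y) := by
  have h1 : Measurable fun w : Eucl n => Real.exp (-‖w‖ ^ 2 / 2) := by fun_prop
  exact ((h1.indicator hK).comp (measurable_id.add_const y)).mul (by fun_prop)

lemma chordKernel_le {K : Set (Eucl n)} {R : ℝ} (hR : ∀ z ∈ K, ‖z‖ ≤ R) {r : ℝ} {y : Eucl n}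
    (hr : R + ‖y‖ < r) (z : Eucl n) : chordKernel q K y z ≤
      (Metric.ball 0 r).indicator (fun z : Eucl n => (‖z‖ ^ ((n : ℝ) - q + 1))⁻¹) z := by
  by_cases h : z + y ∈ K
  · have h1 : z ∈ Metric.ball (0 : Eucl n) r := by
      have h2 := norm_sub_le (z + y) y
      rw [add_sub_cancel_right] at h2
      have h3 := hR _ h
      rw [mem_ball_zero_iff]
      linarith
    rw [chordKernel, Set.indicator_of_mem h, Set.indicator_of_mem h1]
    have h2 : Real.exp (-‖z + y‖ ^ 2 / 2) ≤ 1 := Real.exp_le_one_iff.2 (by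
      have := sq_nonneg ‖z + y‖; linarith)
    exact mul_le_of_le_one_left (by positivity) h2
  · rw [chordKernel, Set.indicator_of_notMem h, zero_mul]
    exact Set.indicator_nonneg (fun w _ => by positivity) _

lemma integrable_indicator_ball_inv_norm_rpow (hn : n ≠ 0) (hq : 1 < q) (r : ℝ) :
    Integrable ((Metric.ball 0 r).indicator
      (fun z : Eucl n => (‖z‖ ^ ((n : ℝ) - q + 1))⁻¹)) :=
  (integrableOn_ball_inv_norm_rpow hn hq r).integrable_indicator Metric.isOpen_ball.measurableSet

lemma integrable_chordKernel (hn : n ≠ 0) (hq : 1 < q) {K : Set (Eucl n)} (hK : IsCompact K)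
    (y : Eucl n) : Integrable (chordKernel q K y) := by
  obtain ⟨R, -, hR⟩ := exists_forall_norm_le hK
  refine (integrable_indicator_ball_inv_norm_rpow hn hq (R + ‖y‖ + 1)).mono'
    (measurable_chordKernel hK.measurableSet y).aestronglyMeasurable
    (Eventually.of_forall fun z => ?_)
  rw [Real.norm_of_nonneg (chordKernel_nonneg K y z)]
  exact chordKernel_le hR (lt_add_one _) z

lemma Vtilde_nonneg (K : Set (Eucl n)) (y : Eucl n) : 0 ≤ Vtilde q K y :=
  mul_nonneg (by positivity) (integral_nonneg fun z => by positivity)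

lemma Vtilde_pos (hn : n ≠ 0) (hq : 1 < q) {K : Set (Eucl n)} (hK : IsCompact K)
    (h0 : (0 : Eucl n) ∈ interior K) (y : Eucl n) : 0 < Vtilde q K y := by
  have : NeZero n := ⟨hn⟩
  rw [Vtilde_eq_integral_chordKernel hK.measurableSet]
  refine mul_pos (by positivity) ?_
  rw [integral_pos_iff_support_of_nonneg (chordKernel_nonneg K y)
    (integrable_chordKernel hn hq hK y)]
  have h1 : ((fun z => z + y) ⁻¹' interior K) \ {0} ⊆ Function.support (chordKernel q K y) := by
    rintro z ⟨hz, hz0⟩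
    have h2 : z + y ∈ K := interior_subset hz
    have h3 : 0 < ‖z‖ := norm_pos_iff.2 hz0
    rw [Function.mem_support, chordKernel, Set.indicator_of_mem h2]
    positivity
  refine lt_of_lt_of_le ?_ (measure_mono h1)
  rw [measure_sdiff_null (measure_singleton _)]
  exact (isOpen_interior.preimage (by fun_prop : Continuous fun z => z + y)).measure_pos volume
    ⟨-y, by simpa using h0⟩

lemma continuous_Vtilde_family (hn : n ≠ 0) (hq : 1 < q) {X : Type*} [TopologicalSpace X]
    [FirstCountableTopology X] {K : X → Set (Eucl n)} (hK : ∀ t, IsCompact (K t))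
    (hc : ∀ t, Convex ℝ (K t)) (hne : ∀ t, (K t).Nonempty) {R : ℝ}
    (hR : ∀ t, ∀ z ∈ K t, ‖z‖ ≤ R)
    (hcont : Continuous fun a : X × Eucl n => suppFun (K a.1) a.2) :
    Continuous fun a : X × Eucl n => Vtilde q (K a.1) a.2 := by
  simp_rw [fun a : X × Eucl n => Vtilde_eq_integral_chordKernel (q := q)
    (hK a.1).measurableSet a.2]
  refine Continuous.mul (by fun_prop) (continuous_iff_continuousAt.2 fun a => ?_)
  obtain ⟨t, y⟩ := a
  refine tendsto_integral_filter_of_dominated_convergence _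
    (Eventually.of_forall fun b => (measurable_chordKernel
      (hK b.1).measurableSet b.2).aestronglyMeasurable) ?_
    (integrable_indicator_ball_inv_norm_rpow (n := n) (q := q) hn hq (R + (‖y‖ + 1))) ?_
  · have h1 : ∀ᶠ b : X × Eucl n in 𝓝 (t, y), ‖b.2‖ < ‖y‖ + 1 :=
      (isOpen_lt (by fun_prop : Continuous fun b : X × Eucl n => ‖b.2‖)
        continuous_const).mem_nhds (lt_add_one ‖y‖)
    filter_upwards [h1] with b hb
    refine Eventually.of_forall fun z => ?_
    rw [Real.norm_of_nonneg (chordKernel_nonneg (K b.1) b.2 z)]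
    exact chordKernel_le (hR b.1) (by linarith) z
  · have h1 : ∀ᵐ z : Eucl n, z + y ∉ frontier (K t) :=
      (measurePreserving_add_right volume y).quasiMeasurePreserving.ae
        (measure_eq_zero_iff_ae_notMem.1 ((hc t).addHaar_frontier volume))
    filter_upwards [h1] with z hz
    have hmap : Tendsto (fun b : X × Eucl n => (b.1, z + b.2)) (𝓝 (t, y)) (𝓝 (t, z + y)) :=
      (by fun_prop : Continuous fun b : X × Eucl n => (b.1, z + b.2)).tendsto _
    refine Tendsto.mul_const _ ?_
    by_cases hm : z + y ∈ K t
    · have hi : z + y ∈ interior (K t) := by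
        by_contra hi
        exact hz ⟨subset_closure hm, hi⟩
      have h2 := hmap.eventually (eventually_mem_of_mem_interior hK hc hne hcont hi)
      rw [Set.indicator_of_mem hm]
      have h3 : Tendsto (fun b : X × Eucl n => Real.exp (-‖z + b.2‖ ^ 2 / 2)) (𝓝 (t, y))
          (𝓝 (Real.exp (-‖z + y‖ ^ 2 / 2))) :=
        (by fun_prop : Continuous fun b : X × Eucl n =>
          Real.exp (-‖z + b.2‖ ^ 2 / 2)).tendsto _
      refine h3.congr' ?_
      filter_upwards [h2] with b hb
      exact (Set.indicator_of_mem (s := K b.1) hb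
        fun w => Real.exp (-‖w‖ ^ 2 / 2)).symm
    · have h2 := hmap.eventually (eventually_notMem_of_notMem hK hc hne hcont hm)
      rw [Set.indicator_of_notMem hm]
      refine tendsto_const_nhds.congr' ?_
      filter_upwards [h2] with b hb
      exact (Set.indicator_of_notMem (s := K b.1) hb
        fun w => Real.exp (-‖w‖ ^ 2 / 2)).symm

end Chord

section ReverseGaussIntegral

variable {n : ℕ} {q : ℝ} {Ω : Set (Eucl n)}

lemma IsSmoothBody.continuous_Vtilde (hn : n ≠ 0) (hq : 1 < q) (h : IsSmoothBody Ω) :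
    Continuous (Vtilde q Ω) := by
  obtain ⟨R, -, hR⟩ := exists_forall_norm_le h.isCompact
  have h0 : Continuous fun a : Unit × Eucl n => suppFun Ω a.2 :=
    (continuous_suppFun h.isCompact h.nonempty).comp continuous_snd
  have h1 : Continuous fun a : Unit × Eucl n => Vtilde q Ω a.2 :=
    continuous_Vtilde_family (K := fun _ => Ω) hn hq (fun _ => h.isCompact)
      (fun _ => h.convex) (fun _ => h.nonempty) (fun _ => hR) h0
  rw [show Vtilde q Ω = (fun a : Unit × Eucl n => Vtilde q Ω a.2) ∘ fun y => ((), y) from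
    funext fun y => rfl]
  exact h1.comp (by fun_prop)

lemma integral_sphereMeasure_eq_of_lintegral_toSphere_eq (hn : n ≠ 0)
    {F G : Metric.sphere (0 : Eucl n) 1 → ℝ} (hF : Continuous F) (hG : Continuous G)
    (hF0 : ∀ u, 0 ≤ F u) (hG0 : ∀ u, 0 ≤ G u)
    (h : ∫⁻ u, ENNReal.ofReal (F u) ∂(volume : Measure (Eucl n)).toSphere =
      ∫⁻ u, ENNReal.ofReal (G u) ∂(volume : Measure (Eucl n)).toSphere) :
    ∫ u, F u ∂sphereMeasure n = ∫ u, G u ∂sphereMeasure n := by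
  obtain ⟨c, -, hc⟩ := exists_sphereMeasure_eq_smul_toSphere hn
  rw [hc, integral_smul_nnreal_measure, integral_smul_nnreal_measure,
    integral_eq_lintegral_of_nonneg_ae (Eventually.of_forall hF0) hF.aestronglyMeasurable,
    integral_eq_lintegral_of_nonneg_ae (Eventually.of_forall hG0) hG.aestronglyMeasurable, h]

lemma IsSmoothBody.integral_Vtilde_radFun (hn : n ≠ 0) (hq : 1 < q) (h : IsSmoothBody Ω) :
    ∫ ξ in Metric.sphere (0 : Eucl n) 1,
        Vtilde q Ω (radFun Ω ξ • ξ) * radFun Ω ξ ^ n ∂μH[(n : ℝ) - 1] =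
      ∫ u : Metric.sphere (0 : Eucl n) 1, Vtilde q Ω (gradient (suppFun Ω) u) *
        (suppFun Ω u * curvDet (suppFun Ω) u) ∂sphereMeasure n := by
  have hV := h.continuous_Vtilde hn hq
  have hH : Continuous (suppFun Ω) := continuous_suppFun h.isCompact h.nonempty
  have hHD : ∀ u : Metric.sphere (0 : Eucl n) 1, 0 ≤ suppFun Ω u * curvDet (suppFun Ω) u :=
    fun u => (mul_pos (h.suppFun_pos (ne_zero_of_mem_sphere_one u.2)) (h.curvDet_pos u.2)).le
  have hρ : ∀ u : Metric.sphere (0 : Eucl n) 1, 0 ≤ radFun Ω (u : Eucl n) ^ n :=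
    fun u => pow_nonneg (radFun_nonneg _) n
  rw [setIntegral_sphere (n := n)]
  refine integral_sphereMeasure_eq_of_lintegral_toSphere_eq hn
    ((hV.comp (h.continuous_radFun_sphere.smul continuous_subtype_val)).mul
      (h.continuous_radFun_sphere.pow n))
    ((hV.comp h.continuous_gradient_sphere).mul
      ((hH.comp continuous_subtype_val).mul h.continuous_curvDet_sphere))
    (fun u => mul_nonneg (Vtilde_nonneg _ _) (hρ u))
    (fun u => mul_nonneg (Vtilde_nonneg _ _) (hHD u)) ?_
  simp_rw [ENNReal.ofReal_mul (Vtilde_nonneg (q := q) Ω _)]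
  exact h.lintegral_radFun hn (Ψ := fun y => ENNReal.ofReal (Vtilde q Ω y))
    (ENNReal.measurable_ofReal.comp hV.measurable)

end ReverseGaussIntegral

section Theta

variable {n : ℕ} {q p : ℝ} {f : Eucl n → ℝ} {Ω : Set (Eucl n)}

lemma theta_nonneg (hf : ∀ x ∈ Metric.sphere (0 : Eucl n) 1, 0 ≤ f x)
    (hΩ : ∀ x ∈ Metric.sphere (0 : Eucl n) 1, 0 ≤ suppFun Ω x) : 0 ≤ theta q p f Ω := by
  refine div_nonneg
    (setIntegral_nonneg Metric.isClosed_sphere.measurableSet fun ξ _ => ?_)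
    (setIntegral_nonneg Metric.isClosed_sphere.measurableSet fun x hx => ?_)
  · exact mul_nonneg (Vtilde_nonneg _ _) (pow_nonneg (radFun_nonneg _) _)
  · exact mul_nonneg (Real.rpow_nonneg (hΩ x hx) _) (hf x hx)

lemma IsSmoothBody.flowRHS_le (h : IsSmoothBody Ω)
    (hf : ∀ x ∈ Metric.sphere (0 : Eucl n) 1, 0 < f x) {x : Eucl n}
    (hx : x ∈ Metric.sphere (0 : Eucl n) 1) : flowRHS q p f Ω x ≤ suppFun Ω x := by
  have h1 : 0 ≤ theta q p f Ω := theta_nonneg (fun x hx => (hf x hx).le)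
    fun x hx => (h.suppFun_pos (ne_zero_of_mem_sphere_one hx)).le
  have h2 : 0 ≤ theta q p f Ω * suppFun Ω x ^ p * (curvDet (suppFun Ω) x)⁻¹ * f x /
      Vtilde q Ω (gradient (suppFun Ω) x) :=
    div_nonneg (mul_nonneg (mul_nonneg (mul_nonneg h1 (Real.rpow_nonneg
      (h.suppFun_pos (ne_zero_of_mem_sphere_one hx)).le _)) (inv_nonneg.2 (h.curvDet_pos hx).le))
      (hf x hx).le) (Vtilde_nonneg _ _)
  rw [flowRHS, neg_mul, neg_mul, neg_mul, neg_div]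
  linarith

lemma integral_sphereMeasure_pos (hn : n ≠ 0) {F : Metric.sphere (0 : Eucl n) 1 → ℝ}
    (hF : Continuous F) (hF0 : ∀ u, 0 < F u) : 0 < ∫ u, F u ∂sphereMeasure n := by
  have := isFiniteMeasure_sphereMeasure hn
  have := isOpenPosMeasure_sphereMeasure hn
  have : NeZero n := ⟨hn⟩
  obtain ⟨u⟩ : Nonempty (Metric.sphere (0 : Eucl n) 1) :=
    (NormedSpace.sphere_nonempty.2 zero_le_one).to_subtype
  refine hF.integral_pos_of_hasCompactSupport_nonneg_nonzero ?_ (fun u => (hF0 u).le) (hF0 u).ne'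
  exact HasCompactSupport.of_compactSpace F

lemma IsSmoothBody.theta_eq (hn : n ≠ 0) (hq : 1 < q) (h : IsSmoothBody Ω) :
    theta q p f Ω =
      (∫ u : Metric.sphere (0 : Eucl n) 1, Vtilde q Ω (gradient (suppFun Ω) u) *
        (suppFun Ω u * curvDet (suppFun Ω) u) ∂sphereMeasure n) /
      ∫ u : Metric.sphere (0 : Eucl n) 1, suppFun Ω u ^ p * f u ∂sphereMeasure n := by
  rw [theta, h.integral_Vtilde_radFun hn hq, setIntegral_sphere]

lemma IsSmoothBody.theta_pos (hn : n ≠ 0) (hq : 1 < q) (hp : 0 < p) (h : IsSmoothBody Ω)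
    (hfc : Continuous f) (hf : ∀ x ∈ Metric.sphere (0 : Eucl n) 1, 0 < f x) :
    0 < theta q p f Ω := by
  have hH : Continuous (suppFun Ω) := continuous_suppFun h.isCompact h.nonempty
  have hpos : ∀ u : Metric.sphere (0 : Eucl n) 1, 0 < suppFun Ω u := fun u =>
    h.suppFun_pos (ne_zero_of_mem_sphere_one u.2)
  rw [h.theta_eq hn hq]
  refine div_pos (integral_sphereMeasure_pos hn ?_ fun u => ?_)
    (integral_sphereMeasure_pos hn ?_ fun u => ?_)
  · exact ((h.continuous_Vtilde hn hq).comp h.continuous_gradient_sphere).mul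
      ((hH.comp continuous_subtype_val).mul h.continuous_curvDet_sphere)
  · exact mul_pos (Vtilde_pos hn hq h.isCompact h.zero_mem_interior _)
      (mul_pos (hpos u) (h.curvDet_pos u.2))
  · exact ((hH.comp continuous_subtype_val).rpow_const fun u => Or.inr hp.le).mul
      (hfc.comp continuous_subtype_val)
  · exact mul_pos (Real.rpow_pos_of_pos (hpos u) _) (hf u u.2)

lemma continuous_theta_family (hn : n ≠ 0) (hq : 1 < q) (hp : 0 < p) (hfc : Continuous f)
    (hf : ∀ x ∈ Metric.sphere (0 : Eucl n) 1, 0 < f x) {X : Type*} [TopologicalSpace X]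
    [FirstCountableTopology X] [LocallyCompactSpace X] {K : X → Set (Eucl n)}
    (hK : ∀ t, IsSmoothBody (K t)) {R : ℝ} (hR : ∀ t, ∀ z ∈ K t, ‖z‖ ≤ R)
    (hcont : Continuous fun a : X × Eucl n => suppFun (K a.1) a.2) :
    Continuous fun t => theta q p f (K t) := by
  have := isFiniteMeasure_sphereMeasure hn
  have hV : Continuous fun a : X × Eucl n => Vtilde q (K a.1) a.2 :=
    continuous_Vtilde_family hn hq (fun t => (hK t).isCompact) (fun t => (hK t).convex)
      (fun t => (hK t).nonempty) hR hcont
  have hv : Continuous fun a : X × Metric.sphere (0 : Eucl n) 1 => (a.1, (a.2 : Eucl n)) := by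
    fun_prop
  have hρ : Continuous fun a : X × Metric.sphere (0 : Eucl n) 1 => radFun (K a.1) a.2 :=
    (continuousOn_radFun_family (fun t => (hK t).isCompact) (fun t => (hK t).convex)
      (fun t => (hK t).zero_mem_interior) hcont).comp_continuous hv
      fun a => ne_zero_of_mem_sphere_one a.2.2
  have h1 : Continuous fun t => ∫ u : Metric.sphere (0 : Eucl n) 1,
      Vtilde q (K t) (radFun (K t) u • (u : Eucl n)) * radFun (K t) u ^ n ∂sphereMeasure n := by
    have h2 : Continuous fun a : X × Metric.sphere (0 : Eucl n) 1 =>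
        (a.1, radFun (K a.1) a.2 • (a.2 : Eucl n)) :=
      continuous_fst.prodMk (hρ.smul (continuous_subtype_val.comp continuous_snd))
    have h3 : Continuous fun a : X × Metric.sphere (0 : Eucl n) 1 =>
        Vtilde q (K a.1) (radFun (K a.1) a.2 • (a.2 : Eucl n)) := by
      have h4 := hV.comp h2
      simpa only [Function.comp_def] using h4
    simpa using continuous_parametric_integral_of_continuous (μ := sphereMeasure n)
      (f := fun (t : X) (u : Metric.sphere (0 : Eucl n) 1) =>
        Vtilde q (K t) (radFun (K t) u • (u : Eucl n)) * radFun (K t) u ^ n)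
      (h3.mul (hρ.pow n)) isCompact_univ
  have h2 : Continuous fun t => ∫ u : Metric.sphere (0 : Eucl n) 1,
      suppFun (K t) u ^ p * f u ∂sphereMeasure n := by
    have h3 : Continuous fun a : X × Metric.sphere (0 : Eucl n) 1 => suppFun (K a.1) a.2 :=
      hcont.comp hv
    simpa using continuous_parametric_integral_of_continuous (μ := sphereMeasure n)
      (f := fun (t : X) (u : Metric.sphere (0 : Eucl n) 1) => suppFun (K t) u ^ p * f u)
      ((h3.rpow_const fun u => Or.inr hp.le).mul
        (hfc.comp (continuous_subtype_val.comp continuous_snd))) isCompact_univ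
  simp only [theta, setIntegral_sphere]
  refine h1.div h2 fun t => (integral_sphereMeasure_pos hn ?_ fun u => ?_).ne'
  · exact (((continuous_suppFun (hK t).isCompact (hK t).nonempty).comp
      continuous_subtype_val).rpow_const fun u => Or.inr hp.le).mul
      (hfc.comp continuous_subtype_val)
  · exact mul_pos (Real.rpow_pos_of_pos
      ((hK t).suppFun_pos (ne_zero_of_mem_sphere_one u.2)) _) (hf u u.2)

end Theta

section FlowRegularity

variable {n : ℕ} {q p T : ℝ} {f : Eucl n → ℝ} {K : ℝ → Set (Eucl n)}

lemma hasDerivWithinAt_exp_neg_mul {g : ℝ → ℝ} {g' t : ℝ} {D : Set ℝ}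
    (hg : HasDerivWithinAt g g' D t) :
    HasDerivWithinAt (fun s => Real.exp (-s) * g s) (Real.exp (-t) * (g' - g t)) D t := by
  have h1 : HasDerivWithinAt (fun s : ℝ => Real.exp (-s)) (-Real.exp (-t)) D t := by
    simpa using ((hasDerivAt_neg t).exp).hasDerivWithinAt
  exact (h1.mul hg).congr_deriv (by ring)

lemma IsGaussChordFlow.antitoneOn_exp_neg_mul (hflow : IsGaussChordFlow q p f (Set.Ico 0 T) K)
    (hsmooth : ∀ t ∈ Set.Ico (0 : ℝ) T, IsSmoothBody (K t))
    (hf : ∀ x ∈ Metric.sphere (0 : Eucl n) 1, 0 < f x) {x : Eucl n}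
    (hx : x ∈ Metric.sphere (0 : Eucl n) 1) :
    AntitoneOn (fun t => Real.exp (-t) * suppFun (K t) x) (Set.Ico 0 T) :=
  antitoneOn_of_hasDerivWithinAt_nonpos (convex_Ico 0 T)
    (fun t ht => (hasDerivWithinAt_exp_neg_mul (hflow t ht x hx)).continuousWithinAt)
    (fun t ht => (hasDerivWithinAt_exp_neg_mul (hflow t (interior_subset ht) x hx)).mono
      interior_subset) fun t ht =>
    mul_nonpos_of_nonneg_of_nonpos (Real.exp_pos _).le
      (sub_nonpos.2 ((hsmooth t (interior_subset ht)).flowRHS_le hf hx))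

lemma IsGaussChordFlow.exists_forall_norm_le (hT : 0 < T)
    (hflow : IsGaussChordFlow q p f (Set.Ico 0 T) K)
    (hsmooth : ∀ t ∈ Set.Ico (0 : ℝ) T, IsSmoothBody (K t))
    (hf : ∀ x ∈ Metric.sphere (0 : Eucl n) 1, 0 < f x) :
    ∃ R : ℝ, 0 < R ∧ ∀ t ∈ Set.Ico 0 T, ∀ z ∈ K t, ‖z‖ ≤ R := by
  have h0 : (0 : ℝ) ∈ Set.Ico 0 T := ⟨le_rfl, hT⟩
  obtain ⟨R, hR0, hR⟩ := _root_.exists_forall_norm_le (hsmooth 0 h0).isCompact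
  refine ⟨Real.exp T * R, by positivity, fun t ht z hz =>
    norm_le_of_suppFun_le (hsmooth t ht).isCompact (by positivity) (fun x hx => ?_) hz⟩
  have h1 := hflow.antitoneOn_exp_neg_mul hsmooth hf hx h0 ht ht.1
  have h2 : suppFun (K 0) x ≤ R := suppFun_le (hsmooth 0 h0).isCompact (hsmooth 0 h0).nonempty
    fun z hz => (real_inner_le_norm x z).trans (by
      rw [mem_sphere_zero_iff_norm.1 hx, one_mul]; exact hR z hz)
  simp only [neg_zero, Real.exp_zero, one_mul] at h1
  calc suppFun (K t) x = Real.exp t * (Real.exp (-t) * suppFun (K t) x) := by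
        rw [← mul_assoc, ← Real.exp_add, add_neg_cancel, Real.exp_zero, one_mul]
    _ ≤ Real.exp t * R := mul_le_mul_of_nonneg_left (h1.trans h2) (Real.exp_pos _).le
    _ ≤ Real.exp T * R := by gcongr; exact ht.2.le

lemma continuous_suppFun_family {X : Type*} [TopologicalSpace X] {K : X → Set (Eucl n)}
    (hK : ∀ t, IsCompact (K t)) (hne : ∀ t, (K t).Nonempty) {R : ℝ}
    (hR : ∀ t, ∀ z ∈ K t, ‖z‖ ≤ R)
    (hcont : ∀ x ∈ Metric.sphere (0 : Eucl n) 1, Continuous fun t => suppFun (K t) x) :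
    Continuous fun a : X × Eucl n => suppFun (K a.1) a.2 := by
  have h1 : ∀ x : Eucl n, Continuous fun t => suppFun (K t) x := by
    intro x
    rcases eq_or_ne x 0 with rfl | hx
    · have : (fun t => suppFun (K t) 0) = fun _ => 0 := funext fun t => by
        simpa using suppFun_smul (hK t) (hne t) le_rfl (0 : Eucl n) (c := 0)
      rw [this]
      exact continuous_const
    · obtain ⟨r, hr, u, hu, rfl⟩ := exists_smul_eq_of_ne_zero hx
      simp_rw [suppFun_smul (hK _) (hne _) hr.le]
      exact (hcont u (by simpa using hu)).const_mul r
  refine continuous_iff_continuousAt.2 fun ⟨t, x⟩ => ?_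
  rw [ContinuousAt, tendsto_iff_dist_tendsto_zero]
  have h2 : Tendsto (fun a : X × Eucl n => R * ‖a.2 - x‖ + |suppFun (K a.1) x - suppFun (K t) x|)
      (𝓝 (t, x)) (𝓝 0) := by
    have h3 : Continuous fun a : X × Eucl n =>
        R * ‖a.2 - x‖ + |suppFun (K a.1) x - suppFun (K t) x| :=
      Continuous.add (by fun_prop) (((h1 x).comp continuous_fst).sub continuous_const).abs
    simpa using h3.tendsto (t, x)
  refine squeeze_zero (fun _ => dist_nonneg) (fun a => ?_) h2
  rw [Real.dist_eq]
  exact (abs_sub_le _ (suppFun (K a.1) x) _).trans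
    (add_le_add (abs_suppFun_sub_le (hK _) (hne _) (hR _) _ _) le_rfl)

end FlowRegularity

section ChordComparison

variable {n : ℕ} {q : ℝ}

lemma exp_mul_gaussian_le {R δ a b : ℝ} (hb : 0 ≤ b) (haR : a ≤ R) (hbR : b ≤ R) (ha : 0 ≤ a)
    (hδ : 0 ≤ δ) (hba : b ≤ a + δ) :
    Real.exp (-(R * δ)) * Real.exp (-a ^ 2 / 2) ≤ Real.exp (-b ^ 2 / 2) := by
  rw [← Real.exp_add, Real.exp_le_exp]
  have h1 : b ^ 2 - a ^ 2 ≤ 2 * R * δ := by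
    calc b ^ 2 - a ^ 2 = (b - a) * (b + a) := by ring
      _ ≤ δ * (b + a) := by gcongr; linarith
      _ ≤ δ * (2 * R) := by gcongr; linarith
      _ = 2 * R * δ := by ring
  linarith

/-- Comparison of the Gaussian chord potentials of `K` and of a body containing the image of `K`
under the homothety `z ↦ α • z + σ • x`. -/
lemma mul_Vtilde_le_of_smul_add_mem (hn : n ≠ 0) (hq : 1 < q) {K K' : Set (Eucl n)}
    (hK : IsCompact K) (hK' : IsCompact K') {R : ℝ} (hRK : ∀ z ∈ K, ‖z‖ ≤ R)
    (hRK' : ∀ z ∈ K', ‖z‖ ≤ R) {α σ δ : ℝ} (hα : 0 < α) (hδ : 0 ≤ δ) {x y : Eucl n}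
    (hsub : ∀ z ∈ K, α • z + σ • x ∈ K') (hle : ∀ z ∈ K, ‖α • z + σ • x‖ ≤ ‖z‖ + δ)
    (hy : y ∈ K) :
    α ^ (q - 1) * Real.exp (-(2 * R * δ)) * Vtilde q K y ≤ Vtilde q K' (α • y + σ • x) := by
  have hgauss : ∀ z ∈ K, Real.exp (-(R * δ)) * Real.exp (-‖z‖ ^ 2 / 2) ≤
      Real.exp (-‖α • z + σ • x‖ ^ 2 / 2) := fun z hz =>
    exp_mul_gaussian_le (norm_nonneg _) (hRK z hz) (hRK' _ (hsub z hz)) (norm_nonneg _) hδ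
      (hle z hz)
  set κ : ℝ := (n : ℝ) - q + 1 with hκ
  have hker : ∀ w : Eucl n, α ^ (-κ) * Real.exp (-(R * δ)) * chordKernel q K y w ≤
      chordKernel q K' (α • y + σ • x) (α • w) := by
    intro w
    by_cases hw : w + y ∈ K
    · have h1 : α • w + (α • y + σ • x) = α • (w + y) + σ • x := by module
      have h2 : (‖α • w‖ ^ κ)⁻¹ = α ^ (-κ) * (‖w‖ ^ κ)⁻¹ := by
        rw [norm_smul, Real.norm_of_nonneg hα.le, Real.mul_rpow hα.le (norm_nonneg _), mul_inv,
          Real.rpow_neg hα.le]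
      rw [chordKernel, chordKernel, ← hκ, h1, Set.indicator_of_mem hw,
        Set.indicator_of_mem (hsub _ hw), h2]
      calc _ = (Real.exp (-(R * δ)) * Real.exp (-‖w + y‖ ^ 2 / 2)) *
            (α ^ (-κ) * (‖w‖ ^ κ)⁻¹) := by ring
        _ ≤ _ := by gcongr; exact hgauss _ hw
    · rw [chordKernel, Set.indicator_of_notMem hw, zero_mul, mul_zero]
      exact chordKernel_nonneg _ _ _
  have hint : α ^ (q - 1) * Real.exp (-(R * δ)) * ∫ w, chordKernel q K y w ≤
      ∫ z, chordKernel q K' (α • y + σ • x) z := by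
    have h1 := Measure.integral_comp_smul (volume : Measure (Eucl n))
      (chordKernel q K' (α • y + σ • x)) α
    rw [finrank_euclideanSpace_fin, abs_of_pos (by positivity), smul_eq_mul] at h1
    have h2 := integral_mono ((integrable_chordKernel hn hq hK y).const_mul
      (α ^ (-κ) * Real.exp (-(R * δ))))
      ((integrable_chordKernel hn hq hK' (α • y + σ • x)).comp_smul hα.ne') hker
    rw [integral_const_mul, h1, le_inv_mul_iff₀ (by positivity)] at h2
    have h3 : α ^ (q - 1) = α ^ n * α ^ (-κ) := by
      rw [← Real.rpow_natCast, ← Real.rpow_add hα, hκ]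
      congr 1
      ring
    rw [h3]
    linarith
  rw [Vtilde_eq_integral_chordKernel hK.measurableSet,
    Vtilde_eq_integral_chordKernel hK'.measurableSet]
  have h4 : Real.exp (-(2 * R * δ)) = Real.exp (-(R * δ)) * Real.exp (-(R * δ)) := by
    rw [← Real.exp_add]; congr 1; ring
  have h5 : 0 ≤ ∫ w, chordKernel q K y w := integral_nonneg (chordKernel_nonneg K y)
  calc _ = 2 * (Real.exp (-(R * δ)) * Real.exp (-‖y‖ ^ 2 / 2)) *
        (α ^ (q - 1) * Real.exp (-(R * δ)) * ∫ w, chordKernel q K y w) := by rw [h4]; ring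
    _ ≤ _ := by gcongr; exact hgauss _ hy

end ChordComparison

/-! ### A maximum principle for decreasing families -/

lemma HasDerivWithinAt.nonneg_of_forall_le {F : ℝ → ℝ} {F' a s : ℝ}
    (hF : HasDerivWithinAt F F' (Set.Icc a s) s) (has : a < s)
    (hle : ∀ u ∈ Set.Icc a s, F u ≤ F s) : 0 ≤ F' := by
  rw [hasDerivWithinAt_iff_tendsto_slope, Set.Icc_sdiff_right, nhdsWithin_Ico_eq_nhdsLT has] at hF
  refine ge_of_tendsto hF ?_
  filter_upwards [Ico_mem_nhdsLT has] with u hu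
  rw [slope_def_field]
  exact div_nonneg_of_nonpos (by linarith [hle u ⟨hu.1, hu.2.le⟩]) (by linarith [hu.2])

set_option maxHeartbeats 1000000 in
/-- Let `g` decrease in time with speed `θ G`. Suppose that whenever `g s'` touches the lower
barrier `(1 - η) g s + η r` at `x`, the speed `G s' x` is controlled by `G s x`, and that
even a definite gain holds if `G s x` is large. Then `g` is Lipschitz in time. -/
lemma exists_sub_le_mul_of_touching {S : Type*} [TopologicalSpace S] [CompactSpace S]
    {b : ℝ} {g G : ℝ → S → ℝ} {θ τ : ℝ → ℝ} {θ₀ r gm G₀ Gm C Λ : ℝ}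
    (hg : ContinuousOn (fun a : ℝ × S => g a.1 a.2) (Set.Icc 0 b ×ˢ Set.univ))
    (hτ : ∀ s, HasDerivAt τ (θ s) s) (hτ0 : τ 0 = 0) (hθ₀ : 0 < θ₀) (hθ : ∀ s, θ₀ ≤ θ s)
    (hder : ∀ s ∈ Set.Icc 0 b, ∀ x,
      HasDerivWithinAt (fun s => g s x) (-(θ s * G s x)) (Set.Icc 0 b) s)
    (hr : 0 < r) (hgr : ∀ s ∈ Set.Icc 0 b, ∀ x, 2 * r ≤ g s x)
    (hgm : ∀ s ∈ Set.Icc 0 b, ∀ x, g s x ≤ gm)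
    (hG : ∀ s ∈ Set.Icc 0 b, ∀ x, 0 < G s x) (hG₀ : ∀ x, G 0 x ≤ G₀)
    (hC : 0 ≤ C) (hΛ : C + 1 < Λ * (r / gm))
    (htouch : ∀ s ∈ Set.Icc 0 b, ∀ s' ∈ Set.Icc 0 b, ∀ (x : S) (η : ℝ), 0 < η →
      η ≤ 1 - r / gm → s < s' → θ₀ * (s' - s) ≤ η →
      (∀ y, (1 - η) * g s y + η * r ≤ g s' y) → g s' x = (1 - η) * g s x + η * r →
      G s' x ≤ (1 + C * η) * G s x ∧
        (G s x ≤ Gm ∨ (1 + Λ * η) * G s' x ≤ (1 + C * η) * G s x)) :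
    ∃ A, 0 ≤ A ∧ ∀ s ∈ Set.Icc 0 b, ∀ s' ∈ Set.Icc 0 b, s ≤ s' → ∀ x,
      g s x - g s' x ≤ A * (τ s' - τ s) := by
  have hτc : Continuous τ := continuous_iff_continuousAt.2 fun s => (hτ s).continuousAt
  have hτsub : ∀ {s s' : ℝ}, s ≤ s' → θ₀ * (s' - s) ≤ τ s' - τ s := fun {s s'} h =>
    mul_sub_le_image_sub_of_le_deriv (fun s => (hτ s).differentiableAt)
      (fun s => by rw [(hτ s).deriv]; exact hθ s) h
  have hτmono : ∀ {s s' : ℝ}, s ≤ s' → τ s ≤ τ s' := fun {s s'} h => by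
    nlinarith [hτsub h, mul_nonneg hθ₀.le (sub_nonneg.2 h)]
  set B : ℝ := max 0 ((C + 1) * Gm / r + 1) with hB
  have hB0 : 0 ≤ B := le_max_left _ _
  have hBr : (C + 1) * Gm < B * r := by
    have : (C + 1) * Gm / r < B := lt_of_lt_of_le (lt_add_one _) (le_max_right _ _)
    rwa [div_lt_iff₀ hr] at this
  set A₁ : ℝ := max 1 ((1 + C) * G₀ / r) with hA₁
  have hA₁1 : 1 ≤ A₁ := le_max_left _ _
  have hA₁G : (1 + C) * G₀ ≤ A₁ * r := by
    have : (1 + C) * G₀ / r ≤ A₁ := le_max_right _ _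
    rwa [div_le_iff₀ hr] at this
  have key : ∀ κ > 0, ∀ s ∈ Set.Icc 0 b, ∀ s' ∈ Set.Icc 0 b, s ≤ s' → ∀ x,
      g s x - g s' x ≤ A₁ * ((g s x - r) * (τ s' - τ s + κ) * Real.exp (B * τ s)) := by
    intro κ hκ s₁ hs₁ s₁' hs₁' hss₁ x₁
    by_contra! hcon
    set W : ℝ × ℝ × S → ℝ := fun a =>
      (g a.1 a.2.2 - r) * (τ a.2.1 - τ a.1 + κ) * Real.exp (B * τ a.1) with hW
    set Z : Set (ℝ × ℝ × S) :=
      (Set.Icc 0 b ×ˢ Set.Icc 0 b ×ˢ Set.univ) ∩ {a | a.1 ≤ a.2.1} with hZ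
    have hZc : IsCompact Z :=
      (isCompact_Icc.prod (isCompact_Icc.prod isCompact_univ)).inter_right
        (isClosed_le continuous_fst (continuous_fst.comp continuous_snd))
    have hWpos : ∀ a ∈ Z, 0 < W a := by
      rintro ⟨s, s', x⟩ ⟨⟨hs, -, -⟩, hss⟩
      have h1 := hgr s hs x
      have h2 : τ s ≤ τ s' := hτmono hss
      exact mul_pos (mul_pos (by simp only; linarith) (by simp only; linarith)) (Real.exp_pos _)
    have hg1 : ContinuousOn (fun a : ℝ × ℝ × S => g a.1 a.2.2) Z :=
      hg.comp (f := fun a : ℝ × ℝ × S => (a.1, a.2.2)) (by fun_prop) fun a ha =>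
        ⟨ha.1.1, Set.mem_univ _⟩
    have hg2 : ContinuousOn (fun a : ℝ × ℝ × S => g a.2.1 a.2.2) Z :=
      hg.comp (f := fun a : ℝ × ℝ × S => (a.2.1, a.2.2)) (by fun_prop) fun a ha =>
        ⟨ha.1.2.1, Set.mem_univ _⟩
    have hWc : ContinuousOn W Z :=
      ((hg1.sub continuousOn_const).mul (by fun_prop)).mul (by fun_prop)
    obtain ⟨⟨s, s', x⟩, hmem, hmax⟩ := hZc.exists_isMaxOn
      ⟨(s₁, s₁', x₁), ⟨hs₁, hs₁', Set.mem_univ _⟩, hss₁⟩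
      ((hg1.sub hg2).div hWc fun a ha => (hWpos a ha).ne')
    set A : ℝ := (g s x - g s' x) / W (s, s', x) with hA
    have hle : ∀ u ∈ Set.Icc 0 b, ∀ u' ∈ Set.Icc 0 b, u ≤ u' → ∀ y,
        g u y - g u' y ≤ A * W (u, u', y) := fun u hu u' hu' huu y => by
      have h1 : (u, u', y) ∈ Z := ⟨⟨hu, hu', Set.mem_univ _⟩, huu⟩
      rw [← div_le_iff₀ (hWpos _ h1)]
      exact hmax h1
    have heq : g s x - g s' x = A * W (s, s', x) := by
      rw [hA, div_mul_cancel₀ _ (hWpos _ hmem).ne']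
    have hAA : A₁ < A := by
      have h1 : (s₁, s₁', x₁) ∈ Z := ⟨⟨hs₁, hs₁', Set.mem_univ _⟩, hss₁⟩
      have h2 := hle s₁ hs₁ s₁' hs₁' hss₁ x₁
      exact lt_of_mul_lt_mul_right (hcon.trans_le h2) (hWpos _ h1).le
    obtain ⟨⟨hs, hs', -⟩, hss⟩ := hmem
    simp only at hs hs' hss
    have hA0 : 0 < A := by linarith
    have hQ : r ≤ g s x - r := by linarith [hgr s hs x]
    set Q := g s x - r with hQdef
    set P := τ s' - τ s + κ with hPdef
    set E := Real.exp (B * τ s) with hEdef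
    have hE1 : 1 ≤ E := Real.one_le_exp (mul_nonneg hB0 (hτ0 ▸ hτmono hs.1))
    have hP0 : 0 < P := by linarith [hτmono hss]
    have hQ0 : 0 < Q := by linarith
    set η := A * P * E with hη
    have hη0 : 0 < η := by positivity
    have heq' : g s x - g s' x = η * Q := by rw [heq, hη, hW]; ring
    have hlt : s < s' := by
      refine lt_of_le_of_ne hss fun h => ?_
      have : 0 < η * Q := by positivity
      rw [← heq', h] at this
      linarith
    have hgmpos : 0 < gm := by linarith [hgr s hs x, hgm s hs x]
    have hη1 : η ≤ 1 - r / gm := by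
      have h1 : η * Q ≤ Q - r := by linarith [hgr s' hs' x]
      have h2 : r / gm ≤ r / Q := div_le_div_of_nonneg_left hr.le hQ0 (by linarith [hgm s hs x])
      have h3 : η ≤ 1 - r / Q := by
        rw [show 1 - r / Q = (Q - r) / Q by field_simp, le_div_iff₀ hQ0]
        exact h1
      linarith
    have hτη : θ₀ * (s' - s) ≤ η := by
      have h1 : 1 ≤ A * E := one_le_mul_of_one_le_of_one_le (by linarith) hE1
      calc θ₀ * (s' - s) ≤ P := by linarith [hτsub hss]
        _ ≤ P * (A * E) := le_mul_of_one_le_right hP0.le h1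
        _ = η := by rw [hη]; ring
    obtain ⟨ht1, ht2⟩ := htouch s hs s' hs' x η hη0 hη1 hlt hτη
      (fun y => by
        have h1 := hle s hs s' hs' hss y
        have h2 : A * W (s, s', y) = η * (g s y - r) := by simp only [hη, hW]; ring
        linarith)
      (by linarith)
    have hGs := hG s hs x
    have hGs' := hG s' hs' x
    have hθs := hθ₀.trans_le (hθ s)
    have hθs' := hθ₀.trans_le (hθ s')
    have hd1 : A * Q * E ≤ G s' x := by
      have h1 : HasDerivWithinAt (fun u => g s x - g u x - A * (Q * (τ u - τ s + κ) * E))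
          (-(-(θ s' * G s' x)) - A * (Q * θ s' * E)) (Set.Icc s s') s' := by
        have h2 := ((hder s' hs' x).mono (Set.Icc_subset_Icc_left hs.1 |>.trans
          (Set.Icc_subset_Icc_right hs'.2))).const_sub (g s x)
        exact h2.sub ((((((hτ s').hasDerivWithinAt.sub_const (τ s)).add_const κ).const_mul
          Q).mul_const E).const_mul A)
      have h3 := h1.nonneg_of_forall_le hlt fun u hu => by
        have h4 := hle s hs u ⟨hs.1.trans hu.1, hu.2.trans hs'.2⟩ hu.1 x
        simp only [hW] at h4 heq
        linarith
      have h5 : 0 ≤ θ s' * (G s' x - A * Q * E) := by linarith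
      linarith [nonneg_of_mul_nonneg_right h5 hθs']
    rcases hs.1.eq_or_lt with h0 | h0
    · have h1 : r ≤ Q * E := hQ.trans (le_mul_of_one_le_right hQ0.le hE1)
      have h2 : A * r ≤ G s' x := by
        refine le_trans ?_ hd1
        rw [mul_assoc]
        exact mul_le_mul_of_nonneg_left h1 hA0.le
      have hη1' : η ≤ 1 := hη1.trans (by linarith [div_pos hr hgmpos])
      have h3 : (1 + C * η) * G s x ≤ (1 + C) * G₀ := by
        have : G s x ≤ G₀ := h0 ▸ hG₀ x
        have : C * η ≤ C := mul_le_of_le_one_right hC hη1'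
        gcongr
      have h4 : A₁ * r < A * r := mul_lt_mul_of_pos_right hAA hr
      linarith
    · have hd2 : (1 - η) * G s x + B * η * Q ≤ A * Q * E := by
        have h1 : HasDerivWithinAt
            (fun u => g u x - g s' x - A * ((g u x - r) * (τ s' - τ u + κ) * Real.exp (B * τ u)))
            (-(θ s * G s x) - A * ((-(θ s * G s x) * P + Q * -θ s) * E +
              Q * P * (E * (B * θ s)))) (Set.Icc 0 s) s := by
          have h2 := (hder s hs x).mono (Set.Icc_subset_Icc_right hs.2)
          have h3 := (((hτ s).hasDerivWithinAt (s := Set.Icc 0 s)).const_sub (τ s')).add_const κ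
          exact (h2.sub_const (g s' x)).sub ((((h2.sub_const r).mul h3).mul
            ((hτ s).hasDerivWithinAt.const_mul B).exp).const_mul A)
        have h3 := h1.nonneg_of_forall_le h0 fun u hu => by
          have h4 := hle u ⟨hu.1, hu.2.trans hs.2⟩ s' hs' (hu.2.trans hss) x
          simp only [hW] at h4 heq
          linarith
        have h5 : 0 ≤ θ s * (A * Q * E - ((1 - η) * G s x + B * η * Q)) := by
          have : θ s * (A * Q * E - ((1 - η) * G s x + B * η * Q)) =
            (-(θ s * G s x) - A * ((-(θ s * G s x) * P + Q * -θ s) * E +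
              Q * P * (E * (B * θ s)))) := by rw [hη]; ring
          rw [this]; exact h3
        linarith [nonneg_of_mul_nonneg_right h5 hθs]
      have hBQ : B * η * r ≤ B * η * Q := by gcongr
      rcases ht2 with ht2 | ht2
      · have h1 : η * (B * r) ≤ η * ((C + 1) * G s x) := by nlinarith
        have h2 := le_of_mul_le_mul_left h1 hη0
        have h3 : (C + 1) * G s x ≤ (C + 1) * Gm := by gcongr
        linarith
      · have hc0 : 0 < r / gm := div_pos hr hgmpos
        have hΛ0 : 0 < Λ := by
          by_contra! h
          nlinarith [mul_nonpos_of_nonpos_of_nonneg h hc0.le]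
        have h1 : (1 + Λ * η) * ((1 - η) * G s x) ≤ (1 + C * η) * G s x := by
          refine le_trans ?_ ht2
          gcongr
          have : 0 ≤ B * η * r := by positivity
          linarith
        have h2 : (1 + Λ * η) * (1 - η) ≤ 1 + C * η :=
          le_of_mul_le_mul_right (by linarith) hGs
        have h3 : η * (Λ * (1 - η)) ≤ η * (C + 1) := by linarith
        have h4 := le_of_mul_le_mul_left h3 hη0
        have h5 : Λ * (r / gm) ≤ Λ * (1 - η) := by gcongr; linarith
        linarith
  refine ⟨A₁ * (|gm| * Real.exp (B * τ b)), by positivity, fun s hs s' hs' hss x => ?_⟩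
  have h1 : g s x - g s' x ≤ A₁ * ((g s x - r) * (τ s' - τ s + 0) * Real.exp (B * τ s)) := by
    have h2 : Tendsto (fun κ : ℝ => A₁ * ((g s x - r) * (τ s' - τ s + κ) * Real.exp (B * τ s)))
        (𝓝[>] 0) (𝓝 (A₁ * ((g s x - r) * (τ s' - τ s + 0) * Real.exp (B * τ s)))) :=
      Continuous.tendsto' (by fun_prop) _ _ rfl |>.mono_left nhdsWithin_le_nhds
    refine ge_of_tendsto h2 ?_
    filter_upwards [self_mem_nhdsWithin] with κ hκ using key κ hκ s hs s' hs' hss x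
  refine h1.trans ?_
  rw [add_zero]
  have h2 := hτmono hss
  have h3 := hτmono hs.2
  have h4 : g s x - r ≤ |gm| := by linarith [hgm s hs x, le_abs_self gm]
  have h5 : 0 ≤ g s x - r := by linarith [hgr s hs x]
  calc A₁ * ((g s x - r) * (τ s' - τ s) * Real.exp (B * τ s))
      ≤ A₁ * (|gm| * (τ s' - τ s) * Real.exp (B * τ b)) := by gcongr
    _ = A₁ * (|gm| * Real.exp (B * τ b)) * (τ s' - τ s) := by ring

/-! ### The speed of the flow at touching points -/

/-- The speed `h^p 𝒦 f / Ṽ_{γ,q}(K, ∇h + h x)` of the flow, without the normalizing factor. -/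
def flowSpeed {n : ℕ} (q p : ℝ) (f : Eucl n → ℝ) (K : Set (Eucl n)) (x : Eucl n) : ℝ :=
  suppFun K x ^ p * f x / (curvDet (suppFun K) x * Vtilde q K (gradient (suppFun K) x))

section

variable {n : ℕ} {q p : ℝ} {f : Eucl n → ℝ} {Ω Ω' : Set (Eucl n)}

lemma flowRHS_eq (K : Set (Eucl n)) (x : Eucl n) :
    flowRHS q p f K x = -(theta q p f K * flowSpeed q p f K x) + suppFun K x := by
  simp only [flowRHS, flowSpeed, div_eq_mul_inv, mul_inv]
  ring

lemma IsSmoothBody.Vtilde_gradient_pos (hn : n ≠ 0) (hq : 1 < q) (h : IsSmoothBody Ω)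
    (x : Eucl n) : 0 < Vtilde q Ω (gradient (suppFun Ω) x) :=
  Vtilde_pos hn hq h.isCompact h.zero_mem_interior _

lemma IsSmoothBody.flowSpeed_pos (hn : n ≠ 0) (hq : 1 < q) (h : IsSmoothBody Ω) {x : Eucl n}
    (hx : x ∈ Metric.sphere (0 : Eucl n) 1) (hfx : 0 < f x) : 0 < flowSpeed q p f Ω x :=
  div_pos (mul_pos (Real.rpow_pos_of_pos (h.suppFun_pos (ne_zero_of_mem_sphere_one hx)) _) hfx)
    (mul_pos (h.curvDet_pos hx) (h.Vtilde_gradient_pos hn hq x))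

/-- If `e^t (1 - η) h_Ω + σ ≤ h_Ω'` with equality at `x`, the speed of `Ω'` at `x` is bounded in
terms of the speed of `Ω`, with a gain if the curvature determinant of `Ω` is small. -/
lemma IsSmoothBody.flowSpeed_le_of_touching (hn : n ≠ 0) (hq : 1 < q) (hp : 0 < p)
    (h : IsSmoothBody Ω) (h' : IsSmoothBody Ω') {R : ℝ} (hR : ∀ z ∈ Ω, ‖z‖ ≤ R)
    (hR' : ∀ z ∈ Ω', ‖z‖ ≤ R) {t η a σ m : ℝ} (ht : 0 ≤ t) (hη : 0 ≤ η)
    (ha : Real.exp (-a) ≤ 1 - η) (hσ : 0 ≤ σ)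
    (hle : ∀ y ∈ Metric.sphere (0 : Eucl n) 1,
      Real.exp t * (1 - η) * suppFun Ω y + σ ≤ suppFun Ω' y)
    {x : Eucl n} (hx : x ∈ Metric.sphere (0 : Eucl n) 1)
    (heq : suppFun Ω' x = Real.exp t * (1 - η) * suppFun Ω x + σ)
    (hle' : suppFun Ω' x ≤ Real.exp t * suppFun Ω x)
    (hfx : 0 < f x) (hm : 0 < m) (hm1 : m < 1) :
    flowSpeed q p f Ω' x ≤ Real.exp (p * t + 2 * R * ((Real.exp t - 1) * R + σ) +
        (n + (q - 1)) * a) * flowSpeed q p f Ω x ∧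
    (m ^ n ≤ curvDet (suppFun Ω) x ∨
      (1 + σ / m) * flowSpeed q p f Ω' x ≤
        Real.exp (p * t + 2 * R * ((Real.exp t - 1) * R + σ) + (n + (q - 1)) * a) *
          flowSpeed q p f Ω x) := by
  have hx1 : ‖x‖ = 1 := by simpa using hx
  have hx0 := ne_zero_of_mem_sphere_one hx
  have hβ : 0 < 1 - η := (Real.exp_pos _).trans_le ha
  have ht1 : 1 ≤ Real.exp t := Real.one_le_exp ht
  set α := Real.exp t * (1 - η) with hα
  have hβα : 1 - η ≤ α := le_mul_of_one_le_left hβ.le ht1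
  have hα0 : 0 < α := hβ.trans_le hβα
  have hR0 : 0 ≤ R := (norm_nonneg _).trans (hR 0 h.zero_mem)
  set δ := (Real.exp t - 1) * R + σ with hδ
  have hδ0 : 0 ≤ δ := add_nonneg (mul_nonneg (sub_nonneg.2 ht1) hR0) hσ
  have hsub : ∀ z ∈ Ω, α • z + σ • x ∈ Ω' := fun z hz =>
    smul_add_smul_mem h.isCompact h' hle hα0.le hσ hx1 hz
  have hgrad := (h.gradient_eq_and_le_of_touching h' hle hx heq).1
  have hV : α ^ (q - 1) * Real.exp (-(2 * R * δ)) * Vtilde q Ω (gradient (suppFun Ω) x) ≤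
      Vtilde q Ω' (gradient (suppFun Ω') x) := by
    rw [hgrad]
    refine mul_Vtilde_le_of_smul_add_mem hn hq h.isCompact h'.isCompact hR hR' hα0 hδ0 hsub
      (fun z hz => ?_) (h.gradient_mem hx0)
    calc ‖α • z + σ • x‖ ≤ ‖α • z‖ + ‖σ • x‖ := norm_add_le _ _
      _ = α * ‖z‖ + σ := by
        rw [norm_smul, norm_smul, hx1, Real.norm_of_nonneg hα0.le, Real.norm_of_nonneg hσ, mul_one]
      _ ≤ Real.exp t * ‖z‖ + σ := by
        have : α ≤ Real.exp t := mul_le_of_le_one_right (Real.exp_pos _).le (by linarith)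
        gcongr
      _ = ‖z‖ + ((Real.exp t - 1) * ‖z‖ + σ) := by ring
      _ ≤ ‖z‖ + δ := by
        have := mul_le_mul_of_nonneg_left (hR z hz) (sub_nonneg.2 ht1)
        linarith
  have hαq : Real.exp (-((q - 1) * a)) ≤ α ^ (q - 1) := by
    calc Real.exp (-((q - 1) * a)) = Real.exp (-a) ^ (q - 1) := by
          rw [← Real.exp_mul]; ring_nf
      _ ≤ α ^ (q - 1) := Real.rpow_le_rpow (Real.exp_pos _).le (ha.trans hβα) (by linarith)
  have hβn : Real.exp (-(n * a)) ≤ (1 - η) ^ n := by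
    calc Real.exp (-(n * a)) = Real.exp (-a) ^ n := by
          rw [← Real.exp_nat_mul]; ring_nf
      _ ≤ (1 - η) ^ n := pow_le_pow_left₀ (Real.exp_pos _).le ha _
  have hV0 := h.Vtilde_gradient_pos hn hq x
  have hV0' := h'.Vtilde_gradient_pos hn hq x
  have hD0 := h.curvDet_pos hx
  have hD0' := h'.curvDet_pos hx
  have hH0 := h.suppFun_pos hx0
  have hH0' := h'.suppFun_pos hx0
  have hHp : suppFun Ω' x ^ p ≤ Real.exp (p * t) * suppFun Ω x ^ p := by
    calc suppFun Ω' x ^ p ≤ (Real.exp t * suppFun Ω x) ^ p :=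
          Real.rpow_le_rpow hH0'.le hle' hp.le
      _ = Real.exp (p * t) * suppFun Ω x ^ p := by
        rw [Real.mul_rpow (Real.exp_pos _).le hH0.le, ← Real.exp_mul, mul_comm t]
  have aux : ∀ w, 0 < w → (1 - η) ^ n * curvDet (suppFun Ω) x * w ≤ curvDet (suppFun Ω') x →
      w * flowSpeed q p f Ω' x ≤
        Real.exp (p * t + 2 * R * δ + (n + (q - 1)) * a) * flowSpeed q p f Ω x := by
    intro w hw hD
    rw [flowSpeed, flowSpeed]
    set D := curvDet (suppFun Ω) x
    set V := Vtilde q Ω (gradient (suppFun Ω) x)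
    have h1 : Real.exp (-(n * a)) * D * w *
        (Real.exp (-((q - 1) * a)) * Real.exp (-(2 * R * δ)) * V) ≤
        curvDet (suppFun Ω') x * Vtilde q Ω' (gradient (suppFun Ω') x) := by
      refine mul_le_mul (le_trans ?_ hD) (le_trans ?_ hV) (by positivity) hD0'.le <;> gcongr
    calc w * (suppFun Ω' x ^ p * f x /
          (curvDet (suppFun Ω') x * Vtilde q Ω' (gradient (suppFun Ω') x)))
        ≤ w * (Real.exp (p * t) * suppFun Ω x ^ p * f x / (Real.exp (-(n * a)) * D * w *
          (Real.exp (-((q - 1) * a)) * Real.exp (-(2 * R * δ)) * V))) := by gcongr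
      _ = _ := by
        rw [show p * t + 2 * R * δ + (n + (q - 1)) * a =
          p * t + 2 * R * δ + n * a + (q - 1) * a by ring, Real.exp_add, Real.exp_add,
          Real.exp_add, Real.exp_neg, Real.exp_neg, Real.exp_neg]
        field_simp
  obtain ⟨hc1, hc2⟩ := h.curvDet_of_touching h' hle hx heq hσ hβ (by linarith) hβα hm hm1
  refine ⟨by simpa using aux 1 one_pos (by simpa using hc1), hc2.imp_right fun hc => ?_⟩
  refine aux _ (by positivity) (le_trans ?_ hc)
  have : σ / m ≤ σ / ((1 - η) * m) :=
    div_le_div_of_nonneg_left hσ (mul_pos hβ hm) (mul_le_of_le_one_left hm.le (by linarith))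
  gcongr

end

/-! ### Lipschitz continuity of the flow in time -/

lemma exists_pos_forall_le_of_continuous {Y : Type*} [TopologicalSpace Y] [CompactSpace Y]
    {F : Y → ℝ} (hF : Continuous F) (h : ∀ y, 0 < F y) : ∃ c, 0 < c ∧ ∀ y, c ≤ F y := by
  rcases isEmpty_or_nonempty Y with hY | hY
  · exact ⟨1, one_pos, fun y => hY.elim y⟩
  · obtain ⟨y, -, hy⟩ := isCompact_univ.exists_isMinOn Set.univ_nonempty hF.continuousOn
    exact ⟨F y, h y, fun z => hy (Set.mem_univ z)⟩

lemma exists_pos_forall_ge_of_continuous {Y : Type*} [TopologicalSpace Y] [CompactSpace Y]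
    {F : Y → ℝ} (hF : Continuous F) : ∃ C, 0 < C ∧ ∀ y, F y ≤ C := by
  obtain ⟨C, hC⟩ := (isCompact_range hF).bddAbove
  exact ⟨max C 1, by positivity, fun y => (hC (Set.mem_range_self y)).trans (le_max_left _ _)⟩

lemma exp_neg_div_le_one_sub {c η : ℝ} (hc : 0 < c) (hη : 0 ≤ η) (h : η ≤ 1 - c) :
    Real.exp (-(η / c)) ≤ 1 - η := by
  have h1 : 0 < 1 - η := by linarith
  have h2 : (1 - η)⁻¹ ≤ Real.exp (η / c) := by
    calc (1 - η)⁻¹ = η / (1 - η) + 1 := by field_simp; ring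
      _ ≤ η / c + 1 := by gcongr; linarith
      _ ≤ Real.exp (η / c) := Real.add_one_le_exp _
  rw [Real.exp_neg]
  exact inv_le_of_inv_le₀ h1 h2

lemma exp_sub_one_le (x : ℝ) : Real.exp x - 1 ≤ x * Real.exp x := by
  have h1 := Real.add_one_le_exp (-x)
  have h2 : Real.exp x * Real.exp (-x) = 1 := by rw [← Real.exp_add]; simp
  nlinarith [Real.exp_pos x]

section

variable {n : ℕ} {q p T b : ℝ} {f : Eucl n → ℝ} {K : ℝ → Set (Eucl n)}

lemma IsSmoothBody.continuous_flowSpeed_sphere (hn : n ≠ 0) (hq : 1 < q) {Ω : Set (Eucl n)}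
    (h : IsSmoothBody Ω) (hfc : Continuous f) :
    Continuous fun u : Metric.sphere (0 : Eucl n) 1 => flowSpeed q p f Ω u := by
  have hH : Continuous fun u : Metric.sphere (0 : Eucl n) 1 => suppFun Ω u :=
    (continuous_suppFun h.isCompact h.nonempty).comp continuous_subtype_val
  have hV := (h.continuous_Vtilde hn hq).comp h.continuous_gradient_sphere
  exact ((hH.rpow_const fun u => Or.inl (h.suppFun_pos (ne_zero_of_mem_sphere_one u.2)).ne').mul
    (hfc.comp continuous_subtype_val)).div (h.continuous_curvDet_sphere.mul hV) fun u =>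
      (mul_pos (h.curvDet_pos u.2) (h.Vtilde_gradient_pos hn hq _)).ne'

lemma IsGaussChordFlow.continuous_suppFun_Icc (hflow : IsGaussChordFlow q p f (Set.Ico 0 T) K)
    (hsmooth : ∀ t ∈ Set.Ico (0 : ℝ) T, IsSmoothBody (K t)) (hbT : b < T) {R : ℝ}
    (hR : ∀ t ∈ Set.Ico 0 T, ∀ z ∈ K t, ‖z‖ ≤ R) :
    Continuous fun a : Set.Icc 0 b × Eucl n => suppFun (K a.1) a.2 := by
  have hsub : Set.Icc 0 b ⊆ Set.Ico 0 T := fun s hs => ⟨hs.1, hs.2.trans_lt hbT⟩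
  refine continuous_suppFun_family (K := fun s : Set.Icc 0 b => K s)
    (fun s => (hsmooth s (hsub s.2)).isCompact) (fun s => (hsmooth s (hsub s.2)).nonempty)
    (fun s => hR s (hsub s.2)) fun x hx => ?_
  have h1 : ContinuousOn (fun s => suppFun (K s) x) (Set.Icc 0 b) := fun s hs =>
    ((hflow s (hsub hs) x hx).continuousWithinAt).mono hsub
  exact h1.domRestrict

end

section

variable {n : ℕ} {q p T b : ℝ} {f : Eucl n → ℝ} {K : ℝ → Set (Eucl n)}

/-- The support functions of a solution of the flow are Lipschitz in time, after rescaling by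
`e^{-t}`, uniformly on compact time intervals. -/
lemma IsGaussChordFlow.exists_exp_mul_sub_le (hn : n ≠ 0) (hq : 1 < q) (hp : 0 < p)
    (hfc : Continuous f) (hf : ∀ x ∈ Metric.sphere (0 : Eucl n) 1, 0 < f x)
    (hsmooth : ∀ t ∈ Set.Ico (0 : ℝ) T, IsSmoothBody (K t))
    (hflow : IsGaussChordFlow q p f (Set.Ico 0 T) K) (hb : 0 ≤ b) (hbT : b < T) :
    ∃ C, 0 ≤ C ∧ ∀ s ∈ Set.Icc 0 b, ∀ s' ∈ Set.Icc 0 b, s ≤ s' →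
      ∀ x ∈ Metric.sphere (0 : Eucl n) 1,
        Real.exp (-s) * suppFun (K s) x - Real.exp (-s') * suppFun (K s') x ≤ C * (s' - s) := by
  have hsub : Set.Icc 0 b ⊆ Set.Ico 0 T := fun s hs => ⟨hs.1, hs.2.trans_lt hbT⟩
  have hK : ∀ s ∈ Set.Icc 0 b, IsSmoothBody (K s) := fun s hs => hsmooth s (hsub hs)
  obtain ⟨R, hR0, hR⟩ := hflow.exists_forall_norm_le (hb.trans_lt hbT) hsmooth hf
  have hcontH := hflow.continuous_suppFun_Icc hsmooth hbT hR
  have hHR : ∀ s ∈ Set.Icc 0 b, ∀ x ∈ Metric.sphere (0 : Eucl n) 1, suppFun (K s) x ≤ R :=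
    fun s hs x hx => suppFun_le (hK s hs).isCompact (hK s hs).nonempty fun z hz => by
      refine (real_inner_le_norm _ _).trans ?_
      rw [mem_sphere_zero_iff_norm.1 hx, one_mul]
      exact hR s (hsub hs) z hz
  have hHpos : ∀ s ∈ Set.Icc 0 b, ∀ x ∈ Metric.sphere (0 : Eucl n) 1, 0 < suppFun (K s) x :=
    fun s hs x hx => (hK s hs).suppFun_pos (ne_zero_of_mem_sphere_one hx)
  have hcontθ : Continuous fun s : Set.Icc 0 b => theta q p f (K s) :=
    continuous_theta_family hn hq hp hfc hf (K := fun s : Set.Icc 0 b => K s)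
      (fun s => hK s s.2) (fun s => hR s (hsub s.2)) hcontH
  obtain ⟨θ₀, hθ₀, hθ⟩ := exists_pos_forall_le_of_continuous hcontθ
    fun s => (hK s s.2).theta_pos hn hq hp hfc hf
  obtain ⟨θ₁, hθ₁, hθ'⟩ := exists_pos_forall_ge_of_continuous hcontθ
  obtain ⟨c, hc, hcH⟩ := exists_pos_forall_le_of_continuous
    (F := fun a : Set.Icc 0 b × Metric.sphere (0 : Eucl n) 1 =>
      Real.exp (-(a.1 : ℝ)) * suppFun (K a.1) a.2)
    (Continuous.mul (by fun_prop) (hcontH.comp (f := fun a : Set.Icc 0 b ×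
      Metric.sphere (0 : Eucl n) 1 => (a.1, (a.2 : Eucl n))) (by fun_prop)))
    fun a => mul_pos (Real.exp_pos _) (hHpos a.1 a.1.2 a.2 a.2.2)
  obtain ⟨Vm, hVm, hV⟩ := exists_pos_forall_le_of_continuous
    (F := fun a : Set.Icc 0 b × Metric.closedBall (0 : Eucl n) R => Vtilde q (K a.1) a.2)
    (by
      have h1 := continuous_Vtilde_family hn hq (K := fun s : Set.Icc 0 b => K s)
        (fun s => (hK s s.2).isCompact) (fun s => (hK s s.2).convex)
        (fun s => (hK s s.2).nonempty) (fun s => hR s (hsub s.2)) hcontH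
      have h2 := h1.comp (f := fun a : Set.Icc 0 b × Metric.closedBall (0 : Eucl n) R =>
        (a.1, (a.2 : Eucl n))) (by fun_prop)
      simpa only [Function.comp_def] using h2)
    fun a => Vtilde_pos hn hq (hK a.1 a.1.2).isCompact (hK a.1 a.1.2).zero_mem_interior _
  obtain ⟨fm, hfm0, hfm⟩ := exists_pos_forall_ge_of_continuous
    (F := fun u : Metric.sphere (0 : Eucl n) 1 => f u) (hfc.comp continuous_subtype_val)
  have h0 : (0 : ℝ) ∈ Set.Icc 0 b := ⟨le_rfl, hb⟩
  obtain ⟨G₀, -, hG₀⟩ := exists_pos_forall_ge_of_continuous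
    ((hK 0 h0).continuous_flowSpeed_sphere (p := p) hn hq hfc)
  set θe : ℝ → ℝ := Set.IccExtend hb fun s : Set.Icc 0 b => theta q p f (K s) with hθe
  have hθec : Continuous θe := hcontθ.Icc_extend'
  have hθeq : ∀ s ∈ Set.Icc 0 b, θe s = theta q p f (K s) := fun s hs =>
    Set.IccExtend_of_mem hb _ hs
  set r : ℝ := c / 2 with hr
  have hr0 : 0 < r := by positivity
  set ρ : ℝ := r / R with hρ
  have hρ0 : 0 < ρ := by positivity
  set C₂ : ℝ := p / θ₀ + 2 * R * (Real.exp b / θ₀ * R + Real.exp b * r) + (n + (q - 1)) / ρ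
    with hC₂
  have hq1 : 0 < q - 1 := by linarith
  have hC₂0 : 0 ≤ C₂ := by positivity
  set C : ℝ := C₂ * Real.exp C₂ with hC
  have hC0 : 0 ≤ C := by positivity
  set Λ : ℝ := (C + 2) / ρ with hΛ
  have hΛ0 : 0 < Λ := by positivity
  set m : ℝ := min (1 / 2) (r / Λ) with hm
  have hm0 : 0 < m := lt_min (by norm_num) (by positivity)
  have hm1 : m < 1 := (min_le_left _ _).trans_lt (by norm_num)
  have hmΛ : m * Λ ≤ r := by
    rw [← le_div_iff₀ hΛ0]
    exact min_le_right _ _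
  obtain ⟨A, hA0, hA⟩ := exists_sub_le_mul_of_touching (S := Metric.sphere (0 : Eucl n) 1)
    (b := b) (g := fun s x => Real.exp (-s) * suppFun (K s) x)
    (G := fun s x => Real.exp (-s) * flowSpeed q p f (K s) x) (θ := θe)
    (τ := fun s => ∫ u in (0 : ℝ)..s, θe u) (θ₀ := θ₀) (r := r) (gm := R) (G₀ := G₀)
    (Gm := R ^ p * fm / (m ^ n * Vm)) (C := C) (Λ := Λ)
    (by
      rw [continuousOn_iff_continuous_domRestrict]
      have h1 := hcontH.comp (f := fun a : (Set.Icc 0 b ×ˢ Set.univ :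
        Set (ℝ × Metric.sphere (0 : Eucl n) 1)) => ((⟨a.1.1, a.2.1⟩ : Set.Icc 0 b),
          (a.1.2 : Eucl n))) (by fun_prop)
      have h2 : Continuous fun a : (Set.Icc 0 b ×ˢ Set.univ :
        Set (ℝ × Metric.sphere (0 : Eucl n) 1)) => Real.exp (-a.1.1) := by fun_prop
      exact h2.mul h1)
    (fun s => (hθec.integral_hasStrictDerivAt 0 s).hasDerivAt)
    intervalIntegral.integral_same hθ₀ (fun s => hθ _)
    (fun s hs x => by
      have h1 := hasDerivWithinAt_exp_neg_mul ((hflow s (hsub hs) x x.2).mono hsub)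
      rw [flowRHS_eq, add_sub_cancel_right] at h1
      convert h1 using 1
      rw [hθeq s hs]
      ring)
    hr0 (fun s hs x => by
      have h1 := hcH (⟨s, hs⟩, x)
      simp only at h1
      linarith)
    (fun s hs x => (mul_le_of_le_one_left (hHpos s hs x x.2).le
      (Real.exp_le_one_iff.2 (by linarith [hs.1]))).trans (hHR s hs x x.2))
    (fun s hs x => mul_pos (Real.exp_pos _) ((hK s hs).flowSpeed_pos hn hq x.2 (hf x x.2)))
    (fun x => by simpa using hG₀ x) hC0
    (by rw [hΛ, ← hρ, div_mul_cancel₀ _ hρ0.ne']; linarith)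
    (by
      intro s hs s' hs' x η hη0 hη1 hss hτη hle heq
      have hxs := x.2
      set t : ℝ := s' - s with ht
      have ht0 : 0 ≤ t := by linarith
      have hexp : ∀ y : ℝ, Real.exp s' * (Real.exp (-s') * y) = y := fun y => by
        rw [← mul_assoc, ← Real.exp_add]; simp
      have hexp' : ∀ y : ℝ, Real.exp s' * ((1 - η) * (Real.exp (-s) * y) + η * r) =
          Real.exp t * (1 - η) * y + Real.exp s' * (η * r) := fun y => by
        rw [ht, sub_eq_add_neg s', Real.exp_add]; ring
      have hσ : 0 ≤ Real.exp s' * (η * r) := by positivity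
      have heq' : suppFun (K s') x =
          Real.exp t * (1 - η) * suppFun (K s) x + Real.exp s' * (η * r) := by
        rw [← hexp' (suppFun (K s) x), ← heq, hexp]
      have h2r : r ≤ Real.exp (-s) * suppFun (K s) x := by
        have h1 := hcH (⟨s, hs⟩, x)
        simp only at h1
        linarith
      obtain ⟨hF1, hF2⟩ := (hK s hs).flowSpeed_le_of_touching (q := q) (p := p) (f := f)
        (η := η) (a := η / ρ) (σ := Real.exp s' * (η * r)) (m := m) hn hq hp (hK s' hs')
        (hR s (hsub hs)) (hR s' (hsub hs')) ht0 hη0.le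
        (exp_neg_div_le_one_sub hρ0 hη0.le hη1) hσ
        (fun y hy => by
          have h1 := mul_le_mul_of_nonneg_left (hle ⟨y, hy⟩) (Real.exp_pos s').le
          rwa [hexp', hexp] at h1)
        hxs heq'
        (by
          have h1 : Real.exp s' * (η * r) ≤ Real.exp s' * (η * (Real.exp (-s) *
            suppFun (K s) x)) := by gcongr
          have h2 : Real.exp s' * (η * (Real.exp (-s) * suppFun (K s) x)) =
              Real.exp t * (η * suppFun (K s) x) := by
            rw [ht, sub_eq_add_neg, Real.exp_add]; ring
          rw [heq']
          linarith)
        (hf x hxs) hm0 hm1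
      have hη1' : η ≤ 1 := hη1.trans (by linarith)
      have htη : t ≤ η / θ₀ := by rw [le_div_iff₀ hθ₀]; linarith
      have hs'b : Real.exp s' ≤ Real.exp b := Real.exp_le_exp.2 hs'.2
      have htb : Real.exp t ≤ Real.exp b := Real.exp_le_exp.2 (by linarith [hs.1, hs'.2])
      have hexponent : p * t + 2 * R * ((Real.exp t - 1) * R + Real.exp s' * (η * r)) +
          (n + (q - 1)) * (η / ρ) ≤ C₂ * η := by
        have h1 : Real.exp t - 1 ≤ η / θ₀ * Real.exp b :=
          (exp_sub_one_le t).trans (by gcongr)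
        calc _ ≤ p * (η / θ₀) + 2 * R * (η / θ₀ * Real.exp b * R + Real.exp b * (η * r)) +
              (n + (q - 1)) * (η / ρ) := by gcongr
          _ = C₂ * η := by rw [hC₂]; ring
      have hfac : Real.exp (p * t + 2 * R * ((Real.exp t - 1) * R + Real.exp s' * (η * r)) +
          (n + (q - 1)) * (η / ρ)) ≤ 1 + C * η := by
        have h1 := exp_sub_one_le (C₂ * η)
        have h2 : C₂ * η * Real.exp (C₂ * η) ≤ C₂ * η * Real.exp C₂ := by
          gcongr
          exact mul_le_of_le_one_right hC₂0 hη1'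
        calc _ ≤ Real.exp (C₂ * η) := Real.exp_le_exp.2 hexponent
          _ ≤ 1 + C * η := by rw [hC]; linarith
      have hF0 := (hK s hs).flowSpeed_pos (p := p) hn hq hxs (hf x hxs)
      have hmulexp : ∀ w y : ℝ, 0 ≤ y → y ≤ w * flowSpeed q p f (K s) x →
          w ≤ 1 + C * η → Real.exp (-s') * y ≤
            (1 + C * η) * (Real.exp (-s) * flowSpeed q p f (K s) x) := by
        intro w y hy hyw hw
        have h1 : Real.exp (-s') ≤ Real.exp (-s) := Real.exp_le_exp.2 (by linarith)
        calc Real.exp (-s') * y ≤ Real.exp (-s) * (w * flowSpeed q p f (K s) x) := by gcongr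
          _ ≤ Real.exp (-s) * ((1 + C * η) * flowSpeed q p f (K s) x) := by gcongr
          _ = _ := by ring
      have hF0' := (hK s' hs').flowSpeed_pos (p := p) hn hq hxs (hf x hxs)
      refine ⟨hmulexp _ _ hF0'.le hF1 hfac, hF2.imp (fun hD => ?_) fun hF => ?_⟩
      · refine (mul_le_of_le_one_left hF0.le (Real.exp_le_one_iff.2 (by linarith [hs.1]))).trans ?_
        have h1 : suppFun (K s) x ^ p ≤ R ^ p :=
          Real.rpow_le_rpow (hHpos s hs x hxs).le (hHR s hs x hxs) hp.le
        have h2 : Vm ≤ Vtilde q (K s) (gradient (suppFun (K s)) x) :=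
          hV (⟨s, hs⟩, ⟨_, mem_closedBall_zero_iff.2 (hR s (hsub hs) _
            ((hK s hs).gradient_mem (ne_zero_of_mem_sphere_one hxs)))⟩)
        have h3 := (hf x hxs).le
        have h4 : f x ≤ fm := hfm x
        have h5 := ((hK s hs).curvDet_pos hxs).le
        rw [flowSpeed]
        gcongr
      · have h1 : Λ * η ≤ Real.exp s' * (η * r) / m := by
          rw [le_div_iff₀ hm0]
          have h2 : 1 ≤ Real.exp s' := Real.one_le_exp hs'.1
          calc Λ * η * m = η * (m * Λ) := by ring
            _ ≤ η * r := by gcongr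
            _ ≤ Real.exp s' * (η * r) := le_mul_of_one_le_left (by positivity) h2
        have h2 : (1 + Λ * η) * flowSpeed q p f (K s') x ≤
            (1 + Real.exp s' * (η * r) / m) * flowSpeed q p f (K s') x := by gcongr
        have h3 := hmulexp _ _ (by positivity) (h2.trans hF) hfac
        linarith)
  refine ⟨A * θ₁, by positivity, fun s hs s' hs' hss x hx => ?_⟩
  refine (hA s hs s' hs' hss ⟨x, hx⟩).trans ?_
  rw [mul_assoc]
  refine mul_le_mul_of_nonneg_left ?_ hA0
  have hint : ∀ a b : ℝ, IntervalIntegrable θe volume a b := fun a b => hθec.intervalIntegrable a b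
  rw [intervalIntegral.integral_interval_sub_left (hint _ _) (hint _ _)]
  calc ∫ u in s..s', θe u ≤ ∫ _ in s..s', θ₁ :=
        intervalIntegral.integral_mono_on hss (hint _ _) intervalIntegrable_const fun u _ => hθ' _
    _ = θ₁ * (s' - s) := by rw [intervalIntegral.integral_const, smul_eq_mul]; ring

end

/-! ### Differentiation of the functional -/

lemma hasDerivWithinAt_integral_of_abs_sub_le {Y : Type*} [MeasurableSpace Y] {μ : Measure Y}
    [IsFiniteMeasure μ] {φ : ℝ → Y → ℝ} {φ' : Y → ℝ} {D : Set ℝ} {t C : ℝ} (ht : t ∈ D)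
    (hint : ∀ s ∈ D, Integrable (φ s) μ)
    (hlip : ∀ s ∈ D, ∀ y, |φ s y - φ t y| ≤ C * |s - t|)
    (hder : ∀ y, HasDerivWithinAt (fun s => φ s y) (φ' y) D t) :
    HasDerivWithinAt (fun s => ∫ y, φ s y ∂μ) (∫ y, φ' y ∂μ) D t := by
  rw [hasDerivWithinAt_iff_tendsto_slope]
  have h1 : Tendsto (fun s => ∫ y, slope (fun s => φ s y) t s ∂μ) (𝓝[D \ {t}] t)
      (𝓝 (∫ y, φ' y ∂μ)) := by
    refine tendsto_integral_filter_of_dominated_convergence (fun _ => C) ?_ ?_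
      (integrable_const C) (Eventually.of_forall fun y =>
        hasDerivWithinAt_iff_tendsto_slope.1 (hder y))
    · filter_upwards [self_mem_nhdsWithin] with s hs
      simp only [slope_def_field]
      exact (((hint s hs.1).sub (hint t ht)).div_const _).aestronglyMeasurable
    · filter_upwards [self_mem_nhdsWithin] with s hs
      refine Eventually.of_forall fun y => ?_
      have h2 : 0 < |s - t| := abs_pos.2 (sub_ne_zero.2 hs.2)
      rw [slope_def_field, Real.norm_eq_abs, abs_div, div_le_iff₀ h2]
      exact hlip s hs.1 y
  refine h1.congr' ?_
  filter_upwards [self_mem_nhdsWithin] with s hs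
  simp only [slope_def_field]
  rw [integral_div, integral_sub (hint s hs.1) (hint t ht)]

lemma exists_abs_rpow_sub_le {c M : ℝ} (hc : 0 < c) (p : ℝ) :
    ∃ L, 0 ≤ L ∧ ∀ x ∈ Set.Icc c M, ∀ y ∈ Set.Icc c M, |x ^ p - y ^ p| ≤ L * |x - y| := by
  have h1 : ContinuousOn (fun x : ℝ => p * x ^ (p - 1)) (Set.Icc c M) := fun x hx =>
    (continuousAt_const.mul (Real.continuousAt_rpow_const x _
      (Or.inl (hc.trans_le hx.1).ne'))).continuousWithinAt
  obtain ⟨L, hL⟩ := isCompact_Icc.exists_bound_of_continuousOn h1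
  refine ⟨max L 0, le_max_right _ _, fun x hx y hy => ?_⟩
  exact Convex.norm_image_sub_le_of_norm_hasDerivWithin_le (f := fun x : ℝ => x ^ p)
    (fun z hz => (Real.hasDerivAt_rpow_const (Or.inl (hc.trans_le hz.1).ne')).hasDerivWithinAt)
    (fun z hz => (hL z hz).trans (le_max_left _ _)) (convex_Icc c M) hy hx

section

variable {n : ℕ} {q p T b : ℝ} {f : Eucl n → ℝ} {K : ℝ → Set (Eucl n)}

lemma IsGaussChordFlow.exists_abs_suppFun_sub_le (hn : n ≠ 0) (hq : 1 < q) (hp : 0 < p)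
    (hfc : Continuous f) (hf : ∀ x ∈ Metric.sphere (0 : Eucl n) 1, 0 < f x)
    (hsmooth : ∀ t ∈ Set.Ico (0 : ℝ) T, IsSmoothBody (K t))
    (hflow : IsGaussChordFlow q p f (Set.Ico 0 T) K) (hb : 0 ≤ b) (hbT : b < T) :
    ∃ C, 0 ≤ C ∧ ∀ s ∈ Set.Icc 0 b, ∀ s' ∈ Set.Icc 0 b, ∀ x ∈ Metric.sphere (0 : Eucl n) 1,
      |suppFun (K s) x - suppFun (K s') x| ≤ C * |s - s'| := by
  have hsub : Set.Icc 0 b ⊆ Set.Ico 0 T := fun s hs => ⟨hs.1, hs.2.trans_lt hbT⟩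
  have hK : ∀ s ∈ Set.Icc 0 b, IsSmoothBody (K s) := fun s hs => hsmooth s (hsub hs)
  obtain ⟨R, hR0, hR⟩ := hflow.exists_forall_norm_le (hb.trans_lt hbT) hsmooth hf
  obtain ⟨C, hC0, hC⟩ := hflow.exists_exp_mul_sub_le hn hq hp hfc hf hsmooth hb hbT
  have key : ∀ s ∈ Set.Icc 0 b, ∀ s' ∈ Set.Icc 0 b, s ≤ s' →
      ∀ x ∈ Metric.sphere (0 : Eucl n) 1,
        |suppFun (K s) x - suppFun (K s') x| ≤ Real.exp b * (R + C) * |s - s'| := by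
    intro s hs s' hs' hss x hx
    have hHR : suppFun (K s) x ≤ R := suppFun_le (hK s hs).isCompact (hK s hs).nonempty
      fun z hz => by
        refine (real_inner_le_norm _ _).trans ?_
        rw [mem_sphere_zero_iff_norm.1 hx, one_mul]
        exact hR s (hsub hs) z hz
    have hH := (hK s hs).suppFun_pos (ne_zero_of_mem_sphere_one hx)
    have h1 := hC s hs s' hs' hss x hx
    have h2 : Real.exp (-s') * suppFun (K s') x ≤ Real.exp (-s) * suppFun (K s) x :=
      hflow.antitoneOn_exp_neg_mul hsmooth hf hx (hsub hs) (hsub hs') hss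
    have hexp : ∀ u y : ℝ, Real.exp u * (Real.exp (-u) * y) = y := fun u y => by
      rw [← mul_assoc, ← Real.exp_add]; simp
    have h3 : Real.exp s ≤ Real.exp s' := Real.exp_le_exp.2 hss
    have h4 : Real.exp s' ≤ Real.exp b := Real.exp_le_exp.2 hs'.2
    have hd : 0 ≤ s' - s := sub_nonneg.2 hss
    rw [abs_sub_comm s, abs_of_nonneg hd, abs_le]
    constructor
    · have h5 : suppFun (K s') x ≤ Real.exp (s' - s) * suppFun (K s) x := by
        have h6 := mul_le_mul_of_nonneg_left h2 (Real.exp_pos s').le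
        rwa [hexp, ← mul_assoc, ← Real.exp_add, ← sub_eq_add_neg] at h6
      have h6 : Real.exp (s' - s) - 1 ≤ (s' - s) * Real.exp b :=
        (exp_sub_one_le _).trans (by gcongr; linarith [hs.1, hs'.2])
      have h7 : (Real.exp (s' - s) - 1) * suppFun (K s) x ≤ (s' - s) * Real.exp b * R := by
        gcongr
      have h8 : 0 ≤ Real.exp b * C * (s' - s) := by positivity
      linarith
    · have h5 : suppFun (K s) x - suppFun (K s') x ≤ Real.exp s' *
          (Real.exp (-s) * suppFun (K s) x - Real.exp (-s') * suppFun (K s') x) := by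
        rw [mul_sub, hexp s']
        have h6 := mul_le_mul_of_nonneg_right h3
          (mul_pos (Real.exp_pos (-s)) hH).le
        rw [hexp] at h6
        linarith
      have h6 : Real.exp s' *
          (Real.exp (-s) * suppFun (K s) x - Real.exp (-s') * suppFun (K s') x) ≤
          Real.exp b * (C * (s' - s)) := by
        refine mul_le_mul h4 h1 (by linarith) (Real.exp_pos b).le
      have h7 : 0 ≤ Real.exp b * R * (s' - s) := by positivity
      linarith
  refine ⟨Real.exp b * (R + C), by positivity, fun s hs s' hs' x hx => ?_⟩
  rcases le_total s s' with hss | hss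
  · exact key s hs s' hs' hss x hx
  · rw [abs_sub_comm, abs_sub_comm s]
    exact key s' hs' s hs hss x hx

lemma IsGaussChordFlow.hasDerivWithinAt_integral (hn : n ≠ 0) (hq : 1 < q) (hp : 0 < p)
    (hfc : Continuous f) (hf : ∀ x ∈ Metric.sphere (0 : Eucl n) 1, 0 < f x)
    (hsmooth : ∀ t ∈ Set.Ico (0 : ℝ) T, IsSmoothBody (K t))
    (hflow : IsGaussChordFlow q p f (Set.Ico 0 T) K) {t : ℝ} (ht : t ∈ Set.Ico 0 T) :
    HasDerivWithinAt (fun s => ∫ u, f (u : Eucl n) * suppFun (K s) u ^ p ∂sphereMeasure n)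
      (∫ u, f (u : Eucl n) * (flowRHS q p f (K t) u * p * suppFun (K t) u ^ (p - 1))
        ∂sphereMeasure n) (Set.Ico 0 T) t := by
  have := isFiniteMeasure_sphereMeasure hn
  set b := (t + T) / 2 with hb
  have htb : t < b := by linarith [ht.2]
  have hbT : b < T := by linarith [ht.2]
  have hb0 : 0 ≤ b := ht.1.trans htb.le
  have htmem : t ∈ Set.Icc 0 b := ⟨ht.1, htb.le⟩
  have hsub : Set.Icc 0 b ⊆ Set.Ico 0 T := fun s hs => ⟨hs.1, hs.2.trans_lt hbT⟩
  have hK : ∀ s ∈ Set.Icc 0 b, IsSmoothBody (K s) := fun s hs => hsmooth s (hsub hs)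
  obtain ⟨R, hR0, hR⟩ := hflow.exists_forall_norm_le (hb0.trans_lt hbT) hsmooth hf
  obtain ⟨C, hC0, hC⟩ := hflow.exists_abs_suppFun_sub_le hn hq hp hfc hf hsmooth hb0 hbT
  have hcontH : Continuous fun a : Set.Icc 0 b × Metric.sphere (0 : Eucl n) 1 =>
      suppFun (K a.1) a.2 :=
    (hflow.continuous_suppFun_Icc hsmooth hbT hR).comp
      (f := fun a : Set.Icc 0 b × Metric.sphere (0 : Eucl n) 1 => (a.1, (a.2 : Eucl n)))
      (by fun_prop)
  have hpos : ∀ a : Set.Icc 0 b × Metric.sphere (0 : Eucl n) 1, 0 < suppFun (K a.1) a.2 :=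
    fun a => (hK a.1 a.1.2).suppFun_pos (ne_zero_of_mem_sphere_one a.2.2)
  obtain ⟨c, hc, hcH⟩ := exists_pos_forall_le_of_continuous hcontH hpos
  obtain ⟨M, -, hMH⟩ := exists_pos_forall_ge_of_continuous hcontH
  obtain ⟨L, hL0, hL⟩ := exists_abs_rpow_sub_le (M := M) hc p
  obtain ⟨fm, hfm0, hfm⟩ := exists_pos_forall_ge_of_continuous
    (F := fun u : Metric.sphere (0 : Eucl n) 1 => f u) (hfc.comp continuous_subtype_val)
  have hmem : Set.Icc 0 b ∈ 𝓝[Set.Ico 0 T] t := by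
    filter_upwards [self_mem_nhdsWithin, mem_nhdsWithin_of_mem_nhds (Iio_mem_nhds htb)] with s h h'
    exact ⟨h.1, h'.le⟩
  refine (hasDerivWithinAt_integral_of_abs_sub_le (C := fm * (L * C)) htmem (fun s hs => ?_)
    (fun s hs u => ?_) fun u => ?_).mono_of_mem_nhdsWithin hmem
  · refine Continuous.integrable_of_hasCompactSupport ?_ (HasCompactSupport.of_compactSpace _)
    exact (hfc.comp continuous_subtype_val).mul
      (((continuous_suppFun (hK s hs).isCompact (hK s hs).nonempty).comp
        continuous_subtype_val).rpow_const fun u => Or.inl (hpos (⟨s, hs⟩, u)).ne')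
  · rw [← mul_sub, abs_mul, abs_of_pos (hf u u.2)]
    have h1 := hL _ ⟨hcH (⟨s, hs⟩, u), hMH (⟨s, hs⟩, u)⟩ _
      ⟨hcH (⟨t, htmem⟩, u), hMH (⟨t, htmem⟩, u)⟩
    have h2 := hC s hs t htmem u u.2
    calc f u * |suppFun (K s) u ^ p - suppFun (K t) u ^ p|
        ≤ fm * (L * (C * |s - t|)) :=
          mul_le_mul (hfm u) (h1.trans (mul_le_mul_of_nonneg_left h2 hL0)) (abs_nonneg _) hfm0.le
      _ = fm * (L * C) * |s - t| := by ring
  · exact (((hflow t ht u u.2).mono hsub).rpow_const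
      (Or.inl (hpos (⟨t, htmem⟩, u)).ne')).const_mul (f u)

end

/-- The equality case of the Cauchy-Schwarz inequality `(∫ v)² ≤ ∫ v² / w * ∫ w`. -/
lemma integral_sub_sq_div_nonpos {Y : Type*} [TopologicalSpace Y] [CompactSpace Y]
    [MeasurableSpace Y] [BorelSpace Y] {μ : Measure Y} [IsFiniteMeasure μ]
    [μ.IsOpenPosMeasure] {v w : Y → ℝ} {c : ℝ} (hv : Continuous v) (hw : Continuous w)
    (hw0 : ∀ y, 0 < w y) (hc : 0 < c) (hcvw : c * ∫ y, v y ∂μ = ∫ y, w y ∂μ) :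
    ∫ y, (v y - c * (v y ^ 2 / w y)) ∂μ ≤ 0 ∧
      (∫ y, (v y - c * (v y ^ 2 / w y)) ∂μ = 0 ↔ ∀ y, c⁻¹ * w y = v y) := by
  have hint : ∀ F : Y → ℝ, Continuous F → Integrable F μ := fun F hF =>
    hF.integrable_of_hasCompactSupport (HasCompactSupport.of_compactSpace _)
  set Q : Y → ℝ := fun y => c * (v y - c⁻¹ * w y) ^ 2 / w y with hQ
  have hQc : Continuous Q :=
    (continuous_const.mul ((hv.sub (continuous_const.mul hw)).pow 2)).div hw fun y => (hw0 y).ne'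
  have hQ0 : 0 ≤ Q := fun y => div_nonneg (by positivity) (hw0 y).le
  have hQeq : ∀ y, v y - c * (v y ^ 2 / w y) = (c⁻¹ * w y - v y) - Q y := fun y => by
    have := (hw0 y).ne'
    simp only [hQ]
    field_simp
    ring
  have h1 : ∫ y, (v y - c * (v y ^ 2 / w y)) ∂μ = -∫ y, Q y ∂μ := by
    simp_rw [hQeq]
    have hcw : Continuous fun y => c⁻¹ * w y := continuous_const.mul hw
    have hcwv : Continuous fun y => c⁻¹ * w y - v y := hcw.sub hv
    rw [integral_sub (hint _ hcwv) (hint _ hQc), integral_sub (hint _ hcw) (hint _ hv),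
      integral_const_mul, ← hcvw, inv_mul_cancel_left₀ hc.ne']
    ring
  rw [h1]
  refine ⟨neg_nonpos.2 (integral_nonneg hQ0), ?_⟩
  rw [neg_eq_zero, integral_eq_zero_iff_of_nonneg hQ0 (hint _ hQc),
    hQc.ae_eq_iff_eq μ continuous_zero, funext_iff]
  refine forall_congr' fun y => ?_
  simp only [hQ, Pi.zero_apply, div_eq_zero_iff, mul_eq_zero, hc.ne', (hw0 y).ne', false_or,
    or_false, sq_eq_zero_iff, sub_eq_zero]
  exact eq_comm

/-- (Lemma 3.2, case `p > 0`: the functional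
`Φ(Ω_t) = (1/p) ∫_{S^{n-1}} f h^p` is non-increasing along the flow, with equality at a
time `t` exactly when `h(·,t)` solves
`τ₁ Ṽ_{γ,q} h^{1-p} det(∇²h + hI) = f` with `τ₁ = 1/θ(t)`). -/
theorem functional_nonincreasing_p_pos
    (n : ℕ) (q p : ℝ) (hq : 1 < q) (hp : 0 < p) (T : ℝ) (hT : 0 < T)
    (f : Eucl n → ℝ) (hf : ContDiff ℝ (⊤ : ℕ∞) f)
    (hfpos : ∀ x ∈ Metric.sphere (0 : Eucl n) 1, 0 < f x)
    (hfeven : ∀ x : Eucl n, f (-x) = f x)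
    (K : ℝ → Set (Eucl n))
    (hsmooth : ∀ t ∈ Set.Ico (0 : ℝ) T, IsSmoothBody (K t))
    (hflow : IsGaussChordFlow q p f (Set.Ico 0 T) K) :
    ∀ t ∈ Set.Ico (0 : ℝ) T, ∃ d : ℝ,
      HasDerivWithinAt (fun s => (1 / p) *
          ∫ x in Metric.sphere (0 : Eucl n) 1,
            f x * suppFun (K s) x ^ p ∂μH[(n : ℝ) - 1])
        d (Set.Ico 0 T) t ∧
      d ≤ 0 ∧
      (d = 0 ↔ ∀ x ∈ Metric.sphere (0 : Eucl n) 1,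
        (theta q p f (K t))⁻¹ * Vtilde q (K t) (gradient (suppFun (K t)) x) *
          suppFun (K t) x ^ (1 - p) * curvDet (suppFun (K t)) x = f x) := by
  intro t ht
  rcases eq_or_ne n 0 with rfl | hn
  · have hS : Metric.sphere (0 : Eucl 0) 1 = ∅ :=
      Set.eq_empty_of_forall_notMem fun x hx =>
        ne_zero_of_mem_sphere_one hx (Subsingleton.elim _ _)
    exact ⟨0, by simp [hS, hasDerivWithinAt_const], le_rfl, by simp [hS]⟩
  have := isFiniteMeasure_sphereMeasure hn
  have := isOpenPosMeasure_sphereMeasure hn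
  have hfc := hf.continuous
  have h := hsmooth t ht
  have hHc : Continuous fun u : Metric.sphere (0 : Eucl n) 1 => suppFun (K t) u :=
    (continuous_suppFun h.isCompact h.nonempty).comp continuous_subtype_val
  have hH : ∀ u : Metric.sphere (0 : Eucl n) 1, 0 < suppFun (K t) u := fun u =>
    h.suppFun_pos (ne_zero_of_mem_sphere_one u.2)
  have hV := h.Vtilde_gradient_pos hn hq
  have hVc : Continuous fun u : Metric.sphere (0 : Eucl n) 1 =>
      Vtilde q (K t) (gradient (suppFun (K t)) u) :=
    (h.continuous_Vtilde hn hq).comp h.continuous_gradient_sphere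
  have hvc : Continuous fun u : Metric.sphere (0 : Eucl n) 1 => suppFun (K t) u ^ p * f u :=
    (hHc.rpow_const fun u => Or.inl (hH u).ne').mul (hfc.comp continuous_subtype_val)
  have hv0 := integral_sphereMeasure_pos hn hvc fun u =>
    mul_pos (Real.rpow_pos_of_pos (hH u) p) (hfpos u u.2)
  have hθ := h.theta_pos hn hq hp hfc hfpos
  obtain ⟨h1, h2⟩ := integral_sub_sq_div_nonpos (μ := sphereMeasure n) (c := theta q p f (K t))
    (w := fun u : Metric.sphere (0 : Eucl n) 1 => Vtilde q (K t) (gradient (suppFun (K t)) u) *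
      (suppFun (K t) u * curvDet (suppFun (K t)) u)) hvc
    (hVc.mul (hHc.mul h.continuous_curvDet_sphere))
    (fun u => mul_pos (hV u) (mul_pos (hH u) (h.curvDet_pos u.2))) hθ
    (by rw [h.theta_eq hn hq, div_mul_cancel₀ _ hv0.ne'])
  refine ⟨_, ?_, h1, h2.trans ?_⟩
  · simp_rw [setIntegral_sphere]
    refine ((hflow.hasDerivWithinAt_integral hn hq hp hfc hfpos hsmooth ht).const_mul
      (1 / p)).congr_deriv ?_
    rw [← integral_const_mul]
    refine integral_congr_ae (Eventually.of_forall fun u => ?_)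
    have h3 := (hH u).ne'
    have h4 := (hV u).ne'
    have h5 := (h.curvDet_pos u.2).ne'
    simp only [flowRHS_eq, flowSpeed, Real.rpow_sub (hH u), Real.rpow_one]
    field_simp
    ring
  · rw [Subtype.forall]
    refine forall₂_congr fun x hx => ?_
    have h3 := hH ⟨x, hx⟩
    have h4 := (Real.rpow_pos_of_pos h3 p).ne'
    simp only [Real.rpow_sub h3, Real.rpow_one]
    rw [mul_div_assoc', div_mul_eq_mul_div, div_eq_iff h4]
    constructor <;> intro h5 <;> linarith
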